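/- Let n ≥ 2, let f and g be meromorphic mappings of ℂ into ℙⁿ(ℂ) given by reduced representations with f linearly nondegenerate (f₀,…,fₙ linearly independent over ℂ), and let {H_i}_{i=1}^{2n+2} and {G_i}_{i=1}^{2n+2} be two families of hyperplanes of ℙⁿ(ℂ), each in general position. Assume: (a) f⁻¹(H_i) ∩ f⁻¹(H_j) = ∅ for all 1 ≤ i < j ≤ 2n+2; (b) f⁻¹(H_i) = g⁻¹(G_i) for i = 1,…,2n+1; (c) min(ν_{(f,H_{2n+2})}, n+1) = min(ν_{(g,G_{2n+2})}, n+1); (d) (f,H_v)·(g,G_j) = (g,G_v)·(f,H_j) at every point of ⋃_{i=1}^{2n+2} f⁻¹(H_i) ∖ f⁻¹(H_j), for all 1 ≤ v, j ≤ 2n+2. Then the map f×g : ℂ → ℙⁿ(ℂ)×ℙⁿ(ℂ) is algebraically degenerate. (One-variable case m = 1 of the paper's Theorem in Section 3.) -/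

import Mathlib

open MeasureTheory Filter Topology

noncomputable section

/-- `f` is a reduced representation of a meromorphic map `ℂ → ℙⁿ(ℂ)`:
the components are entire functions with no common zero
(hence not all identically zero). -/
def ReducedRepr (n : ℕ) (f : Fin (n + 1) → ℂ → ℂ) : Prop :=
  (∀ i, Differentiable ℂ (f i)) ∧ ∀ z : ℂ, ∃ i, f i z ≠ 0

/-- The entire function `(f, H) = a₀f₀ + ⋯ + aₙfₙ` attached to the hyperplane
with coefficient vector `a`. -/
def lform {n : ℕ} (a : Fin (n + 1) → ℂ) (f : Fin (n + 1) → ℂ → ℂ) (z : ℂ) : ℂ :=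
  ∑ i, a i * f i z

/-- The vanishing order of the entire function `F` at `z`
(the least `k` such that the `k`-th derivative does not vanish at `z`). -/
def vord (F : ℂ → ℂ) (z : ℂ) : ℕ :=
  sInf {k : ℕ | iteratedDeriv k F z ≠ 0}

/-- The hyperplanes with coefficient vectors `H 0, …, H (q-1)` are in general
position: any `n + 1` of the coefficient vectors are linearly independent. -/
def GenPos (n q : ℕ) (H : Fin q → Fin (n + 1) → ℂ) : Prop :=
  ∀ s : Finset (Fin q), s.card = n + 1 → LinearIndependent ℂ (fun i : s => H i.1)

/-- `f` and `g` share the hyperplane with coefficient vector `a` with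
multiplicity truncated by `d`: the truncated zero divisors of `(f,H)` and
`(g,H)` agree and `f(z) = g(z)` (as points of `ℙⁿ(ℂ)`) on `f⁻¹(H)`. -/
def SharesTrunc {n : ℕ} (f g : Fin (n + 1) → ℂ → ℂ) (a : Fin (n + 1) → ℂ) (d : ℕ) : Prop :=
  (∃ z, lform a f z ≠ 0) ∧ (∃ z, lform a g z ≠ 0) ∧
  (∀ z, min (vord (lform a f) z) d = min (vord (lform a g) z) d) ∧
  ∀ z, lform a f z = 0 → ∃ c : ℂ, c ≠ 0 ∧ ∀ i, g i z = c * f i z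

/-- The map `f × g : ℂ → ℙⁿ(ℂ) × ℙⁿ(ℂ)` is algebraically degenerate: a nonzero
polynomial `Q(v, w)`, homogeneous in `v` and in `w` separately, annihilates
`(f₀, …, fₙ, g₀, …, gₙ)`. -/
def AlgDeg {n : ℕ} (f g : Fin (n + 1) → ℂ → ℂ) : Prop :=
  ∃ Q : MvPolynomial (Fin (n + 1) ⊕ Fin (n + 1)) ℂ, Q ≠ 0 ∧
    (∃ d₁ : ℕ, MvPolynomial.IsWeightedHomogeneous (Sum.elim (fun _ => 1) (fun _ => 0)) Q d₁) ∧
    (∃ d₂ : ℕ, MvPolynomial.IsWeightedHomogeneous (Sum.elim (fun _ => 0) (fun _ => 1)) Q d₂) ∧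
    ∀ z : ℂ, MvPolynomial.eval (Sum.elim (fun i => f i z) (fun i => g i z)) Q = 0

open Real Metric in
theorem abs_sub_le_of_harmonicOnNhd {u : ℂ → ℝ} {R s : ℝ} (hs : 0 < s)
    (hu : InnerProductSpace.HarmonicOnNhd u (closedBall 0 R)) {w w' : ℂ}
    (hw : ‖w‖ ≤ R - s) (hw' : ‖w'‖ ≤ R - s) :
    |u w - u w'| ≤ 2 * R * ‖w - w'‖ / s ^ 2 * circleAverage (fun z => |u z|) 0 R := by
  have hR : 0 < R := by linarith [norm_nonneg w]
  have hcu : ContinuousOn u (sphere 0 |R|) := by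
    rw [abs_of_pos hR]; exact hu.continuousOn.mono sphere_subset_closedBall
  have hker : ∀ v : ℂ, ‖v‖ ≤ R - s →
      ContinuousOn ((Complex.re ∘ herglotzRieszKernel 0 v) • u) (sphere 0 |R|) := by
    intro v hv
    refine ContinuousOn.smul ?_ hcu
    refine Complex.continuous_re.comp_continuousOn ?_
    rw [herglotzRieszKernel_fun_def]
    refine ContinuousOn.div (by fun_prop) (by fun_prop) ?_
    intro x hx h0
    rw [abs_of_pos hR, mem_sphere_zero_iff_norm] at hx
    have : x = v := by linear_combination h0
    subst this; linarith
  have hball : ∀ v : ℂ, ‖v‖ ≤ R - s → v ∈ ball (0:ℂ) R := fun v hv => by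
    rw [mem_ball_zero_iff]; linarith
  rw [← hu.circleAverage_re_herglotzRieszKernel_smul (hball w hw),
    ← hu.circleAverage_re_herglotzRieszKernel_smul (hball w' hw'),
    ← circleAverage_sub (hker w hw).circleIntegrable' (hker w' hw').circleIntegrable']
  refine abs_circleAverage_le_circleAverage_abs.trans ?_
  rw [← smul_eq_mul (2 * R * ‖w - w'‖ / s ^ 2), ← circleAverage_fun_smul]
  refine circleAverage_mono ?_ ?_ ?_
  · exact (continuous_abs.comp_continuousOn ((hker w hw).sub (hker w' hw'))).circleIntegrable'
  · exact ContinuousOn.circleIntegrable' (f := fun z => (2 * R * ‖w - w'‖ / s ^ 2) • |u z|)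
      ((continuous_const.mul continuous_abs).comp_continuousOn hcu)
  · intro x hx
    rw [abs_of_pos hR, mem_sphere_zero_iff_norm] at hx
    have h1 : ∀ v : ℂ, ‖v‖ ≤ R - s → s ≤ ‖x - v‖ := fun v hv => by
      have := norm_sub_norm_le x v; linarith
    have hne : ∀ v : ℂ, ‖v‖ ≤ R - s → x - v ≠ 0 := fun v hv h => by
      have := h1 v hv; rw [h, norm_zero] at this; linarith
    have h2 : herglotzRieszKernel 0 w x - herglotzRieszKernel 0 w' x
        = 2 * x * (w - w') / ((x - w) * (x - w')) := by
      rw [herglotzRieszKernel_def, herglotzRieszKernel_def]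
      have := hne w hw
      have := hne w' hw'
      simp only [sub_zero]
      field_simp
      ring
    simp only [Pi.abs_apply, Pi.sub_apply, smul_eq_mul, Pi.mul_apply, Function.comp_apply]
    rw [← sub_mul, abs_mul, ← Complex.sub_re, h2]
    refine mul_le_mul_of_nonneg_right ((Complex.abs_re_le_norm _).trans ?_) (abs_nonneg _)
    rw [norm_div, norm_mul, norm_mul, norm_mul, hx, Complex.norm_ofNat]
    refine div_le_div_of_nonneg_left (by positivity) (by positivity) ?_
    rw [sq]
    exact mul_le_mul (h1 w hw) (h1 w' hw') hs.le (norm_nonneg _)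

open Real in
theorem circleAverage_abs_log_norm_sub_le {R : ℝ} (hR : 1 ≤ R) {u : ℂ} (hu : ‖u‖ ≤ R) :
    circleAverage (fun z => |log ‖z - u‖|) 0 R ≤ 4 * R := by
  have hR0 : 0 < R := by linarith
  have hint : CircleIntegrable (fun z => log ‖z - u‖) 0 R :=
    MeromorphicOn.circleIntegrable_log_norm (fun z _ => by fun_prop)
  have h1 : circleAverage (fun z => |log ‖z - u‖|) 0 R
      ≤ circleAverage (fun z => 4 * R - log ‖z - u‖) 0 R := by
    refine circleAverage_mono hint.abs ((circleIntegrable_const _ _ _).sub hint) ?_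
    intro x hx
    rw [abs_of_pos hR0, mem_sphere_zero_iff_norm] at hx
    have h2 : ‖x - u‖ ≤ 2 * R := by linarith [norm_sub_le x u]
    have h3 : log ‖x - u‖ ≤ 2 * R := by
      rcases (norm_nonneg (x - u)).eq_or_lt with h | h
      · rw [← h]; simp; linarith
      · linarith [log_le_sub_one_of_pos h]
    rcases abs_cases (log ‖x - u‖) with h | h <;> linarith
  refine h1.trans ?_
  rw [circleAverage_fun_sub (circleIntegrable_const _ _ _) hint, circleAverage_const]
  have h4 : circleAverage (fun z => log ‖z - u‖) 0 R = log R := by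
    apply circleAverage_log_norm_sub_const_of_mem_closedBall
    rw [abs_of_pos hR0]; simpa using hu
  rw [h4]
  linarith [log_nonneg hR]

open Real Metric MeromorphicOn in
theorem norm_iteratedDeriv_le_local {F : ℂ → ℂ} (hF : Meromorphic F)
    (hF' : ∀ z, meromorphicOrderAt F z ≠ ⊤) {R s η ε m A : ℝ} (hR : 1 ≤ R)
    (hε : 0 < ε) (hεs : ε ≤ s) (hεη : 2 * ε ≤ η) (hεm : 2 * ε * m ≤ η)
    (hεA : 2 * R * ε * A ≤ s ^ 2)
    (hm : ∑ᶠ u, |(divisor F (closedBall 0 R) u : ℝ)| ≤ m)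
    (hA : circleAverage (fun z => |log ‖F z‖|) 0 R + m * (4 * R) ≤ A)
    {z₀ : ℂ} (hz₀ : ‖z₀‖ ≤ R - 2 * s)
    (hη : ∀ u, divisor F (closedBall 0 R) u ≠ 0 → η ≤ ‖z₀ - u‖)
    (han : AnalyticAt ℂ F z₀) (k : ℕ) :
    ‖iteratedDeriv k F z₀‖ ≤ k.factorial * (exp 2 * ‖F z₀‖) / ε ^ k := by
  classical
  have hs : 0 < s := hε.trans_le hεs
  have hη0 : 0 < η := by linarith
  have hR0 : 0 < R := by linarith
  set U := closedBall (0 : ℂ) R with hU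
  set D := divisor F U with hD
  have hfin : D.support.Finite := D.finiteSupport (isCompact_closedBall 0 R)
  obtain ⟨G, hG, hG0, hFG⟩ := (hF.meromorphicOn (s := U)).extract_zeros_poles (fun u => hF' u) hfin
  have hm' : ∑ u ∈ hfin.toFinset, |(D u : ℝ)| ≤ m := by
    rwa [finsum_eq_sum_of_support_subset] at hm
    intro x hx
    simpa using hx
  have hsupp : ∀ u ∈ hfin.toFinset, ‖u‖ ≤ R := by
    intro u hu
    have : u ∈ D.support := by simpa using hu
    simpa [hU] using D.supportWithinDomain this
  -- mean of `|log ‖G‖|`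
  have hlogG : (fun z => |log ‖G z‖|) =ᶠ[codiscreteWithin (sphere (0:ℂ) |R|)]
      (fun z => |log ‖F z‖ - ∑ u ∈ hfin.toFinset, (D u : ℝ) * log ‖z - u‖|) := by
    have h1 := extract_zeros_poles_log hG0 hFG
    have h2 : sphere (0:ℂ) |R| ⊆ U := by
      rw [abs_of_pos hR0]; exact sphere_subset_closedBall
    filter_upwards [h1.filter_mono (codiscreteWithin_mono h2)] with z hz
    rw [finsum_eq_sum_of_support_subset (s := hfin.toFinset)] at hz
    · rw [hz]; simp [← hD]
    · intro x hx
      by_contra h0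
      have h0' : D x = 0 := by simpa using h0
      exact hx (by ext z; simp [← hD, h0'])
  have hintF : CircleIntegrable (fun z => log ‖F z‖) 0 R :=
    MeromorphicOn.circleIntegrable_log_norm (fun z _ => hF z)
  have hintu : ∀ u, CircleIntegrable (fun z => log ‖z - u‖) 0 R := fun u =>
    MeromorphicOn.circleIntegrable_log_norm (fun z _ => by fun_prop)
  have hmean : circleAverage (fun z => |log ‖G z‖|) 0 R ≤ A := by
    rw [circleAverage_congr_codiscreteWithin hlogG hR0.ne']
    have hsumint : CircleIntegrable (fun z => ∑ u ∈ hfin.toFinset, (D u : ℝ) * log ‖z - u‖) 0 R :=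
      CircleIntegrable.fun_sum _ fun u _ => (hintu u).const_fun_smul
    have hsumint' : CircleIntegrable
        (fun z => ∑ u ∈ hfin.toFinset, |(D u : ℝ)| * |log ‖z - u‖|) 0 R :=
      CircleIntegrable.fun_sum _ fun u _ => (hintu u).abs.const_fun_smul
    have h1 : circleAverage
        (fun z => |log ‖F z‖ - ∑ u ∈ hfin.toFinset, (D u : ℝ) * log ‖z - u‖|) 0 R ≤
        circleAverage (fun z => |log ‖F z‖| +
          ∑ u ∈ hfin.toFinset, |(D u : ℝ)| * |log ‖z - u‖|) 0 R := by
      refine circleAverage_mono (hintF.sub hsumint).abs (hintF.abs.add hsumint') ?_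
      intro x _
      refine (abs_sub _ _).trans ?_
      gcongr
      refine (Finset.abs_sum_le_sum_abs _ _).trans (le_of_eq ?_)
      simp_rw [abs_mul]
    refine h1.trans ?_
    have hintF' : CircleIntegrable (fun z => |log ‖F z‖|) 0 R := hintF.abs
    rw [circleAverage_fun_add hintF' hsumint', circleAverage_fun_sum]
    · have h2 : ∑ u ∈ hfin.toFinset, circleAverage (fun z => |(D u : ℝ)| * |log ‖z - u‖|) 0 R
          ≤ ∑ u ∈ hfin.toFinset, |(D u : ℝ)| * (4 * R) := by
        refine Finset.sum_le_sum fun u hu => ?_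
        have := circleAverage_fun_smul (f := fun z => |log ‖z - u‖|) (c := 0) (R := R)
          (a := |(D u : ℝ)|)
        simp only [smul_eq_mul] at this
        rw [this]
        exact mul_le_mul_of_nonneg_left (circleAverage_abs_log_norm_sub_le hR (hsupp u hu))
          (abs_nonneg _)
      rw [← Finset.sum_mul] at h2
      have h3 : (∑ u ∈ hfin.toFinset, |(D u : ℝ)|) * (4 * R) ≤ m * (4 * R) := by gcongr
      linarith
    · intro u _
      exact (hintu u).abs.const_fun_smul
  have hharm : InnerProductSpace.HarmonicOnNhd (fun z => log ‖G z‖) U := fun z hz =>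
    (hG z hz).harmonicAt_log_norm (hG0 ⟨z, hz⟩)
  -- the comparison function
  set P : ℂ → ℂ := ∏ᶠ u, (· - u) ^ D u with hP
  have hPz : ∀ z, P z = ∏ u ∈ hfin.toFinset, (z - u) ^ D u := by
    intro z
    rw [hP, finprod_eq_prod_of_mulSupport_subset (s := hfin.toFinset)]
    · simp
    · rw [Function.FactorizedRational.mulSupport]; simp
  have hfar : ∀ ζ, ‖ζ - z₀‖ ≤ ε → ∀ u, D u ≠ 0 → η / 2 ≤ ‖ζ - u‖ := by
    intro ζ hζ u hu
    have h1 := hη u hu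
    have h2 : ‖z₀ - u‖ ≤ ‖ζ - z₀‖ + ‖ζ - u‖ := by
      have := norm_sub_le (ζ - u) (ζ - z₀)
      simp only [sub_sub_sub_cancel_left] at this
      linarith
    linarith
  have hD0 : ∀ ζ, ‖ζ - z₀‖ ≤ ε → D ζ = 0 := by
    intro ζ hζ
    by_contra h
    have := hfar ζ hζ ζ h
    simp at this; linarith
  have hζR : ∀ ζ, ‖ζ - z₀‖ ≤ ε → ‖ζ‖ ≤ R - s := by
    intro ζ hζ
    have := norm_le_norm_add_norm_sub' ζ z₀
    linarith
  have hζU : ∀ ζ, ‖ζ - z₀‖ ≤ ε → ζ ∈ U := by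
    intro ζ hζ
    have := hζR ζ hζ
    simp [hU]; linarith
  have hanP : ∀ ζ, ‖ζ - z₀‖ ≤ ε → AnalyticAt ℂ (P • G) ζ := fun ζ hζ =>
    (Function.FactorizedRational.analyticAt (hD0 ζ hζ).ge).smul (hG ζ (hζU ζ hζ))
  have hz₀ε : ‖z₀ - z₀‖ ≤ ε := by simpa using hε.le
  have hne : ∀ ζ, ‖ζ - z₀‖ ≤ ε → (P • G) ζ ≠ 0 := fun ζ hζ =>
    mul_ne_zero (Function.FactorizedRational.ne_zero (hD0 ζ hζ)) (hG0 ⟨ζ, hζU ζ hζ⟩)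
  have hlogPG : ∀ ζ, ‖ζ - z₀‖ ≤ ε → log ‖(P • G) ζ‖ =
      ∑ u ∈ hfin.toFinset, (D u : ℝ) * log ‖ζ - u‖ + log ‖G ζ‖ := by
    intro ζ hζ
    have h1 : P ζ ≠ 0 := Function.FactorizedRational.ne_zero (hD0 ζ hζ)
    have h2 := hG0 ⟨ζ, hζU ζ hζ⟩
    rw [Pi.smul_apply', smul_eq_mul, norm_mul, log_mul (by simpa using h1) (by simpa using h2)]
    congr 1
    rw [hPz, norm_prod, log_prod]
    · refine Finset.sum_congr rfl fun u _ => ?_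
      rw [norm_zpow, log_zpow]
    · intro u hu
      have h3 : D u ≠ 0 := by simpa using hu
      have := hfar ζ hζ u h3
      rw [norm_ne_zero_iff]
      refine zpow_ne_zero _ ?_
      rw [← norm_pos_iff]; linarith
  have hratio : ∀ ζ ∈ sphere z₀ ε, ‖(P • G) ζ‖ ≤ exp 2 * ‖(P • G) z₀‖ := by
    intro ζ hζ
    rw [mem_sphere_iff_norm] at hζ
    have h1 : log ‖(P • G) ζ‖ - log ‖(P • G) z₀‖ ≤ 2 := by
      rw [hlogPG ζ hζ.le, hlogPG z₀ hz₀ε]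
      have h2 : log ‖G ζ‖ - log ‖G z₀‖ ≤ 1 := by
        have h3 := (le_abs_self _).trans (abs_sub_le_of_harmonicOnNhd hs hharm (hζR ζ hζ.le)
          (hζR z₀ hz₀ε))
        refine h3.trans ?_
        rw [hζ, div_mul_eq_mul_div, div_le_one (by positivity)]
        refine le_trans ?_ hεA
        gcongr
      have h4 : ∑ u ∈ hfin.toFinset, (D u : ℝ) * log ‖ζ - u‖
          - ∑ u ∈ hfin.toFinset, (D u : ℝ) * log ‖z₀ - u‖ ≤ 1 := by
        rw [← Finset.sum_sub_distrib]
        have h5 : ∀ u ∈ hfin.toFinset, (D u : ℝ) * log ‖ζ - u‖ - (D u : ℝ) * log ‖z₀ - u‖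
            ≤ |(D u : ℝ)| * (2 * ε / η) := by
          intro u hu
          have h6 : D u ≠ 0 := by simpa using hu
          have h7 := hfar ζ hζ.le u h6
          have h8 := hfar z₀ hz₀ε u h6
          have h9 : ∀ a b : ℝ, η / 2 ≤ a → η / 2 ≤ b → a ≤ b + ε → log a - log b ≤ 2 * ε / η := by
            intro a b ha hb hab
            have hb0 : 0 < b := by linarith
            have ha0 : 0 < a := by linarith
            rw [← log_div ha0.ne' hb0.ne']
            refine (log_le_sub_one_of_pos (by positivity)).trans ?_
            rw [sub_le_iff_le_add, div_le_iff₀ hb0, add_mul, one_mul]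
            have : ε ≤ 2 * ε / η * b := by
              rw [div_mul_eq_mul_div, le_div_iff₀ hη0]; nlinarith
            linarith
          have h10 : ‖ζ - u‖ ≤ ‖z₀ - u‖ + ε := by
            have := norm_add_le (z₀ - u) (ζ - z₀)
            rw [show z₀ - u + (ζ - z₀) = ζ - u by ring] at this
            linarith
          have h11 : ‖z₀ - u‖ ≤ ‖ζ - u‖ + ε := by
            have := norm_sub_le (ζ - u) (ζ - z₀)
            rw [show ζ - u - (ζ - z₀) = z₀ - u by ring] at this
            linarith
          rw [← mul_sub]
          refine (le_abs_self _).trans ?_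
          rw [abs_mul]
          refine mul_le_mul_of_nonneg_left ?_ (abs_nonneg _)
          rw [abs_le]
          constructor
          · linarith [h9 _ _ h8 h7 h11]
          · exact h9 _ _ h7 h8 h10
        refine (Finset.sum_le_sum h5).trans ?_
        rw [← Finset.sum_mul]
        have : (∑ u ∈ hfin.toFinset, |(D u : ℝ)|) * (2 * ε / η) ≤ m * (2 * ε / η) := by gcongr
        refine this.trans ?_
        rw [mul_div_assoc', div_le_one hη0]
        linarith
      linarith
    have hp1 : 0 < ‖(P • G) ζ‖ := norm_pos_iff.2 (hne ζ hζ.le)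
    have hp2 : 0 < ‖(P • G) z₀‖ := norm_pos_iff.2 (hne z₀ hz₀ε)
    rw [← exp_log hp1, ← exp_log hp2, ← exp_add]
    exact exp_le_exp.2 (by linarith)
  have heq : F =ᶠ[𝓝 z₀] P • G := by
    refine (han.frequently_eq_iff_eventually_eq (hanP z₀ hz₀ε)).1 ?_
    have h1 : U ∈ 𝓝 z₀ := by
      refine mem_of_superset (closedBall_mem_nhds z₀ hε) fun ζ hζ => hζU ζ ?_
      simpa [dist_eq_norm] using hζ
    have h2 := mem_codiscreteWithin_iff_forall_mem_nhdsNE.1 hFG z₀ (mem_of_mem_nhds h1)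
    have h3 : ∀ᶠ z in 𝓝[≠] z₀, F z = (P • G) z := by
      filter_upwards [h2, nhdsWithin_le_nhds h1] with z hz hzU
      rcases hz with hz | hz
      · exact hz
      · exact absurd hzU hz
    exact h3.frequently
  rw [heq.iteratedDeriv_eq k, heq.eq_of_nhds]
  refine Complex.norm_iteratedDeriv_le_of_forall_mem_sphere_norm_le k hε ?_ hratio
  refine DifferentiableOn.diffContOnCl fun ζ hζ => ?_
  have : ζ ∈ closedBall z₀ ε := closure_ball_subset_closedBall hζ
  exact (hanP ζ (by simpa [dist_eq_norm] using this)).differentiableAt.differentiableWithinAt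

open Real Function.locallyFinsuppWithin in
theorem sum_mul_log_le_logCounting {E : Function.locallyFinsupp ℂ ℤ} (hE : 0 ≤ E) (s : Finset ℂ)
    {R R' : ℝ} (hR : 1 ≤ R) (hRR' : R ≤ R') (hs : ∀ u ∈ s, ‖u‖ ≤ R) :
    (∑ u ∈ s, (E u : ℝ)) * (log R' - log R) ≤ logCounting E R' := by
  classical
  have h1 : ∑ u ∈ s, (E u) • (single u (1 : ℤ) : Function.locallyFinsupp ℂ ℤ) ≤ E := by
    intro z
    have h2 : (∑ u ∈ s, (E u) • (single u (1 : ℤ) : Function.locallyFinsupp ℂ ℤ)) z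
        = if z ∈ s then E z else 0 := by
      simp only [coe_sum, coe_zsmul, Finset.sum_apply, Pi.smul_apply, smul_eq_mul, single_apply]
      simp
    rw [h2]
    split_ifs
    · exact le_rfl
    · exact hE z
  refine le_trans ?_ (logCounting_le h1 (hR.trans hRR'))
  rw [map_sum, Finset.sum_apply, Finset.sum_mul]
  refine Finset.sum_le_sum fun u hu => ?_
  rw [map_zsmul, Pi.smul_apply, logCounting_single_eq_log_sub_const ((hs u hu).trans hRR'),
    zsmul_eq_mul]
  have h3 : log ‖u‖ ≤ log R := by
    rcases (norm_nonneg u).eq_or_lt with h | h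
    · rw [← h, log_zero]; exact log_nonneg hR
    · exact log_le_log h (hs u hu)
  have h4 : (0:ℝ) ≤ E u := by exact_mod_cast hE u
  gcongr
  simp only [Int.cast_one, one_mul]
  linarith

theorem exists_growth_le {Φ : ℝ → ℝ} (hΦ : MonotoneOn Φ (Set.Ici 1)) (hΦr : ∀ r, 1 ≤ r → r ≤ Φ r)
    (r₀ : ℝ) : ∃ r, r₀ ≤ r ∧ 1 ≤ r ∧ Φ (r + 1 / Φ r) ≤ 2 * Φ r := by
  by_contra! hcon
  set a := max r₀ 1 with ha
  let x : ℕ → ℝ := fun k => (fun r => r + 1 / Φ r)^[k] a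
  have hx : ∀ k, x (k + 1) = x k + 1 / Φ (x k) := fun k => by
    simp only [x, Function.iterate_succ_apply']
  have hmain : ∀ k, a ≤ x k ∧ 2 ^ k ≤ Φ (x k) ∧ x k ≤ a + 2 - 2 * (1 / 2) ^ k := by
    intro k
    induction k with
    | zero =>
      refine ⟨le_rfl, ?_, by simp [x]⟩
      have : 1 ≤ a := le_max_right _ _
      have := hΦr a this
      simp only [x, Function.iterate_zero, id, pow_zero]; linarith
    | succ k ih =>
      obtain ⟨h1, h2, h3⟩ := ih
      have h5 : 1 ≤ x k := (le_max_right _ _).trans h1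
      have h4 := hcon (x k) ((le_max_left _ _).trans h1) h5
      have h6 : (0:ℝ) < 2 ^ k := by positivity
      have h7 : 0 < 1 / Φ (x k) := by
        have := hΦr _ h5
        have : 0 < Φ (x k) := by linarith
        positivity
      have h8 : 1 / Φ (x k) ≤ (1 / 2) ^ k := by
        rw [div_pow, one_pow]
        exact one_div_le_one_div_of_le h6 h2
      rw [hx]
      refine ⟨by linarith, ?_, ?_⟩
      · rw [pow_succ]; linarith
      · rw [pow_succ]; linarith
  have ha1 : 1 ≤ a := le_max_right _ _
  obtain ⟨k, hk⟩ := pow_unbounded_of_one_lt (Φ (a + 2)) (one_lt_two)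
  obtain ⟨h1, h2, h3⟩ := hmain k
  have h4 : Φ (x k) ≤ Φ (a + 2) := by
    apply hΦ
    · exact ha1.trans h1
    · simp; linarith
    · have : (0:ℝ) < (1 / 2) ^ k := by positivity
      linarith
  linarith

theorem exists_mem_Icc_far (s : Finset ℂ) {T : Set ℝ} (hT : T.Countable) {a ℓ η : ℝ}
    (hη : 0 ≤ η) (h : 2 * η * s.card < ℓ) :
    ∃ r ∈ Set.Icc a (a + ℓ), r ∉ T ∧ ∀ u ∈ s, η ≤ |r - ‖u‖| := by
  have h1 : volume (T ∪ ⋃ u ∈ s, Metric.ball ‖u‖ η) < volume (Set.Icc a (a + ℓ)) := by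
    refine (measure_union_le _ _).trans_lt ?_
    rw [hT.measure_zero, zero_add]
    refine (measure_biUnion_finset_le _ _).trans_lt ?_
    simp only [Real.volume_ball, Real.volume_Icc, Finset.sum_const, nsmul_eq_mul]
    rw [← ENNReal.ofReal_natCast, ← ENNReal.ofReal_mul (by positivity),
      ENNReal.ofReal_lt_ofReal_iff_of_nonneg (by positivity)]
    linarith
  obtain ⟨r, hr, hr'⟩ : ∃ r ∈ Set.Icc a (a + ℓ), r ∉ T ∪ ⋃ u ∈ s, Metric.ball ‖u‖ η := by
    by_contra! hcon
    exact absurd (measure_mono (μ := volume) hcon) h1.not_ge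
  refine ⟨r, hr, fun h => hr' (Or.inl h), fun u hu => ?_⟩
  by_contra! hlt
  exact hr' (Or.inr (Set.mem_biUnion hu (by rwa [Metric.mem_ball, Real.dist_eq])))

open Real Metric MeromorphicOn ValueDistribution Function in
theorem exists_divisor_bound {F : ℂ → ℂ} (hF : Meromorphic F) :
    ∃ c : ℝ, 1 ≤ c ∧ ∀ R R' Y : ℝ, 1 ≤ R → R ≤ R' → characteristic F ⊤ R ≤ Y →
      characteristic F ⊤ R' ≤ Y →
      (∑ᶠ u, |(divisor F (closedBall 0 R) u : ℝ)|) * (log R' - log R) ≤ 2 * Y + c ∧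
      circleAverage (fun z => |log ‖F z‖|) 0 R ≤ 2 * Y + c := by
  classical
  refine ⟨max 1 (max |log ‖F 0‖| |log ‖meromorphicTrailingCoeffAt F 0‖|), le_max_left _ _, ?_⟩
  set c := max 1 (max |log ‖F 0‖| |log ‖meromorphicTrailingCoeffAt F 0‖|)
  intro R R' Y hR hRR' hY hY'
  have hinv : ∀ x, characteristic F⁻¹ ⊤ x ≤ characteristic F ⊤ x + c := by
    intro x
    have h1 := characteristic_sub_characteristic_inv_le (R := x) hF
    have h2 := abs_le.1 (h1.trans (le_max_right 1 _))
    linarith [h2.1]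
  have hchar : ∀ x, characteristic F⁻¹ ⊤ x = proximity F 0 x + logCounting F 0 x := by
    intro x
    rw [characteristic, proximity_inv, logCounting_inv]; rfl
  have hchar' : ∀ x, characteristic F ⊤ x = proximity F ⊤ x + logCounting F ⊤ x := fun x => rfl
  have p0 : ∀ x, 0 ≤ proximity F 0 x := fun x => proximity_nonneg x
  have p1 : ∀ x, 0 ≤ proximity F ⊤ x := fun x => proximity_nonneg x
  have l0 : ∀ x, 1 ≤ x → 0 ≤ logCounting F 0 x := fun x hx => logCounting_nonneg hx
  have l1 : ∀ x, 1 ≤ x → 0 ≤ logCounting F ⊤ x := fun x hx => logCounting_nonneg hx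
  constructor
  · set D := divisor F Set.univ
    have hfin : (divisor F (closedBall (0:ℂ) R)).support.Finite :=
      (divisor F (closedBall (0:ℂ) R)).finiteSupport (isCompact_closedBall 0 R)
    have h1 : ∑ᶠ u, |(divisor F (closedBall 0 R) u : ℝ)|
        = ∑ u ∈ hfin.toFinset, ((D⁺ + D⁻ : Function.locallyFinsupp ℂ ℤ) u : ℝ) := by
      rw [finsum_eq_sum_of_support_subset (s := hfin.toFinset)]
      · refine Finset.sum_congr rfl fun u hu => ?_
        have hu' : u ∈ closedBall (0:ℂ) R := by
          have : u ∈ (divisor F (closedBall (0:ℂ) R)).support := by simpa using hu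
          exact (divisor F (closedBall (0:ℂ) R)).supportWithinDomain this
        have h2 : divisor F (closedBall (0:ℂ) R) u = D u := by
          rw [divisor_apply (fun z _ => hF z) hu', divisor_apply (fun z _ => hF z) (Set.mem_univ _)]
        rw [h2, ← Int.cast_abs]
        congr 1
        change _ = (D⁺) u + (D⁻) u
        change |D u| = (D u)⁺ + (D u)⁻
        exact (posPart_add_negPart (D u)).symm
      · intro u hu
        simp only [Function.mem_support, ne_eq, abs_eq_zero, Int.cast_eq_zero] at hu
        simpa using hu
    rw [h1]
    refine (sum_mul_log_le_logCounting (add_nonneg (posPart_nonneg _) (negPart_nonneg _)) _ hR hRR' ?_).trans ?_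
    · intro u hu
      have : u ∈ (divisor F (closedBall (0:ℂ) R)).support := by simpa using hu
      simpa using (divisor F (closedBall (0:ℂ) R)).supportWithinDomain this
    · rw [map_add, Pi.add_apply, ← logCounting_zero, ← logCounting_top]
      have := hinv R'; have := hchar R'; have := hchar' R'; have := p0 R'; have := p1 R'
      linarith
  · have h1 : circleAverage (fun z => |log ‖F z‖|) 0 R = proximity F ⊤ R + proximity F 0 R := by
      rw [proximity_top, proximity_zero, ← circleAverage_fun_add]
      · refine congrArg (fun h => circleAverage h 0 R) ?_
        funext z
        rw [posLog, posLog, log_inv]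
        rcases le_total 0 (log ‖F z‖) with h | h
        · rw [abs_of_nonneg h, max_eq_right h, max_eq_left (by linarith), add_zero]
        · rw [abs_of_nonpos h, max_eq_left h, max_eq_right (by linarith), zero_add]
      · exact MeromorphicOn.circleIntegrable_posLog_norm (fun z _ => hF z)
      · have := MeromorphicOn.circleIntegrable_posLog_norm (c := 0) (R := R) (f := F⁻¹) (fun z _ => (hF z).inv)
        simpa using this
    have := hinv R; have := hchar R; have := hchar' R; have := l0 R hR; have := l1 R hR
    linarith

set_option maxHeartbeats 1600000 in
open Real Metric MeromorphicOn ValueDistribution Function in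
theorem exists_good_radii {ι : Type*} [Fintype ι] (F : ι → ℂ → ℂ) (hF : ∀ i, Meromorphic (F i))
    (hF' : ∀ i z, meromorphicOrderAt (F i) z ≠ ⊤) (Φ : ℝ → ℝ) (hΦ : MonotoneOn Φ (Set.Ici 1))
    (hΦr : ∀ r, 1 ≤ r → r ≤ Φ r) (hchar : ∀ i, ∀ r, 1 ≤ r → characteristic (F i) ⊤ r ≤ Φ r)
    {S : Set ℂ} (hS : S.Countable) (K : ℕ) :
    ∃ B : ℝ, 1 ≤ B ∧ ∀ r₀ : ℝ, ∃ r, r₀ ≤ r ∧ 1 ≤ r ∧ (∀ z ∈ S, ‖z‖ ≠ r) ∧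
      ∀ i, ∀ k ≤ K, ∀ z : ℂ, ‖z‖ = r → AnalyticAt ℂ (F i) z →
        ‖iteratedDeriv k (F i) z‖ ≤ B * Φ r ^ (7 * K) * ‖F i z‖ := by
  classical
  choose c hc1 hc using fun i => exists_divisor_bound (hF i)
  set c₀ : ℝ := 1 + ∑ i, c i with hc₀
  have hc₀i : ∀ i, c i ≤ c₀ := fun i => by
    have := Finset.single_le_sum (f := c) (fun j _ => zero_le_one.trans (hc1 j)) (Finset.mem_univ i)
    linarith
  have hc₀1 : 1 ≤ c₀ := by
    have := Finset.sum_nonneg (fun j (_ : j ∈ Finset.univ) => zero_le_one.trans (hc1 j))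
    linarith
  set q : ℝ := Fintype.card ι + 1 with hq
  have hq1 : 1 ≤ q := by rw [hq]; have : (0:ℝ) ≤ Fintype.card ι := by positivity
                         linarith
  set B₀ : ℝ := 2 ^ 16 * c₀ ^ 2 * q with hB₀
  have hB₀1 : 1 ≤ B₀ := by
    have : 1 ≤ c₀ ^ 2 := one_le_pow₀ hc₀1
    rw [hB₀]; nlinarith [mul_le_mul this hq1 zero_le_one (by positivity)]
  refine ⟨K.factorial * exp 2 * B₀ ^ K, ?_, fun r₀ => ?_⟩
  · have h1 : (1:ℝ) ≤ K.factorial := by exact_mod_cast Nat.factorial_pos K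
    have h2 : (1:ℝ) ≤ exp 2 := one_le_exp (by norm_num)
    have h3 : 1 ≤ B₀ ^ K := one_le_pow₀ hB₀1
    nlinarith [mul_le_mul h1 h2 zero_le_one (by positivity), mul_le_mul (mul_le_mul h1 h2 zero_le_one (by positivity)) h3 zero_le_one (by positivity)]
  obtain ⟨r₁, hr₀, hr₁, hgrow⟩ := exists_growth_le hΦ hΦr r₀
  set X := Φ r₁ with hX
  have hXr : r₁ ≤ X := hΦr _ hr₁
  have hX1 : 1 ≤ X := hr₁.trans hXr
  have hX0 : 0 < X := by linarith
  set δ : ℝ := 1 / X with hδ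
  have hδ0 : 0 < δ := by positivity
  have hδ1 : δ ≤ 1 := by rw [hδ]; exact (div_le_one hX0).2 hX1
  have hδX : δ * X = 1 := by rw [hδ]; field_simp
  set R := r₁ + δ / 2 with hR
  set R' := r₁ + δ with hR'
  have hR1 : 1 ≤ R := by linarith
  have hRR' : R ≤ R' := by linarith
  have hΦR : Φ R ≤ 2 * X := (hΦ (by simpa using hR1) (by simp; linarith) hRR').trans hgrow
  have hlog : 1 / (4 * X ^ 2) ≤ log R' - log R := by
    rw [← log_div (by linarith) (by linarith)]
    have h1 : 1 - (R' / R)⁻¹ ≤ log (R' / R) := one_sub_inv_le_log_of_pos (by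
      have : 0 < R := by linarith
      have : 0 < R' := by linarith
      positivity)
    refine le_trans ?_ h1
    have hR'0 : 0 < R' := by linarith
    rw [inv_div, one_sub_div hR'0.ne', div_le_div_iff₀ (by positivity) hR'0]
    have : R' ≤ 2 * X := by linarith
    have e : (R' - R) * (4 * X ^ 2) = 2 * X * (δ * X) := by rw [hR', hR]; ring
    rw [e, hδX]; linarith
  set m : ℝ := 20 * c₀ * X ^ 3 with hm
  have hmi : ∀ i, ∑ᶠ u, |(divisor (F i) (closedBall 0 R) u : ℝ)| ≤ m := by
    intro i
    have h1 := (hc i R R' (2 * X) hR1 hRR' ((hchar i R hR1).trans hΦR)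
      ((hchar i R' (hR1.trans hRR')).trans hgrow)).1
    have h0 : 0 ≤ ∑ᶠ u, |(divisor (F i) (closedBall 0 R) u : ℝ)| := finsum_nonneg fun _ => abs_nonneg _
    have h2 := (mul_le_mul_of_nonneg_left hlog h0).trans h1
    rw [mul_one_div, div_le_iff₀ (by positivity)] at h2
    have h3 : 2 * (2 * X) + c i ≤ 5 * c₀ * X := by nlinarith [hc₀i i]
    calc _ ≤ _ := h2
      _ ≤ 5 * c₀ * X * (4 * X ^ 2) := by gcongr
      _ = m := by rw [hm]; ring
  have hAi : ∀ i, circleAverage (fun z => |log ‖F i z‖|) 0 R + m * (4 * R) ≤ 200 * c₀ * X ^ 4 := by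
    intro i
    have h1 := (hc i R R' (2 * X) hR1 hRR' ((hchar i R hR1).trans hΦR)
      ((hchar i R' (hR1.trans hRR')).trans hgrow)).2
    have h3 : 2 * (2 * X) + c i ≤ 5 * c₀ * X := by nlinarith [hc₀i i]
    have h4 : R ≤ 2 * X := by linarith
    have h5 : m * (4 * R) ≤ 20 * c₀ * X ^ 3 * (4 * (2 * X)) := by
      rw [hm]; gcongr
    have h6 : c₀ * X ≤ c₀ * X ^ 4 := by
      gcongr; exact le_self_pow₀ hX1 (by norm_num)
    calc _ ≤ 5 * c₀ * X + 20 * c₀ * X ^ 3 * (4 * (2 * X)) := by linarith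
      _ = 5 * (c₀ * X) + 160 * (c₀ * X ^ 4) := by ring
      _ ≤ _ := by nlinarith [show 0 ≤ c₀ * X ^ 4 by positivity]
  have hfin : ∀ i, (divisor (F i) (closedBall (0:ℂ) R)).support.Finite := fun i =>
    (divisor (F i) (closedBall (0:ℂ) R)).finiteSupport (isCompact_closedBall 0 R)
  set s : Finset ℂ := Finset.univ.biUnion fun i => (hfin i).toFinset with hs
  have hcard : (s.card : ℝ) ≤ q * m := by
    have h1 : ∀ i, ((hfin i).toFinset.card : ℝ) ≤ m := by
      intro i
      refine le_trans ?_ (hmi i)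
      rw [finsum_eq_sum_of_support_subset (s := (hfin i).toFinset), Finset.card_eq_sum_ones,
        Nat.cast_sum]
      · refine Finset.sum_le_sum fun u hu => ?_
        have hu' : divisor (F i) (closedBall (0:ℂ) R) u ≠ 0 := by simpa using hu
        have := Int.one_le_abs hu'
        rw [← Int.cast_abs]; exact_mod_cast this
      · intro u hu
        simp only [Function.mem_support, ne_eq, abs_eq_zero, Int.cast_eq_zero] at hu
        simpa using hu
    have h2 : (s.card : ℝ) ≤ ∑ i, ((hfin i).toFinset.card : ℝ) := by
      exact_mod_cast Finset.card_biUnion_le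
    refine h2.trans ((Finset.sum_le_sum fun i _ => h1 i).trans ?_)
    rw [Finset.sum_const, nsmul_eq_mul, Finset.card_univ]
    have hm0 : 0 ≤ m := by positivity
    gcongr
    linarith
  set η : ℝ := δ / (16 * (q * m + 1)) with hη
  have hm0 : 0 < m := by positivity
  have hη0 : 0 < η := by positivity
  obtain ⟨r, ⟨hra, hrb⟩, hrT, hrs⟩ := exists_mem_Icc_far s (T := Set.image norm S) (hS.image _)
    (a := r₁) (ℓ := δ / 4) hη0.le (by
      have h1 : η * (16 * (q * m + 1)) = δ := by rw [hη]; field_simp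
      nlinarith)
  have hr1 : 1 ≤ r := hr₁.trans hra
  have hXr' : X ≤ Φ r := hΦ (by simpa using hr₁) (by simpa using hr1) hra
  refine ⟨r, hr₀.trans hra, hr1, fun z hz h => hrT ⟨z, hz, h⟩, ?_⟩
  intro i k hk z hz han
  set ε : ℝ := 1 / (B₀ * X ^ 7) with hε
  have hε0 : 0 < ε := by positivity
  have hX7 : ∀ j ≤ 7, X ^ j ≤ X ^ 7 := fun j hj => pow_le_pow_right₀ hX1 hj
  have h2c : c₀ ≤ c₀ ^ 2 := le_self_pow₀ hc₀1 (by norm_num)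
  have hm1 : 1 ≤ m := by
    rw [hm]; nlinarith [mul_le_mul hc₀1 (one_le_pow₀ hX1 : 1 ≤ X ^ 3) zero_le_one (by positivity)]
  have hqm : 16 * (q * m + 1) ≤ 640 * (q * c₀ * X ^ 3) := by
    have : 1 ≤ q * m := by nlinarith
    rw [hm] at this ⊢; nlinarith
  have hηge : 1 / (640 * (q * c₀ * X ^ 4)) ≤ η := by
    have h0 : 0 < q * c₀ * X ^ 3 := by positivity
    calc 1 / (640 * (q * c₀ * X ^ 4)) = δ / (640 * (q * c₀ * X ^ 3)) := by rw [hδ]; field_simp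
      _ ≤ _ := by rw [hη]; gcongr
  have hkey := norm_iteratedDeriv_le_local (hF i) (hF' i) (R := R) (s := δ / 8) (η := η) (ε := ε)
    (m := m) (A := 200 * c₀ * X ^ 4) hR1 hε0 ?_ ?_ ?_ ?_ (hmi i) (hAi i) (z₀ := z) (by linarith) ?_ han k
  · refine hkey.trans ?_
    have e1 : (k.factorial * (exp 2 * ‖F i z‖) / ε ^ k : ℝ)
        = k.factorial * exp 2 * B₀ ^ k * X ^ (7 * k) * ‖F i z‖ := by
      rw [hε, pow_mul, one_div, inv_pow, div_inv_eq_mul, mul_pow]; ring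
    rw [e1]
    have h1 : B₀ ^ k ≤ B₀ ^ K := pow_le_pow_right₀ hB₀1 hk
    have h2 : X ^ (7 * k) ≤ Φ r ^ (7 * K) :=
      (pow_le_pow_right₀ hX1 (by omega)).trans (pow_le_pow_left₀ hX0.le hXr' _)
    have h3 : (k.factorial : ℝ) ≤ K.factorial := by exact_mod_cast Nat.factorial_le hk
    gcongr
  · rw [hε, hδ, div_div, div_le_div_iff₀ (by positivity) (by positivity)]
    have h1 : X ≤ X ^ 7 := le_self_pow₀ hX1 (by norm_num)
    have h2 : 8 * X ≤ B₀ * X ^ 7 := by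
      have : 8 ≤ B₀ := by
        rw [hB₀]; nlinarith [mul_le_mul (one_le_pow₀ hc₀1 : 1 ≤ c₀ ^ 2) hq1 zero_le_one (by positivity)]
      gcongr
    linarith
  · refine le_trans ?_ hηge
    rw [hε, mul_one_div, div_le_div_iff₀ (by positivity) (by positivity)]
    have h1 : c₀ * X ^ 4 ≤ c₀ ^ 2 * X ^ 7 := mul_le_mul h2c (hX7 4 (by norm_num)) (by positivity) (by positivity)
    have h2 : q * (c₀ * X ^ 4) ≤ q * (c₀ ^ 2 * X ^ 7) := by gcongr
    rw [hB₀]; nlinarith [show 0 ≤ q * (c₀ ^ 2 * X ^ 7) by positivity]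
  · refine le_trans ?_ hηge
    rw [hε, hm, mul_one_div, div_mul_eq_mul_div, div_le_div_iff₀ (by positivity) (by positivity)]
    have h2 : 0 ≤ q * (c₀ ^ 2 * X ^ 7) := by positivity
    calc 2 * (20 * c₀ * X ^ 3) * (640 * (q * c₀ * X ^ 4)) = 25600 * (q * (c₀ ^ 2 * X ^ 7)) := by ring
      _ ≤ 1 * (B₀ * X ^ 7) := by rw [hB₀]; linarith
  · have h4 : R ≤ 2 * X := by linarith
    calc 2 * R * ε * (200 * c₀ * X ^ 4) ≤ 2 * (2 * X) * ε * (200 * c₀ * X ^ 4) := by gcongr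
      _ = 800 * c₀ / (B₀ * X ^ 2) := by rw [hε]; field_simp; norm_num
      _ ≤ (δ / 8) ^ 2 := by
        rw [hδ, div_div, div_pow, one_pow, div_le_div_iff₀ (by positivity) (by positivity)]
        have h2 : c₀ * X ^ 2 ≤ c₀ ^ 2 * q * X ^ 2 := by
          have : c₀ ≤ c₀ ^ 2 * q := by nlinarith
          gcongr
        rw [hB₀]; nlinarith [show 0 ≤ c₀ * X ^ 2 by positivity]
  · intro u hu
    have hus : u ∈ s := by
      rw [hs]; simp only [Finset.mem_biUnion, Finset.mem_univ, true_and]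
      exact ⟨i, by simpa using hu⟩
    have := hrs u hus
    rw [← hz] at this
    exact this.trans (abs_norm_sub_norm_le z u)

/-- The Wronskian determinant of a finite family of functions of one complex variable. -/
def wronskian {N : ℕ} (φ : Fin N → ℂ → ℂ) (z : ℂ) : ℂ :=
  (Matrix.of fun i k : Fin N => iteratedDeriv k (φ i) z).det

theorem wronskian_matrix_mul {N : ℕ} (A : Matrix (Fin N) (Fin N) ℂ) {φ : Fin N → ℂ → ℂ} {z : ℂ}
    (hφ : ∀ i, AnalyticAt ℂ (φ i) z) :
    wronskian (fun i w => ∑ j, A i j * φ j w) z = A.det * wronskian φ z := by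
  rw [wronskian, wronskian, ← Matrix.det_mul]
  congr 1
  ext i k
  simp only [Matrix.of_apply, Matrix.mul_apply]
  have h1 : ∀ j ∈ Finset.univ, ContDiffAt ℂ (k : ℕ) (fun w => A i j * φ j w) z := fun j _ =>
    (analyticAt_const.mul (hφ j)).contDiffAt
  rw [iteratedDeriv_fun_sum h1]
  refine Finset.sum_congr rfl fun j _ => ?_
  rw [iteratedDeriv_const_mul_field]

theorem wronskian_mul_left {N : ℕ} {h : ℂ → ℂ} {φ : Fin N → ℂ → ℂ} {z : ℂ}
    (hh : AnalyticAt ℂ h z) (hφ : ∀ i, AnalyticAt ℂ (φ i) z) :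
    wronskian (fun i w => h w * φ i w) z = h z ^ N * wronskian φ z := by
  classical
  set U : Matrix (Fin N) (Fin N) ℂ := Matrix.of fun j k =>
    if j ≤ k then ((k : ℕ).choose j : ℂ) * iteratedDeriv (k - j : ℕ) h z else 0 with hU
  have hdet : U.det = h z ^ N := by
    rw [Matrix.det_of_isUpperTriangular]
    · simp [hU]
    · intro i j hij
      simp only [id] at hij
      simp [hU, not_le.2 hij]
  rw [← hdet, mul_comm, wronskian, wronskian, ← Matrix.det_mul]
  congr 1
  ext i k
  simp only [Matrix.of_apply, Matrix.mul_apply, hU]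
  have h1 : iteratedDeriv k (fun w => h w * φ i w) z
      = iteratedDeriv k (φ i * h) z := by
    congr 1; funext w; simp [mul_comm]
  rw [h1, iteratedDeriv_mul ((hφ i).contDiffAt) (hh.contDiffAt),
    ← Finset.sum_subset (Finset.subset_univ (Finset.univ.filter fun j : Fin N => j ≤ k))]
  · symm
    refine Finset.sum_bij (fun (j : Fin N) _ => (j : ℕ)) ?_ ?_ ?_ ?_
    · intro j hj
      simp only [Finset.mem_filter, Finset.mem_univ, true_and, Fin.le_def] at hj
      simp only [Finset.mem_range]; omega
    · intro a _ b _ hab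
      exact Fin.ext hab
    · intro b hb
      simp only [Finset.mem_range] at hb
      exact ⟨⟨b, by have := k.2; omega⟩, by
        rw [Finset.mem_filter, Fin.le_def]
        exact ⟨Finset.mem_univ _, Nat.lt_succ_iff.1 hb⟩, rfl⟩
    · intro j hj
      simp only [Finset.mem_filter, Finset.mem_univ, true_and] at hj
      rw [if_pos hj]; ring
  · intro j _ hj
    simp only [Finset.mem_filter, Finset.mem_univ, true_and] at hj
    rw [if_neg hj, mul_zero]

theorem wronskian_congr {N : ℕ} {φ ψ : Fin N → ℂ → ℂ} {z : ℂ} (h : ∀ i, φ i =ᶠ[𝓝 z] ψ i) :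
    wronskian φ z = wronskian ψ z := by
  rw [wronskian, wronskian]
  congr 1
  ext i k
  exact (h i).iteratedDeriv_eq k

theorem norm_det_le {N : ℕ} (A : Matrix (Fin N) (Fin N) ℂ) (a : Fin N → ℝ)
    {M : ℝ} (h : ∀ i k, ‖A i k‖ ≤ M * a i) :
    ‖A.det‖ ≤ N.factorial * (M ^ N * ∏ i, a i) := by
  rw [← Matrix.det_transpose, Matrix.det_apply]
  refine (norm_sum_le _ _).trans ?_
  refine (Finset.sum_le_card_nsmul _ _ (M ^ N * ∏ i, a i) fun σ _ => ?_).trans ?_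
  · have h1 : ‖Equiv.Perm.sign σ • ∏ i, A.transpose (σ i) i‖ = ‖∏ i, A.transpose (σ i) i‖ := by
      rcases Int.units_eq_one_or (Equiv.Perm.sign σ) with h | h <;> simp [h]
    rw [h1, norm_prod]
    refine (Finset.prod_le_prod (fun _ _ => norm_nonneg _) fun i _ => h i (σ i)).trans ?_
    rw [Finset.prod_mul_distrib]; simp
  · rw [Finset.card_univ, Fintype.card_perm, Fintype.card_fin, nsmul_eq_mul]

theorem differentiable_iteratedDeriv {F : ℂ → ℂ} (hF : Differentiable ℂ F) (k : ℕ) :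
    Differentiable ℂ (iteratedDeriv k F) := by
  have : ContDiff ℂ (k + 1 : ℕ) F := hF.contDiff
  exact this.differentiable_iteratedDeriv k (by exact_mod_cast Nat.lt_succ_self k)

theorem differentiable_wronskian {N : ℕ} {φ : Fin N → ℂ → ℂ} (hφ : ∀ i, Differentiable ℂ (φ i)) :
    Differentiable ℂ (wronskian φ) := by
  have : wronskian φ = fun z => ∑ σ : Equiv.Perm (Fin N), (Equiv.Perm.sign σ : ℂ) *
      ∏ i : Fin N, iteratedDeriv (i : ℕ) (φ (σ i)) z := by
    funext z
    rw [wronskian, Matrix.det_apply']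
    simp
  rw [this]
  have := fun i k => differentiable_iteratedDeriv (hφ i) k
  fun_prop

theorem wronskian_one_left {N : ℕ} {ψ : Fin (N + 1) → ℂ → ℂ} {z : ℂ} (h : ψ 0 =ᶠ[𝓝 z] fun _ => 1) :
    wronskian ψ z = wronskian (fun i : Fin N => deriv (ψ i.succ)) z := by
  rw [wronskian, Matrix.det_succ_row_zero, Finset.sum_eq_single 0]
  · simp only [Matrix.of_apply, Fin.val_zero, pow_zero, one_mul, iteratedDeriv_zero, h.eq_of_nhds,
      wronskian]
    congr 1
    ext i k
    simp [iteratedDeriv_succ']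
  · intro k _ hk
    obtain ⟨j, rfl⟩ := Fin.exists_succ_eq.2 hk
    simp [(h.iteratedDeriv_eq (j + 1)), iteratedDeriv_const]
  · simp

open Metric in
theorem exists_linear_relation_of_wronskian_eq_zero {N : ℕ} (φ : Fin N → ℂ → ℂ) {c : ℂ} {ρ : ℝ}
    (hρ : 0 < ρ) (hφ : ∀ i, AnalyticOnNhd ℂ (φ i) (ball c ρ))
    (hW : ∀ z ∈ ball c ρ, wronskian φ z = 0) :
    ∃ c' ρ', 0 < ρ' ∧ ball c' ρ' ⊆ ball c ρ ∧ ∃ a : Fin N → ℂ, a ≠ 0 ∧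
      ∀ z ∈ ball c' ρ', ∑ i, a i * φ i z = 0 := by
  induction N generalizing c ρ with
  | zero =>
    have := hW c (mem_ball_self hρ)
    simp [wronskian] at this
  | succ N ih =>
    by_cases h0 : ∀ z ∈ ball c ρ, φ 0 z = 0
    · refine ⟨c, ρ, hρ, subset_rfl, Pi.single 0 1, by simp, fun z hz => ?_⟩
      rw [Finset.sum_eq_single 0] <;> simp +contextual [h0 z hz]
    push Not at h0
    obtain ⟨z₁, hz₁, hne⟩ := h0
    obtain ⟨ρ₁, hρ₁, hsub⟩ : ∃ ρ₁ > 0, ball z₁ ρ₁ ⊆ ball c ρ ∩ {z | φ 0 z ≠ 0} := by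
      refine Metric.mem_nhds_iff.1 (Filter.inter_mem (isOpen_ball.mem_nhds hz₁) ?_)
      exact (hφ 0 z₁ hz₁).continuousAt.eventually_ne hne
    set ψ : Fin (N + 1) → ℂ → ℂ := fun i z => φ i z / φ 0 z with hψ
    have hψan : ∀ i, AnalyticOnNhd ℂ (ψ i) (ball z₁ ρ₁) := fun i z hz =>
      (hφ i z (hsub hz).1).fun_div (hφ 0 z (hsub hz).1) (hsub hz).2
    have hnhds : ∀ z ∈ ball z₁ ρ₁, ∀ᶠ w in 𝓝 z, φ 0 w ≠ 0 := fun z hz =>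
      (hφ 0 z (hsub hz).1).continuousAt.eventually_ne (hsub hz).2
    have hWψ : ∀ z ∈ ball z₁ ρ₁, wronskian (fun i : Fin N => deriv (ψ i.succ)) z = 0 := by
      intro z hz
      rw [← wronskian_one_left]
      · have h1 : wronskian φ z = wronskian (fun i w => φ 0 w * ψ i w) z := by
          refine wronskian_congr fun i => ?_
          filter_upwards [hnhds z hz] with w hw
          simp only [hψ]; field_simp
        rw [hW z (hsub hz).1, wronskian_mul_left (hφ 0 z (hsub hz).1) fun i => hψan i z hz] at h1
        have h2 : φ 0 z ≠ 0 := (hsub hz).2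
        simpa [h2] using h1.symm
      · filter_upwards [hnhds z hz] with w hw
        simp [hψ, hw]
    obtain ⟨c', ρ', hρ', hsub', b, hb, hrel⟩ := ih (fun i : Fin N => deriv (ψ i.succ)) hρ₁
      (fun i => (hψan _).deriv) hWψ
    set h : ℂ → ℂ := fun z => ∑ i, b i * ψ i.succ z with hh
    have hψd : ∀ i, ∀ z ∈ ball c' ρ', DifferentiableAt ℂ (ψ i) z := fun i z hz =>
      (hψan i z (hsub' hz)).differentiableAt
    have hconst : ∀ z ∈ ball c' ρ', h z = h c' := by
      intro z hz
      refine isOpen_ball.is_const_of_deriv_eq_zero (convex_ball c' ρ').isPreconnected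
        (fun w hw => ?_) (fun w hw => ?_) hz (mem_ball_self hρ')
      · have := fun i => hψd i w hw
        exact DifferentiableAt.differentiableWithinAt (by simp only [hh]; fun_prop)
      · have := fun i => hψd i w hw
        simp only [hh]
        rw [deriv_fun_sum (fun i _ => by fun_prop)]
        simp only [deriv_const_mul_field, Pi.zero_apply]
        exact hrel w hw
    refine ⟨c', ρ', hρ', fun z hz => (hsub (hsub' hz)).1, Fin.cons (-h c') b, ?_, fun z hz => ?_⟩
    · intro h0
      apply hb
      funext i
      simpa using congrFun h0 i.succ
    · have h1 := hconst z hz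
      have h2 : φ 0 z ≠ 0 := (hsub (hsub' hz)).2
      rw [Fin.sum_univ_succ]
      simp only [Fin.cons_zero, Fin.cons_succ]
      rw [← h1, hh]
      simp only [hψ, neg_mul, Finset.sum_mul]
      rw [neg_add_eq_zero]
      refine Finset.sum_congr rfl fun i _ => ?_
      field_simp

theorem AnalyticAt.iteratedDeriv' {F : ℂ → ℂ} {z : ℂ} (hF : AnalyticAt ℂ F z) (k : ℕ) :
    AnalyticAt ℂ (iteratedDeriv k F) z := by
  induction k with
  | zero => simpa
  | succ k ih => rw [iteratedDeriv_succ]; exact ih.deriv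

theorem exists_wronskian_ne_zero {N : ℕ} {φ : Fin N → ℂ → ℂ} (hφ : ∀ i, Differentiable ℂ (φ i))
    (hlin : LinearIndependent ℂ φ) : ∃ z, wronskian φ z ≠ 0 := by
  by_contra! hW
  obtain ⟨c', ρ', hρ', -, a, ha, hrel⟩ := exists_linear_relation_of_wronskian_eq_zero φ
    (c := 0) one_pos (fun i z _ => (hφ i).analyticAt z) (fun z _ => hW z)
  apply ha
  have h1 : (fun z => ∑ i, a i * φ i z) = fun _ => 0 := by
    refine AnalyticOnNhd.eq_of_eventuallyEq (z₀ := c') (𝕜 := ℂ) (fun z _ => ?_)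
      (fun z _ => analyticAt_const) ?_
    · have : Differentiable ℂ fun z => ∑ i, a i * φ i z := by fun_prop
      exact this.analyticAt z
    · filter_upwards [Metric.ball_mem_nhds c' hρ'] with z hz using hrel z hz
  funext i
  refine Fintype.linearIndependent_iff.1 hlin a ?_ i
  funext z
  simpa using congrFun h1 z

theorem le_analyticOrderAt_iteratedDeriv {F : ℂ → ℂ} {z : ℂ} (hF : AnalyticAt ℂ F z) {m : ℕ}
    (hm : (m : ℕ∞) ≤ analyticOrderAt F z) (k : ℕ) :
    ((m - k : ℕ) : ℕ∞) ≤ analyticOrderAt (iteratedDeriv k F) z := by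
  rw [natCast_le_analyticOrderAt_iff_iteratedDeriv_eq_zero (hF.iteratedDeriv' k)]
  rw [natCast_le_analyticOrderAt_iff_iteratedDeriv_eq_zero hF] at hm
  intro i hi
  have h1 : iteratedDeriv i (iteratedDeriv k F) = iteratedDeriv (i + k) F := by
    rw [iteratedDeriv_eq_iterate, iteratedDeriv_eq_iterate, iteratedDeriv_eq_iterate,
      Function.iterate_add_apply]
  rw [h1]
  exact hm _ (by omega)

theorem le_analyticOrderAt_wronskian {N : ℕ} {φ : Fin N → ℂ → ℂ} (hφ : ∀ i, Differentiable ℂ (φ i))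
    {a : Fin N → ℂ} (ha : a ≠ 0) {z : ℂ} {m : ℕ}
    (hm : (m : ℕ∞) ≤ analyticOrderAt (fun w => ∑ i, a i * φ i w) z) :
    ((m - (N - 1) : ℕ) : ℕ∞) ≤ analyticOrderAt (wronskian φ) z := by
  classical
  obtain ⟨j, hj⟩ := Function.ne_iff.1 ha
  simp only [Pi.zero_apply] at hj
  set L : ℂ → ℂ := fun w => ∑ i, a i * φ i w with hL
  have hLd : Differentiable ℂ L := by fun_prop
  have hex : ∀ k : Fin N, ∃ g : ℂ → ℂ, AnalyticAt ℂ g z ∧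
      ∀ᶠ w in 𝓝 z, iteratedDeriv k L w = (w - z) ^ (m - (N - 1)) • g w := by
    intro k
    rw [← natCast_le_analyticOrderAt ((hLd.analyticAt z).iteratedDeriv' k)]
    refine le_trans ?_ (le_analyticOrderAt_iteratedDeriv (hLd.analyticAt z) hm k)
    have := k.2
    exact_mod_cast (by omega : m - (N - 1) ≤ m - k)
  choose g hg hgL using hex
  rw [natCast_le_analyticOrderAt ((differentiable_wronskian hφ).analyticAt z)]
  set M : ℂ → Matrix (Fin N) (Fin N) ℂ := fun w => Matrix.of fun i k => iteratedDeriv k (φ i) w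
  refine ⟨fun w => (a j)⁻¹ * ((M w).updateRow j (fun k => g k w)).det, ?_, ?_⟩
  · refine analyticAt_const.mul ?_
    simp only [Matrix.det_apply']
    refine Finset.analyticAt_fun_sum _ fun σ _ => analyticAt_const.mul
      (Finset.analyticAt_fun_prod _ fun i _ => ?_)
    simp only [Matrix.updateRow_apply]
    split_ifs
    · exact hg _
    · exact ((hφ _).analyticAt z).iteratedDeriv' _
  · filter_upwards [Filter.eventually_all.2 hgL] with w hw
    have h1 : (fun k : Fin N => iteratedDeriv k L w) = ∑ i, a i • M w i := by
      funext k
      have h1 : ∀ j ∈ Finset.univ, ContDiffAt ℂ (k : ℕ) (fun w => a j * φ j w) w := fun j _ =>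
        (analyticAt_const.mul ((hφ j).analyticAt w)).contDiffAt
      rw [hL, iteratedDeriv_fun_sum h1]
      simp only [Finset.sum_apply, Pi.smul_apply, smul_eq_mul]
      refine Finset.sum_congr rfl fun i _ => ?_
      rw [iteratedDeriv_const_mul_field]; rfl
    have h2 := Matrix.det_updateRow_sum (M w) j a
    rw [← h1] at h2
    have h3 : (fun k : Fin N => iteratedDeriv k L w) = (w - z) ^ (m - (N - 1)) • fun k => g k w := by
      funext k; exact hw k
    rw [h3, Matrix.det_updateRow_smul] at h2
    change (M w).det = _
    rw [smul_eq_mul] at h2 ⊢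
    field_simp
    rw [mul_comm, ← h2]

theorem exists_pos_le_of_finite {ι : Type*} [Finite ι] {c : ι → ℝ} (hc : ∀ i, 0 < c i) :
    ∃ c₀ > 0, ∀ i, c₀ ≤ c i := by
  have := Fintype.ofFinite ι
  have h0 : 0 ≤ ∑ i, (c i)⁻¹ := Finset.sum_nonneg fun i _ => (inv_pos.2 (hc i)).le
  refine ⟨(1 + ∑ i, (c i)⁻¹)⁻¹, by positivity, fun i => ?_⟩
  rw [inv_le_comm₀ (by positivity) (hc i)]
  have := Finset.single_le_sum (f := fun i => (c i)⁻¹) (fun j _ => (inv_pos.2 (hc j)).le)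
    (Finset.mem_univ i)
  linarith

theorem exists_le_norm_mulVec {N : ℕ} {A : Matrix (Fin N) (Fin N) ℂ} (hA : IsUnit A) :
    ∃ c > 0, ∀ x : Fin N → ℂ, c * ‖x‖ ≤ ‖A.mulVec x‖ := by
  obtain ⟨K, hK, h⟩ := A.mulVecLin.exists_antilipschitzWith
    (LinearMap.ker_eq_bot.2 (Matrix.mulVec_injective_of_isUnit hA))
  refine ⟨(K : ℝ)⁻¹, by positivity, fun x => ?_⟩
  have h1 := h.le_mul_dist x 0
  simp only [dist_zero_right, map_zero, Matrix.mulVecLin_apply] at h1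
  rw [inv_mul_le_iff₀ (by positivity)]
  exact h1

theorem exists_pow_norm_mul_wronskian_le {N q : ℕ} (hN : 0 < N) (hNq : N ≤ q)
    (H : Fin q → Fin N → ℂ) (hH : ∀ e : Fin N ↪ Fin q, LinearIndependent ℂ fun i => H (e i)) :
    ∃ C : ℝ, 1 ≤ C ∧ ∀ (φ : Fin N → ℂ → ℂ) (z : ℂ), (∀ i, AnalyticAt ℂ (φ i) z) →
      (∀ v, ∑ i, H v i * φ i z ≠ 0) → ∀ M : ℝ, 1 ≤ M →
      (∀ v v₀, ∀ k < N, ‖iteratedDeriv k (fun w => (∑ i, H v i * φ i w) / ∑ i, H v₀ i * φ i w) z‖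
        ≤ M * ‖(∑ i, H v i * φ i z) / ∑ i, H v₀ i * φ i z‖) →
      ‖fun i => φ i z‖ ^ (q - N) * ‖wronskian φ z‖ ≤
        C * M ^ N * ∏ v, ‖∑ i, H v i * φ i z‖ := by
  classical
  have hunit : ∀ e : Fin N ↪ Fin q, IsUnit (Matrix.of fun i => H (e i)) := fun e =>
    Matrix.linearIndependent_rows_iff_isUnit.1 (hH e)
  choose c hc0 hc using fun e => exists_le_norm_mulVec (hunit e)
  obtain ⟨c₀, hc₀, hc₀le⟩ := exists_pos_le_of_finite hc0
  obtain ⟨d₀, hd₀, hd₀le⟩ := exists_pos_le_of_finite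
    (c := fun e : Fin N ↪ Fin q => ‖(Matrix.of fun i => H (e i)).det‖) fun e =>
      norm_pos_iff.2 ((Matrix.isUnit_iff_isUnit_det _).1 (hunit e)).ne_zero
  refine ⟨max 1 (N.factorial / (d₀ * c₀ ^ (q - N))), le_max_left _ _, ?_⟩
  intro φ z hφ hL0 M hM hder
  set L : Fin q → ℂ → ℂ := fun v w => ∑ i, H v i * φ i w with hL
  set x : Fin N → ℂ := fun i => φ i z with hx
  have hLan : ∀ v, AnalyticAt ℂ (L v) z := fun v =>
    Finset.analyticAt_fun_sum _ fun i _ => analyticAt_const.mul (hφ i)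
  have hemb : ∀ I : Finset (Fin q), I.card = N → ∃ e : Fin N ↪ Fin q, Finset.univ.map e = I :=
    fun I hI => ⟨(I.orderEmbOfFin hI).toEmbedding, Finset.map_orderEmbOfFin_univ I hI⟩
  set B : Finset (Fin q) := Finset.univ.filter fun v => ‖L v z‖ < c₀ * ‖x‖ with hB
  have hBcard : B.card ≤ N := by
    by_contra! hlt
    obtain ⟨I, hIB, hI⟩ := Finset.exists_subset_card_eq hlt.le
    obtain ⟨e, he⟩ := hemb I hI
    have hmem : ∀ i, ‖L (e i) z‖ < c₀ * ‖x‖ := fun i => by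
      have : e i ∈ B := hIB (he ▸ Finset.mem_map_of_mem e (Finset.mem_univ i))
      simpa [hB] using this
    have hpos : 0 < c₀ * ‖x‖ := (norm_nonneg _).trans_lt (hmem ⟨0, hN⟩)
    have h1 := hc e x
    have h2 : ‖(Matrix.of fun i => H (e i)).mulVec x‖ < c₀ * ‖x‖ := by
      rw [pi_norm_lt_iff hpos]
      exact hmem
    have := mul_le_mul_of_nonneg_right (hc₀le e) (norm_nonneg x)
    linarith
  obtain ⟨I, hBI, -, hI⟩ := Finset.exists_subsuperset_card_eq (Finset.subset_univ B) hBcard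
    (by simpa using hNq)
  obtain ⟨e, he⟩ := hemb I hI
  have hcompl : (c₀ * ‖x‖) ^ (q - N) ≤ ∏ v ∈ Iᶜ, ‖L v z‖ := by
    have h1 : Iᶜ.card = q - N := by rw [Finset.card_compl, hI, Fintype.card_fin]
    rw [← h1, ← Finset.prod_const]
    refine Finset.prod_le_prod (fun _ _ => by positivity) fun v hv => ?_
    by_contra! hlt
    exact (Finset.mem_compl.1 hv) (hBI (by simpa [hB] using hlt))
  have hprodI : ∏ v ∈ I, ‖L v z‖ = ∏ i, ‖L (e i) z‖ := by
    rw [← he, Finset.prod_map]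
  set A : Matrix (Fin N) (Fin N) ℂ := Matrix.of fun i => H (e i) with hA
  have hWA : wronskian (fun i => L (e i)) z = A.det * wronskian φ z := wronskian_matrix_mul A hφ
  set v₀ := e ⟨0, hN⟩
  have hWF : wronskian (fun i => L (e i)) z
      = L v₀ z ^ N * wronskian (fun i w => L (e i) w / L v₀ w) z := by
    rw [← wronskian_mul_left (hLan v₀) fun i => (hLan _).fun_div (hLan v₀) (hL0 v₀)]
    refine wronskian_congr fun i => ?_
    filter_upwards [(hLan v₀).continuousAt.eventually_ne (hL0 v₀)] with w hw
    field_simp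
  have hWFle : ‖wronskian (fun i w => L (e i) w / L v₀ w) z‖ ≤
      N.factorial * (M ^ N * ∏ i, ‖L (e i) z / L v₀ z‖) :=
    norm_det_le _ _ fun i k => hder (e i) v₀ k k.2
  have hWle : ‖A.det‖ * ‖wronskian φ z‖ ≤ N.factorial * (M ^ N * ∏ i, ‖L (e i) z‖) := by
    rw [← norm_mul, ← hWA, hWF, norm_mul, norm_pow]
    have hne : ‖L v₀ z‖ ≠ 0 := norm_ne_zero_iff.2 (hL0 v₀)
    refine (mul_le_mul_of_nonneg_left hWFle (by positivity)).trans (le_of_eq ?_)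
    simp only [norm_div, Finset.prod_div_distrib, Finset.prod_const, Finset.card_univ,
      Fintype.card_fin]
    field_simp
  rw [← Finset.prod_mul_prod_compl I, hprodI]
  have h1 : d₀ * ‖wronskian φ z‖ ≤ N.factorial * (M ^ N * ∏ i, ‖L (e i) z‖) :=
    (mul_le_mul_of_nonneg_right (hd₀le e) (norm_nonneg _)).trans hWle
  have h2 : (d₀ * c₀ ^ (q - N)) * (‖x‖ ^ (q - N) * ‖wronskian φ z‖) ≤
      N.factorial * (M ^ N * ((∏ i, ‖L (e i) z‖) * ∏ v ∈ Iᶜ, ‖L v z‖)) := by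
    calc _ = (c₀ * ‖x‖) ^ (q - N) * (d₀ * ‖wronskian φ z‖) := by rw [mul_pow]; ring
      _ ≤ (∏ v ∈ Iᶜ, ‖L v z‖) * (N.factorial * (M ^ N * ∏ i, ‖L (e i) z‖)) := by
        gcongr
      _ = _ := by ring
  rw [← le_div_iff₀' (by positivity)] at h2
  refine h2.trans ?_
  rw [mul_div_right_comm, mul_assoc]
  have h3 : 0 ≤ M ^ N * ((∏ i, ‖L (e i) z‖) * ∏ v ∈ Iᶜ, ‖L v z‖) := by
    have h4 := Finset.prod_nonneg (s := Finset.univ) fun i _ => norm_nonneg (L (e i) z)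
    have h5 := Finset.prod_nonneg (s := Iᶜ) fun i _ => norm_nonneg (L i z)
    positivity
  exact mul_le_mul_of_nonneg_right (le_max_right _ _) h3

open Real in
theorem continuousOn_log_norm {F : ℂ → ℂ} (hF : Continuous F) {s : Set ℂ} (h : ∀ z ∈ s, F z ≠ 0) :
    ContinuousOn (fun z => log ‖F z‖) s :=
  ContinuousOn.log hF.norm.continuousOn fun z hz => norm_ne_zero_iff.2 (h z hz)

open Real in
/-- Cartan's second main theorem on a circle on which the logarithmic derivatives are under
control. -/
theorem exists_circleAverage_log_wronskian_le {N q : ℕ} (hN : 0 < N) (hNq : N ≤ q)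
    (H : Fin q → Fin N → ℂ) (hH : ∀ e : Fin N ↪ Fin q, LinearIndependent ℂ fun i => H (e i)) :
    ∃ C : ℝ, 0 ≤ C ∧ ∀ φ : Fin N → ℂ → ℂ, (∀ i, Differentiable ℂ (φ i)) → ∀ r M : ℝ, 0 ≤ r → 1 ≤ M →
      (∀ z : ℂ, ‖z‖ = r → wronskian φ z ≠ 0 ∧ ∀ v, ∑ i, H v i * φ i z ≠ 0) →
      (∀ v v₀, ∀ k < N, ∀ z : ℂ, ‖z‖ = r →
        ‖iteratedDeriv k (fun w => (∑ i, H v i * φ i w) / ∑ i, H v₀ i * φ i w) z‖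
        ≤ M * ‖(∑ i, H v i * φ i z) / ∑ i, H v₀ i * φ i z‖) →
      ((q - N : ℕ) : ℝ) * circleAverage (fun z => log ‖fun i => φ i z‖) 0 r +
        circleAverage (fun z => log ‖wronskian φ z‖) 0 r ≤
        ∑ v, circleAverage (fun z => log ‖∑ i, H v i * φ i z‖) 0 r + C * (1 + log M) := by
  obtain ⟨C, hC1, hC⟩ := exists_pow_norm_mul_wronskian_le hN hNq H hH
  refine ⟨log C + N, add_nonneg (log_nonneg hC1) (by positivity), ?_⟩
  intro φ hφ r M hr hM hne hder
  have hW : CircleIntegrable (fun z => log ‖wronskian φ z‖) 0 r := by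
    refine ContinuousOn.circleIntegrable hr ?_
    exact continuousOn_log_norm (differentiable_wronskian hφ).continuous fun z hz =>
      (hne z (by simpa using hz)).1
  have hx0 : ∀ z : ℂ, ‖z‖ = r → (fun i => φ i z) ≠ 0 := by
    intro z hz h0
    have h1 := (hne z hz).2 ⟨0, hN.trans_le hNq⟩
    apply h1
    refine Finset.sum_eq_zero fun i _ => ?_
    have := congrFun h0 i
    simp only [Pi.zero_apply] at this
    rw [this, mul_zero]
  have hx : CircleIntegrable (fun z => log ‖fun i => φ i z‖) 0 r := by
    refine ContinuousOn.circleIntegrable hr ?_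
    refine ContinuousOn.log ?_ fun z hz => norm_ne_zero_iff.2 (hx0 z (by simpa using hz))
    have : Continuous fun z => (fun i => φ i z) := continuous_pi fun i => (hφ i).continuous
    exact this.norm.continuousOn
  have hL : ∀ v ∈ Finset.univ, CircleIntegrable (fun z => log ‖∑ i, H v i * φ i z‖) 0 r := by
    intro v _
    refine ContinuousOn.circleIntegrable hr ?_
    have : Differentiable ℂ fun z => ∑ i, H v i * φ i z := by fun_prop
    exact continuousOn_log_norm this.continuous fun z hz => (hne z (by simpa using hz)).2 v
  have hlogM : 0 ≤ log M := log_nonneg hM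
  have key : circleAverage (fun z => ((q - N : ℕ) : ℝ) • log ‖fun i => φ i z‖ + log ‖wronskian φ z‖) 0 r
      ≤ circleAverage (fun z => ∑ v, log ‖∑ i, H v i * φ i z‖ + (log C + N * log M)) 0 r := by
    refine circleAverage_mono ((hx.const_fun_smul).add hW) ((CircleIntegrable.fun_sum _ hL).add
      (circleIntegrable_const _ _ _)) ?_
    intro z hz
    have hz' : ‖z‖ = r := by simpa [abs_of_nonneg hr] using hz
    have h1 := hC φ z (fun i => (hφ i).analyticAt z) (hne z hz').2 M hM
      (fun v v₀ k hk => hder v v₀ k hk z hz')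
    have p1 : 0 < ‖fun i => φ i z‖ := norm_pos_iff.2 (hx0 z hz')
    have p2 : 0 < ‖wronskian φ z‖ := norm_pos_iff.2 (hne z hz').1
    have p3 : ∀ v, ‖∑ i, H v i * φ i z‖ ≠ 0 := fun v => norm_ne_zero_iff.2 ((hne z hz').2 v)
    have h2 := log_le_log (by positivity) h1
    rw [log_mul (by positivity) (by positivity), log_mul (by positivity)
      (Finset.prod_ne_zero_iff.2 fun v _ => p3 v), log_mul (by positivity) (by positivity),
      log_pow, log_pow, log_prod (fun v _ => p3 v)] at h2
    simp only [smul_eq_mul]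
    linarith
  rw [circleAverage_fun_add hx.const_fun_smul hW, circleAverage_fun_smul,
    circleAverage_fun_add (CircleIntegrable.fun_sum _ hL) (circleIntegrable_const _ _ _),
    circleAverage_fun_sum hL, circleAverage_const] at key
  refine key.trans ?_
  have h5 : log C + N * log M ≤ (log C + N) * (1 + log M) := by
    have := log_nonneg hC1
    nlinarith [show (0:ℝ) ≤ N by positivity]
  linarith

/-- An entire function that is not identically zero. -/
def EntireNZ (F : ℂ → ℂ) : Prop := Differentiable ℂ F ∧ ∃ z, F z ≠ 0

theorem EntireNZ.order_ne_top {F : ℂ → ℂ} (hF : EntireNZ F) (z : ℂ) : analyticOrderAt F z ≠ ⊤ := by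
  obtain ⟨w, hw⟩ := hF.2
  refine AnalyticOnNhd.analyticOrderAt_ne_top_of_isPreconnected (U := Set.univ)
    (fun z _ => hF.1.analyticAt z) isPreconnected_univ (Set.mem_univ w) (Set.mem_univ z) ?_
  rw [(hF.1.analyticAt w).analyticOrderAt_eq_zero.2 hw]
  exact ENat.zero_ne_top

theorem EntireNZ.cast_order {F : ℂ → ℂ} (hF : EntireNZ F) (z : ℂ) :
    (analyticOrderNatAt F z : ℕ∞) = analyticOrderAt F z :=
  Nat.cast_analyticOrderNatAt (hF.order_ne_top z)

theorem EntireNZ.le_order_iff {F : ℂ → ℂ} (hF : EntireNZ F) {z : ℂ} {k : ℕ} :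
    k ≤ analyticOrderNatAt F z ↔ (k : ℕ∞) ≤ analyticOrderAt F z := by
  rw [← hF.cast_order z]; norm_cast

theorem EntireNZ.order_eq_zero {F : ℂ → ℂ} (hF : EntireNZ F) {z : ℂ} :
    analyticOrderNatAt F z = 0 ↔ F z ≠ 0 := by
  rw [← (hF.1.analyticAt z).analyticOrderAt_eq_zero, ← hF.cast_order z]; norm_cast

theorem EntireNZ.mul {F G : ℂ → ℂ} (hF : EntireNZ F) (hG : EntireNZ G) :
    EntireNZ (fun z => F z * G z) := by
  refine ⟨hF.1.mul hG.1, ?_⟩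
  by_contra! h
  have h1 := analyticOrderAt_mul (hF.1.analyticAt 0) (hG.1.analyticAt 0)
  have h2 : analyticOrderAt (F * G) 0 = ⊤ := by
    rw [analyticOrderAt_eq_top]
    exact Eventually.of_forall h
  rw [h2, ← hF.cast_order, ← hG.cast_order] at h1
  exact ENat.natCast_ne_top (analyticOrderNatAt F 0 + analyticOrderNatAt G 0) (by
    rw [h1]; norm_cast)

theorem EntireNZ.order_mul {F G : ℂ → ℂ} (hF : EntireNZ F) (hG : EntireNZ G) (z : ℂ) :
    analyticOrderNatAt (fun z => F z * G z) z = analyticOrderNatAt F z + analyticOrderNatAt G z :=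
  analyticOrderNatAt_mul (hF.1.analyticAt z) (hG.1.analyticAt z) (hF.order_ne_top z)
    (hG.order_ne_top z)

theorem EntireNZ.prod {ι : Type*} (s : Finset ι) {F : ι → ℂ → ℂ} (hF : ∀ i ∈ s, EntireNZ (F i)) :
    EntireNZ (fun z => ∏ i ∈ s, F i z) := by
  classical
  induction s using Finset.induction_on with
  | empty => exact ⟨by simp, 0, by simp⟩
  | insert a s ha ih =>
    simp only [Finset.prod_insert ha]
    exact (hF a (by simp)).mul (ih fun i hi => hF i (by simp [hi]))

theorem EntireNZ.divisor_apply {F : ℂ → ℂ} (hF : EntireNZ F) (z : ℂ) :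
    MeromorphicOn.divisor F Set.univ z = (analyticOrderNatAt F z : ℤ) := by
  rw [MeromorphicOn.AnalyticOnNhd.divisor_apply (fun z _ => hF.1.analyticAt z) (Set.mem_univ z),
    ← hF.cast_order]
  rfl

theorem EntireNZ.meromorphic {F : ℂ → ℂ} (hF : EntireNZ F) : Meromorphic F :=
  fun z => (hF.1.analyticAt z).meromorphicAt

theorem EntireNZ.countable_zeros {F : ℂ → ℂ} (hF : EntireNZ F) : {z | F z = 0}.Countable := by
  refine (Set.countable_iUnion fun n : ℕ => ((MeromorphicOn.divisor F
    (Metric.closedBall (0:ℂ) n)).finiteSupport (isCompact_closedBall 0 n)).countable).mono ?_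
  intro z hz
  obtain ⟨n, hn⟩ := exists_nat_ge ‖z‖
  have hzn : z ∈ Metric.closedBall (0:ℂ) n := by simpa using hn
  refine Set.mem_iUnion.2 ⟨n, ?_⟩
  rw [Function.mem_support, MeromorphicOn.AnalyticOnNhd.divisor_apply
    (fun z _ => hF.1.analyticAt z) hzn, ← hF.cast_order]
  have : analyticOrderNatAt F z ≠ 0 := fun h => hF.order_eq_zero.1 h hz
  simpa using this

/-- The restriction of an integer-valued function to the support of a divisor. -/
def cutoff (D : Function.locallyFinsupp ℂ ℤ) (φ : ℂ → ℤ) : Function.locallyFinsupp ℂ ℤ where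
  toFun z := if D z = 0 then 0 else φ z
  supportWithinDomain' := Set.subset_univ _
  supportLocallyFiniteWithinDomain' z hz := by
    obtain ⟨t, ht, hfin⟩ := D.supportLocallyFiniteWithinDomain z hz
    refine ⟨t, ht, hfin.subset fun w hw => ⟨hw.1, ?_⟩⟩
    intro h0
    exact hw.2 (if_pos h0)

/-- The logarithmic counting function of `φ`, restricted to the zeros of `Z`. -/
def cnt (Z : ℂ → ℂ) (φ : ℂ → ℤ) (r : ℝ) : ℝ :=
  Function.locallyFinsuppWithin.logCounting (cutoff (MeromorphicOn.divisor Z Set.univ) φ) r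

theorem cnt_add (Z : ℂ → ℂ) (φ ψ : ℂ → ℤ) (r : ℝ) :
    cnt Z (fun z => φ z + ψ z) r = cnt Z φ r + cnt Z ψ r := by
  rw [cnt, cnt, cnt, ← Pi.add_apply, ← map_add]
  refine congrArg (fun D => Function.locallyFinsuppWithin.logCounting D r) ?_
  ext z
  change (if MeromorphicOn.divisor Z Set.univ z = 0 then 0 else φ z + ψ z)
    = (if MeromorphicOn.divisor Z Set.univ z = 0 then 0 else φ z)
      + (if MeromorphicOn.divisor Z Set.univ z = 0 then 0 else ψ z)
  split_ifs <;> simp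

theorem cnt_zero (Z : ℂ → ℂ) (r : ℝ) : cnt Z (fun _ => 0) r = 0 := by
  have := cnt_add Z (fun _ => 0) (fun _ => 0) r
  simp only [add_zero] at this
  linarith

theorem cnt_sub (Z : ℂ → ℂ) (φ ψ : ℂ → ℤ) (r : ℝ) :
    cnt Z (fun z => φ z - ψ z) r = cnt Z φ r - cnt Z ψ r := by
  have := cnt_add Z (fun z => φ z - ψ z) ψ r
  simp only [sub_add_cancel] at this
  linarith

theorem cnt_sum (Z : ℂ → ℂ) {ι : Type*} (s : Finset ι) (φ : ι → ℂ → ℤ) (r : ℝ) :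
    cnt Z (fun z => ∑ i ∈ s, φ i z) r = ∑ i ∈ s, cnt Z (φ i) r := by
  classical
  induction s using Finset.induction_on with
  | empty => simpa using cnt_zero Z r
  | insert a s ha ih => simp only [Finset.sum_insert ha]; rw [cnt_add, ih]

theorem cnt_nsmul (Z : ℂ → ℂ) (k : ℕ) (φ : ℂ → ℤ) (r : ℝ) :
    cnt Z (fun z => k * φ z) r = k * cnt Z φ r := by
  have := cnt_sum Z (Finset.range k) (fun _ => φ) r
  simpa using this

theorem cnt_mono {Z : ℂ → ℂ} (hZ : EntireNZ Z) {φ ψ : ℂ → ℤ} (h : ∀ z, Z z = 0 → φ z ≤ ψ z) {r : ℝ}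
    (hr : 1 ≤ r) : cnt Z φ r ≤ cnt Z ψ r := by
  refine Function.locallyFinsuppWithin.logCounting_le ?_ hr
  intro z
  change (if MeromorphicOn.divisor Z Set.univ z = 0 then 0 else φ z)
    ≤ (if MeromorphicOn.divisor Z Set.univ z = 0 then 0 else ψ z)
  split_ifs with h0
  · exact le_rfl
  · refine h z ?_
    by_contra hne
    exact h0 (by rw [hZ.divisor_apply, hZ.order_eq_zero.2 hne]; rfl)

theorem cnt_nonneg {Z : ℂ → ℂ} (hZ : EntireNZ Z) {φ : ℂ → ℤ} (h : ∀ z, Z z = 0 → 0 ≤ φ z) {r : ℝ}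
    (hr : 1 ≤ r) : 0 ≤ cnt Z φ r := by
  rw [← cnt_zero Z r]; exact cnt_mono hZ h hr

open Real in
/-- Jensen's formula, up to a bounded term. -/
theorem exists_abs_cnt_sub_circleAverage_le {Z : ℂ → ℂ} (hZ : EntireNZ Z) {F : ℂ → ℂ} (hF : EntireNZ F)
    (hFZ : ∀ z, F z = 0 → Z z = 0) : ∃ C, 0 ≤ C ∧ ∀ r, 1 ≤ r →
      |cnt Z (fun z => analyticOrderNatAt F z) r - circleAverage (fun z => log ‖F z‖) 0 r| ≤ C := by
  refine ⟨|log ‖meromorphicTrailingCoeffAt F 0‖|, abs_nonneg _, fun r hr => ?_⟩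
  have h1 := Function.locallyFinsuppWithin.logCounting_divisor_eq_circleAverage_sub_const
    hF.meromorphic (R := r) (by linarith)
  have h2 : cutoff (MeromorphicOn.divisor Z Set.univ) (fun z => analyticOrderNatAt F z)
      = MeromorphicOn.divisor F Set.univ := by
    ext z
    rw [hF.divisor_apply]
    change (if MeromorphicOn.divisor Z Set.univ z = 0 then 0 else (analyticOrderNatAt F z : ℤ)) = _
    split_ifs with h0
    · rw [hZ.divisor_apply] at h0
      have h3 := hZ.order_eq_zero.1 (by exact_mod_cast h0)
      rw [hF.order_eq_zero.2 fun h => h3 (hFZ z h)]; rfl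
    · rfl
  rw [cnt, h2, h1]
  simp

theorem EntireNZ.meromorphicOrderAt_div_ne_top {p q : ℂ → ℂ} (hp : EntireNZ p) (hq : EntireNZ q)
    (z : ℂ) : meromorphicOrderAt (fun w => p w / q w) z ≠ ⊤ := by
  have h1 : (fun w => p w / q w) = p * q⁻¹ := by funext w; simp [div_eq_mul_inv]
  rw [h1, meromorphicOrderAt_mul (hp.meromorphic z) (hq.meromorphic z).inv, meromorphicOrderAt_inv,
    (hp.1.analyticAt z).meromorphicOrderAt_eq, (hq.1.analyticAt z).meromorphicOrderAt_eq,
    ← hp.cast_order, ← hq.cast_order]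
  exact WithTop.coe_ne_top (a := (analyticOrderNatAt p z : ℤ) + -(analyticOrderNatAt q z : ℤ))

open Real ValueDistribution MeromorphicOn in
theorem exists_characteristic_div_le {p q : ℂ → ℂ} (hp : EntireNZ p) (hq : EntireNZ q) :
    ∃ C, 0 ≤ C ∧ ∀ r, 1 ≤ r → (∀ z : ℂ, ‖z‖ = r → p z ≠ 0 ∧ q z ≠ 0) →
      characteristic (fun w => p w / q w) ⊤ r ≤
        circleAverage (fun z => log (max ‖p z‖ ‖q z‖)) 0 r + C := by
  refine ⟨|log ‖meromorphicTrailingCoeffAt q 0‖|, abs_nonneg _, fun r hr hne => ?_⟩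
  have hr0 : 0 ≤ r := by linarith
  have hmer : Meromorphic (fun w => p w / q w) := fun z => (hp.meromorphic z).div (hq.meromorphic z)
  have h1 : (fun w => p w / q w) = p * q⁻¹ := by funext w; simp [div_eq_mul_inv]
  have hD : ∀ z, divisor (fun w => p w / q w) Set.univ z
      = (analyticOrderNatAt p z : ℤ) - analyticOrderNatAt q z := by
    intro z
    rw [MeromorphicOn.divisor_apply (fun z _ => hmer z) (Set.mem_univ z), h1,
      meromorphicOrderAt_mul (hp.meromorphic z) (hq.meromorphic z).inv, meromorphicOrderAt_inv,
      (hp.1.analyticAt z).meromorphicOrderAt_eq, (hq.1.analyticAt z).meromorphicOrderAt_eq,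
      ← hp.cast_order, ← hq.cast_order]
    exact WithTop.untop₀_coe ((analyticOrderNatAt p z : ℤ) + -(analyticOrderNatAt q z : ℤ))
  have h2 : logCounting (fun w => p w / q w) ⊤ r ≤
      Function.locallyFinsuppWithin.logCounting (divisor q Set.univ) r := by
    rw [logCounting_top]
    refine Function.locallyFinsuppWithin.logCounting_le ?_ hr
    intro z
    change (divisor (fun w => p w / q w) Set.univ z)⁻ ≤ _
    rw [hD, hq.divisor_apply, negPart_def]
    refine max_le ?_ ?_
    · omega
    · exact Int.natCast_nonneg _
  rw [Function.locallyFinsuppWithin.logCounting_divisor_eq_circleAverage_sub_const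
    hq.meromorphic (by linarith)] at h2
  have h3 : proximity (fun w => p w / q w) ⊤ r
      = circleAverage (fun z => log (max ‖p z‖ ‖q z‖)) 0 r - circleAverage (log ‖q ·‖) 0 r := by
    rw [proximity_top, ← circleAverage_fun_sub]
    · refine circleAverage_congr_sphere ?_
      intro z hz
      obtain ⟨hpz, hqz⟩ := hne z (by simpa [abs_of_nonneg hr0] using hz)
      have p1 : 0 < ‖p z‖ := norm_pos_iff.2 hpz
      have p2 : 0 < ‖q z‖ := norm_pos_iff.2 hqz
      change log⁺ ‖p z / q z‖ = log (max ‖p z‖ ‖q z‖) - log ‖q z‖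
      rw [norm_div, posLog, log_div p1.ne' p2.ne']
      rcases le_total ‖p z‖ ‖q z‖ with h | h
      · rw [max_eq_right h, max_eq_left (by have := log_le_log p1 h; linarith), sub_self]
      · rw [max_eq_left h, max_eq_right (by have := log_le_log p2 h; linarith)]
    · refine ContinuousOn.circleIntegrable hr0 (ContinuousOn.log ?_ fun z hz => ?_)
      · exact (hp.1.continuous.norm.max hq.1.continuous.norm).continuousOn
      · have p1 : 0 < ‖p z‖ := norm_pos_iff.2 (hne z (by simpa using hz)).1
        exact (lt_max_of_lt_left p1).ne'
    · exact ContinuousOn.circleIntegrable hr0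
        (continuousOn_log_norm hq.1.continuous fun z hz => (hne z (by simpa using hz)).2)
  change proximity (fun w => p w / q w) ⊤ r + logCounting (fun w => p w / q w) ⊤ r ≤ _
  have := neg_abs_le (log ‖meromorphicTrailingCoeffAt q 0‖)
  linarith

open Real ValueDistribution in
theorem exists_good_radius {Z : ℂ → ℂ} (hZ : EntireNZ Z) (𝓕 : Finset ((ℂ → ℂ) × (ℂ → ℂ)))
    (hFam : ∀ P ∈ 𝓕, EntireNZ P.1 ∧ EntireNZ P.2)
    (hFamZ : ∀ P ∈ 𝓕, ∀ z, P.1 z = 0 ∨ P.2 z = 0 → Z z = 0) (T : ℝ → ℝ) {c : ℝ}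
    (hT : ∀ P ∈ 𝓕, ∀ r, 1 ≤ r → (∀ z, Z z = 0 → ‖z‖ ≠ r) →
      circleAverage (fun z => log (max ‖P.1 z‖ ‖P.2 z‖)) 0 r ≤ c * T r + c)
    (hgrow : ∀ C : ℝ, ∃ r₀, ∀ r, r₀ ≤ r → C * log r ≤ T r) (K : ℕ) {ε : ℝ} (hε : 0 < ε) :
    ∃ r M : ℝ, 1 ≤ r ∧ 1 ≤ M ∧ (∀ z, Z z = 0 → ‖z‖ ≠ r) ∧
      (∀ P ∈ 𝓕, ∀ k ≤ K, ∀ z : ℂ, ‖z‖ = r →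
        ‖iteratedDeriv k (fun w => P.1 w / P.2 w) z‖ ≤ M * ‖P.1 z / P.2 z‖) ∧
      1 + log M ≤ ε * T r := by
  classical
  set Φ : ℝ → ℝ := fun r => r + ∑ P ∈ 𝓕, characteristic (fun w => P.1 w / P.2 w) ⊤ r with hΦdef
  have hmer : ∀ P ∈ 𝓕, Meromorphic (fun w => P.1 w / P.2 w) := fun P hP z =>
    ((hFam P hP).1.meromorphic z).div ((hFam P hP).2.meromorphic z)
  have hchar0 : ∀ P ∈ 𝓕, ∀ r, 1 ≤ r → 0 ≤ characteristic (fun w => P.1 w / P.2 w) ⊤ r :=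
    fun P _ r hr => characteristic_nonneg hr
  have hΦ : MonotoneOn Φ (Set.Ici 1) := by
    intro a ha b hb hab
    refine add_le_add hab (Finset.sum_le_sum fun P hP => ?_)
    exact characteristic_monotoneOn (hmer P hP) (Set.mem_Ioi.2 (zero_lt_one.trans_le ha))
      (Set.mem_Ioi.2 (zero_lt_one.trans_le hb)) hab
  have hΦr : ∀ r, 1 ≤ r → r ≤ Φ r := fun r hr => by
    have := Finset.sum_nonneg fun P hP => hchar0 P hP r hr
    simp only [hΦdef]; linarith
  obtain ⟨B, hB, hgood⟩ := exists_good_radii (ι := 𝓕) (fun P w => P.1.1 w / P.1.2 w)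
    (fun P => hmer P.1 P.2)
    (fun P z => (hFam P.1 P.2).1.meromorphicOrderAt_div_ne_top (hFam P.1 P.2).2 z) Φ hΦ hΦr
    (fun P r hr => by
      have := Finset.single_le_sum (f := fun P : (ℂ → ℂ) × (ℂ → ℂ) =>
        characteristic (fun w => P.1 w / P.2 w) ⊤ r) (fun P hP => hchar0 P hP r hr) P.2
      simp only [hΦdef] at this ⊢; linarith) hZ.countable_zeros K
  choose! C hC0 hC using fun (P : (ℂ → ℂ) × (ℂ → ℂ)) (hP : P ∈ 𝓕) =>
    exists_characteristic_div_le (hFam P hP).1 (hFam P hP).2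
  set a : ℝ := (𝓕.card : ℝ) * |c| with ha
  set b : ℝ := (𝓕.card : ℝ) * |c| + ∑ P ∈ 𝓕, C P with hb
  have ha0 : 0 ≤ a := by positivity
  have hb0 : 0 ≤ b := add_nonneg ha0 (Finset.sum_nonneg hC0)
  have hΦle : ∀ r, 1 ≤ r → (∀ z, Z z = 0 → ‖z‖ ≠ r) → 0 ≤ T r → Φ r ≤ r + a * T r + b := by
    intro r hr hZr hTr
    have h1 : ∀ P ∈ 𝓕, characteristic (fun w => P.1 w / P.2 w) ⊤ r ≤ (|c| * T r + |c|) + C P := by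
      intro P hP
      refine (hC P hP r hr fun z hz => ?_).trans ?_
      · exact ⟨fun h => hZr z (hFamZ P hP z (Or.inl h)) hz, fun h => hZr z (hFamZ P hP z (Or.inr h)) hz⟩
      · have := hT P hP r hr hZr
        have h2 : c * T r ≤ |c| * T r := mul_le_mul_of_nonneg_right (le_abs_self c) hTr
        linarith [le_abs_self c]
    have h2 := Finset.sum_le_sum h1
    rw [Finset.sum_add_distrib, Finset.sum_const, nsmul_eq_mul] at h2
    simp only [hΦdef, ha, hb]
    linarith
  have hlogo : ∀ᶠ x : ℝ in atTop, log x ≤ (ε / (4 * (7 * K + 1))) * x := by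
    have := isLittleO_log_id_atTop.bound (c := ε / (4 * (7 * K + 1))) (by positivity)
    filter_upwards [this, eventually_ge_atTop 1] with x hx hx1
    simpa [abs_of_nonneg (log_nonneg hx1), abs_of_nonneg (zero_le_one.trans hx1)] using hx
  obtain ⟨x₀, hx₀⟩ := eventually_atTop.1 hlogo
  set D : ℝ := 1 + log B + 7 * K * log (1 + a + b) with hD
  obtain ⟨r₁, hr₁⟩ := hgrow (4 * (7 * K + 1) / ε)
  obtain ⟨r₂, hr₂⟩ := hgrow 1
  set X : ℝ := max (max 1 x₀) (4 * D / ε) with hX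
  obtain ⟨r, hr, hr1, hrZ, hder⟩ := hgood (max (max r₁ r₂) (exp X))
  have hTr : X ≤ T r := by
    have h1 := hr₂ r ((le_max_right _ _).trans ((le_max_left _ _).trans hr))
    have h2 : X ≤ log r := (le_log_iff_exp_le (by linarith)).2 ((le_max_right _ _).trans hr)
    linarith
  have hT1 : 1 ≤ T r := ((le_max_left _ _).trans (le_max_left _ _)).trans hTr
  have hTx : x₀ ≤ T r := ((le_max_right _ _).trans (le_max_left _ _)).trans hTr
  have hTD : 4 * D / ε ≤ T r := (le_max_right _ _).trans hTr
  have hlogr := hr₁ r ((le_max_left _ _).trans ((le_max_left _ _).trans hr))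
  have hZr : ∀ z, Z z = 0 → ‖z‖ ≠ r := fun z hz => hrZ z hz
  have hΦ1 : 1 ≤ Φ r := hr1.trans (hΦr r hr1)
  have hM1 : 1 ≤ B * Φ r ^ (7 * K) := by
    have := one_le_pow₀ hΦ1 (n := 7 * K)
    nlinarith
  refine ⟨r, B * Φ r ^ (7 * K), hr1, hM1, hZr, ?_, ?_⟩
  · intro P hP k hk z hz
    refine hder ⟨P, hP⟩ k hk z hz ?_
    exact ((hFam P hP).1.1.analyticAt z).fun_div ((hFam P hP).2.1.analyticAt z)
      fun h => hZr z (hFamZ P hP z (Or.inr h)) hz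
  · have hΦ2 : Φ r ≤ (1 + a + b) * (r * T r) := by
      have h1 := hΦle r hr1 hZr (by linarith)
      have h2 : T r ≤ r * T r := le_mul_of_one_le_left (by linarith) hr1
      have h3 : r ≤ r * T r := le_mul_of_one_le_right (by linarith) hT1
      have h4 : a * T r ≤ a * (r * T r) := by gcongr
      have h5 : b * 1 ≤ b * (r * T r) := by gcongr; linarith
      linarith
    have hlogΦ : log (Φ r) ≤ log (1 + a + b) + (log r + log (T r)) := by
      have := log_le_log (by linarith) hΦ2
      rwa [log_mul (by linarith) (by positivity), log_mul (by linarith) (by linarith)] at this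
    rw [log_mul (by linarith) (by positivity), log_pow]
    push_cast
    have h1 := hx₀ (T r) hTx
    have h2 : log r ≤ ε / (4 * (7 * K + 1)) * T r := by
      rw [div_mul_eq_mul_div, le_div_iff₀ (by positivity)]
      rw [div_mul_eq_mul_div, div_le_iff₀ hε] at hlogr
      linarith
    have h3 : D ≤ ε / 4 * T r := by
      rw [div_le_iff₀ hε] at hTD; linarith
    have h4 : (7 * K : ℝ) * log (Φ r) ≤ 7 * K * (log (1 + a + b) + (log r + log (T r))) := by gcongr
    have h5 : (7 * K : ℝ) * (ε / (4 * (7 * K + 1)) * T r) ≤ ε / 4 * T r := by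
      have : (7 * K : ℝ) * (ε / (4 * (7 * K + 1)) * T r)
          = (7 * K / (7 * K + 1)) * (ε / 4 * T r) := by field_simp
      rw [this]
      refine mul_le_of_le_one_left (by positivity) ?_
      rw [div_le_one (by positivity)]; linarith
    have h6 : (7 * K : ℝ) * log r ≤ 7 * K * (ε / (4 * (7 * K + 1)) * T r) := by gcongr
    have h7 : (7 * K : ℝ) * log (T r) ≤ 7 * K * (ε / (4 * (7 * K + 1)) * T r) := by gcongr
    have h8 : 0 < ε * T r := by positivity
    linarith

/-- A nonzero entire function `Z` together with finitely many quotients of entire functions: the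
zeros of `Z` and the logarithmic derivatives of the quotients determine the admissible radii. -/
structure Frame where
  Z : ℂ → ℂ
  nz : EntireNZ Z
  fam : Finset ((ℂ → ℂ) × (ℂ → ℂ))
  K : ℕ

namespace Frame

/-- The radius `r` avoids the zeros of `Z`, and on the circle of radius `r` the logarithmic
derivatives of the quotients of the family are bounded by `M`. -/
structure Good (E : Frame) (r M : ℝ) : Prop where
  one_le : 1 ≤ r
  one_le_bound : 1 ≤ M
  off : ∀ z, E.Z z = 0 → ‖z‖ ≠ r
  deriv : ∀ P ∈ E.fam, ∀ k ≤ E.K, ∀ z : ℂ, ‖z‖ = r →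
    ‖iteratedDeriv k (fun w => P.1 w / P.2 w) z‖ ≤ M * ‖P.1 z / P.2 z‖

/-- `h` is bounded above by a constant multiple of `1 + log M` on the good radii. -/
def Small (E : Frame) (h : ℝ → ℝ) : Prop :=
  ∃ C, 0 ≤ C ∧ ∀ r M, E.Good r M → h r ≤ C * (1 + Real.log M)

/-- The counting function of `φ` on the zeros of `Z`. -/
def N (E : Frame) (φ : ℂ → ℤ) (r : ℝ) : ℝ := cnt E.Z φ r

variable {E : Frame} {h k : ℝ → ℝ}

theorem Good.one_le_err {r M : ℝ} (hg : E.Good r M) : 1 ≤ 1 + Real.log M := by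
  have := Real.log_nonneg hg.one_le_bound
  linarith

theorem Small.mono (hk : E.Small k) (hle : ∀ r M, E.Good r M → h r ≤ k r) : E.Small h := by
  obtain ⟨C, hC, hb⟩ := hk
  exact ⟨C, hC, fun r M hg => (hle r M hg).trans (hb r M hg)⟩

theorem Small.add (hh : E.Small h) (hk : E.Small k) : E.Small fun r => h r + k r := by
  obtain ⟨C, hC, hb⟩ := hh
  obtain ⟨D, hD, hd⟩ := hk
  exact ⟨C + D, by positivity, fun r M hg => by linarith [hb r M hg, hd r M hg]⟩

theorem Small.const_mul (hh : E.Small h) {c : ℝ} (hc : 0 ≤ c) : E.Small fun r => c * h r := by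
  obtain ⟨C, hC, hb⟩ := hh
  exact ⟨c * C, by positivity, fun r M hg => by
    rw [mul_assoc]; exact mul_le_mul_of_nonneg_left (hb r M hg) hc⟩

theorem small_of_le {C : ℝ} (hC : ∀ r M, E.Good r M → h r ≤ C) : E.Small h := by
  refine ⟨|C|, abs_nonneg C, fun r M hg => (hC r M hg).trans ((le_abs_self C).trans ?_)⟩
  exact le_mul_of_one_le_right (abs_nonneg C) hg.one_le_err

theorem Small.sum {ι : Type*} {s : Finset ι} {h : ι → ℝ → ℝ} (hh : ∀ i ∈ s, E.Small (h i)) :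
    E.Small fun r => ∑ i ∈ s, h i r := by
  classical
  induction s using Finset.induction_on with
  | empty => exact small_of_le (C := 0) (by simp)
  | insert a s ha ih =>
    simp only [Finset.sum_insert ha]
    exact (hh a (by simp)).add (ih fun i hi => hh i (by simp [hi]))

theorem N_add (φ ψ : ℂ → ℤ) (r : ℝ) : E.N (fun z => φ z + ψ z) r = E.N φ r + E.N ψ r :=
  cnt_add _ _ _ _

theorem N_sub (φ ψ : ℂ → ℤ) (r : ℝ) : E.N (fun z => φ z - ψ z) r = E.N φ r - E.N ψ r :=
  cnt_sub _ _ _ _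

theorem N_sum {ι : Type*} (s : Finset ι) (φ : ι → ℂ → ℤ) (r : ℝ) :
    E.N (fun z => ∑ i ∈ s, φ i z) r = ∑ i ∈ s, E.N (φ i) r :=
  cnt_sum _ _ _ _

theorem N_nsmul (m : ℕ) (φ : ℂ → ℤ) (r : ℝ) : E.N (fun z => m * φ z) r = m * E.N φ r :=
  cnt_nsmul _ _ _ _

theorem N_mono {φ ψ : ℂ → ℤ} (hle : ∀ z, φ z ≤ ψ z) {r : ℝ} (hr : 1 ≤ r) : E.N φ r ≤ E.N ψ r :=
  cnt_mono E.nz (fun z _ => hle z) hr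

theorem N_nonneg {φ : ℂ → ℤ} (hle : ∀ z, 0 ≤ φ z) {r : ℝ} (hr : 1 ≤ r) : 0 ≤ E.N φ r :=
  cnt_nonneg E.nz (fun z _ => hle z) hr

open Real in
theorem jensen_le {F : ℂ → ℂ} (hF : EntireNZ F) (hFZ : ∀ z, F z = 0 → E.Z z = 0) :
    E.Small fun r => E.N (fun z => analyticOrderNatAt F z) r -
      circleAverage (fun z => log ‖F z‖) 0 r := by
  obtain ⟨C, _, hC⟩ := exists_abs_cnt_sub_circleAverage_le E.nz hF hFZ
  exact small_of_le fun r M hg => (abs_le.1 (hC r hg.one_le)).2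

open Real in
theorem jensen_ge {F : ℂ → ℂ} (hF : EntireNZ F) (hFZ : ∀ z, F z = 0 → E.Z z = 0) :
    E.Small fun r => circleAverage (fun z => log ‖F z‖) 0 r -
      E.N (fun z => analyticOrderNatAt F z) r := by
  obtain ⟨C, _, hC⟩ := exists_abs_cnt_sub_circleAverage_le E.nz hF hFZ
  exact small_of_le (C := C) fun r M hg => by
    have := (abs_le.1 (hC r hg.one_le)).1
    unfold Frame.N
    linarith

open Real in
/-- Cartan's second main theorem. -/
theorem second_main {N q : ℕ} (hN : 0 < N) (hNq : N ≤ q) (hK : N ≤ E.K + 1)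
    (H : Fin q → Fin N → ℂ) (hH : ∀ e : Fin N ↪ Fin q, LinearIndependent ℂ fun i => H (e i))
    (φ : Fin N → ℂ → ℂ) (hφ : ∀ i, Differentiable ℂ (φ i)) (X : Fin q → ℂ → ℂ)
    (hX : ∀ v z, X v z = ∑ i, H v i * φ i z) (hXnz : ∀ v, EntireNZ (X v))
    (hXZ : ∀ v z, X v z = 0 → E.Z z = 0) (hW : EntireNZ (wronskian φ))
    (hWZ : ∀ z, wronskian φ z = 0 → E.Z z = 0) (hmem : ∀ v w, (X v, X w) ∈ E.fam) :
    E.Small fun r => ((q - N : ℕ) : ℝ) * circleAverage (fun z => log ‖fun i => φ i z‖) 0 r +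
      E.N (fun z => analyticOrderNatAt (wronskian φ) z) r -
        ∑ v, E.N (fun z => analyticOrderNatAt (X v) z) r := by
  obtain ⟨C, hC, hsmt⟩ := exists_circleAverage_log_wronskian_le hN hNq H hH
  have h1 : E.Small fun r => ((q - N : ℕ) : ℝ) * circleAverage (fun z => log ‖fun i => φ i z‖) 0 r +
      circleAverage (fun z => log ‖wronskian φ z‖) 0 r -
        ∑ v, circleAverage (fun z => log ‖X v z‖) 0 r := by
    refine ⟨C, hC, fun r M hg => ?_⟩
    have := hsmt φ hφ r M (by linarith [hg.one_le]) hg.one_le_bound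
      (fun z hz => ⟨fun h => hg.off z (hWZ z h) hz, fun v h => hg.off z
        (hXZ v z (by rw [hX, h])) hz⟩)
      (fun v v₀ k hk z hz => by
        have h2 := hg.deriv _ (hmem v v₀) k (by omega) z hz
        simpa only [hX] using h2)
    simp only [hX]
    linarith
  have h2 := Small.sum (s := Finset.univ) fun v _ => jensen_ge (E := E) (hXnz v) (hXZ v)
  refine ((h1.add h2).add (jensen_le hW hWZ)).mono fun r M _ => ?_
  rw [Finset.sum_sub_distrib]
  linarith

end Frame

theorem EntireNZ.min_le_order_add {A B X : ℂ → ℂ} (hA : EntireNZ A) (hB : EntireNZ B)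
    (hX : EntireNZ X) (h : ∀ z, X z = A z + B z) (z : ℂ) :
    min (analyticOrderNatAt A z) (analyticOrderNatAt B z) ≤ analyticOrderNatAt X z := by
  have h1 : X = A + B := funext h
  rw [hX.le_order_iff, h1]
  refine le_trans ?_ le_analyticOrderAt_add
  rw [← hA.cast_order, ← hB.cast_order]
  exact le_of_eq (by norm_cast)

theorem EntireNZ.neg {A : ℂ → ℂ} (hA : EntireNZ A) : EntireNZ fun z => - A z :=
  ⟨hA.1.neg, by simpa using hA.2⟩

theorem analyticOrderNatAt_neg (A : ℂ → ℂ) (z : ℂ) :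
    analyticOrderNatAt (fun w => - A w) z = analyticOrderNatAt A z := by
  rw [analyticOrderNatAt, analyticOrderNatAt]
  exact congrArg ENat.toNat (analyticOrderAt_neg (f := A))

theorem EntireNZ.min_le_order_sub {A B X : ℂ → ℂ} (hA : EntireNZ A) (hB : EntireNZ B)
    (hX : EntireNZ X) (h : ∀ z, X z = A z - B z) (z : ℂ) :
    min (analyticOrderNatAt A z) (analyticOrderNatAt B z) ≤ analyticOrderNatAt X z := by
  rw [← analyticOrderNatAt_neg B]
  exact hA.min_le_order_add hB.neg hX (by simpa [sub_eq_add_neg] using h) z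

theorem wronskian_pair (A B : ℂ → ℂ) (z : ℂ) :
    wronskian ![A, B] z = A z * deriv B z - deriv A z * B z := by
  simp [wronskian, Matrix.det_fin_two, iteratedDeriv_zero, iteratedDeriv_one]

theorem order_add_le_wronskian_pair {A B W : ℂ → ℂ} (hA : EntireNZ A) (hB : EntireNZ B)
    (hW : EntireNZ W) (h : ∀ z, W z = A z * deriv B z - deriv A z * B z) (z : ℂ) :
    analyticOrderNatAt A z + analyticOrderNatAt B z ≤ analyticOrderNatAt W z + 1 := by
  set a := analyticOrderNatAt A z
  set b := analyticOrderNatAt B z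
  suffices h1 : a + b - 1 ≤ analyticOrderNatAt W z by omega
  have hda := le_analyticOrderAt_iteratedDeriv (hA.1.analyticAt z) (hA.cast_order z).le 1
  have hdb := le_analyticOrderAt_iteratedDeriv (hB.1.analyticAt z) (hB.cast_order z).le 1
  rw [iteratedDeriv_one] at hda hdb
  have hW' : W = A * deriv B - deriv A * B := funext h
  rw [hW.le_order_iff, hW']
  refine le_trans (le_min ?_ ?_) le_analyticOrderAt_sub
  · rw [analyticOrderAt_mul (hA.1.analyticAt z) (hB.1.analyticAt z).deriv, ← hA.cast_order]
    refine le_trans ?_ (add_le_add_right hdb _)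
    exact_mod_cast (by omega : a + b - 1 ≤ a + (b - 1))
  · rw [analyticOrderAt_mul (hA.1.analyticAt z).deriv (hB.1.analyticAt z), ← hB.cast_order]
    refine le_trans ?_ (add_le_add_left hda _)
    exact_mod_cast (by omega : a + b - 1 ≤ (a - 1) + b)

theorem two_mul_min_le_wronskian_pair {A B : ℂ → ℂ} (hA : EntireNZ A) (hB : EntireNZ B)
    (hW : EntireNZ (wronskian ![A, B])) (z : ℂ) :
    2 * min (analyticOrderNatAt A z) (analyticOrderNatAt B z) ≤
      analyticOrderNatAt (wronskian ![A, B]) z := by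
  set c := min (analyticOrderNatAt A z) (analyticOrderNatAt B z)
  obtain ⟨A₁, hA₁, hA₂⟩ := (natCast_le_analyticOrderAt (hA.1.analyticAt z)).1
    (hA.le_order_iff.1 (min_le_left _ _ : c ≤ _))
  obtain ⟨B₁, hB₁, hB₂⟩ := (natCast_le_analyticOrderAt (hB.1.analyticAt z)).1
    (hB.le_order_iff.1 (min_le_right _ _ : c ≤ _))
  have hφ : ∀ i : Fin 2, AnalyticAt ℂ (![A₁, B₁] i) z := by
    intro i; fin_cases i <;> assumption
  rw [hW.le_order_iff, natCast_le_analyticOrderAt (hW.1.analyticAt z)]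
  refine ⟨fun w => A₁ w * deriv B₁ w - deriv A₁ w * B₁ w,
    (hA₁.mul hB₁.deriv).sub (hA₁.deriv.mul hB₁), ?_⟩
  filter_upwards [hA₂.eventually_nhds, hB₂.eventually_nhds, hA₁.eventually_analyticAt,
    hB₁.eventually_analyticAt] with w h1 h2 h3 h4
  have h5 : wronskian ![A, B] w = wronskian (fun i u => (u - z) ^ c * ![A₁, B₁] i u) w := by
    refine wronskian_congr fun i => ?_
    fin_cases i
    · exact h1
    · exact h2
  rw [h5, wronskian_mul_left (h := fun u => (u - z) ^ c) (by fun_prop)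
    (by intro i; fin_cases i <;> assumption), wronskian_pair, ← pow_mul, mul_comm c 2, smul_eq_mul]

theorem order_triple_le {A B X : ℂ → ℂ} (hA : EntireNZ A) (hB : EntireNZ B) (hX : EntireNZ X)
    (h : ∀ z, X z = A z + B z) (hW : EntireNZ (wronskian ![A, B])) (z : ℂ) {t : ℕ}
    (ht : (analyticOrderNatAt A z = analyticOrderNatAt B z ∧
      analyticOrderNatAt B z = analyticOrderNatAt X z) ∨ 1 ≤ t) :
    analyticOrderNatAt A z + analyticOrderNatAt B z + analyticOrderNatAt X z ≤
      analyticOrderNatAt (wronskian ![A, B]) z +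
        min (min (analyticOrderNatAt A z) (analyticOrderNatAt B z)) (analyticOrderNatAt X z) + t := by
  have hd : ∀ w, deriv X w = deriv A w + deriv B w := fun w => by
    rw [show X = A + B from funext h]
    exact deriv_add (hA.1 w) (hB.1 w)
  have h1 := order_add_le_wronskian_pair hA hB hW (wronskian_pair A B) z
  have h2 := order_add_le_wronskian_pair hA hX hW (fun w => by
    rw [wronskian_pair, hd, h]; ring) z
  have h3 := order_add_le_wronskian_pair hX hB hW (fun w => by
    rw [wronskian_pair, hd, h]; ring) z
  have h4 := two_mul_min_le_wronskian_pair hA hB hW z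
  have h5 := hA.min_le_order_add hB hX h z
  have h6 := hX.min_le_order_sub hB hA (fun w => by rw [h]; ring) z
  have h7 := hX.min_le_order_sub hA hB (fun w => by rw [h]; ring) z
  omega

section

/-- The `2 × 2` minors of the pair of families `F`, `G`. -/
def minor {q : ℕ} (F G : Fin q → ℂ → ℂ) (i j : Fin q) (z : ℂ) : ℂ :=
  F i z * G j z - F j z * G i z

open Classical in
/-- The indicator function of the zeros of `F`. -/
def ind (F : ℂ → ℂ) (z : ℂ) : ℤ := if F z = 0 then 1 else 0

/-- The smaller of the vanishing orders of two functions. -/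
def jord (A B : ℂ → ℂ) (z : ℂ) : ℤ := min (analyticOrderNatAt A z : ℤ) (analyticOrderNatAt B z)

/-- The function `G i * minor F G j k`. -/
def triple {q : ℕ} (F G : Fin q → ℂ → ℂ) (i j k : Fin q) (z : ℂ) : ℂ := G i z * minor F G j k z

/-- The amount by which the vanishing order of a minor exceeds its generic value. -/
def exc {q : ℕ} (F G : Fin q → ℂ → ℂ) (i j : Fin q) (z : ℂ) : ℤ :=
  analyticOrderNatAt (minor F G i j) z -
    (jord (F i) (G i) z + jord (F j) (G j) z + (∑ v, ind (F v) z - ind (F i) z - ind (F j) z))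

/-- Two families of entire functions with the same zeros, which are disjoint for different
members, such that the two families are proportional at these zeros. -/
structure Config {q : ℕ} (F G : Fin q → ℂ → ℂ) : Prop where
  left : ∀ v, EntireNZ (F v)
  right : ∀ v, EntireNZ (G v)
  disj : ∀ v w z, F v z = 0 → F w z = 0 → v = w
  zero_iff : ∀ v z, F v z = 0 ↔ G v z = 0
  coin : ∀ i v j z, F i z = 0 → F j z ≠ 0 → F v z * G j z = G v z * F j z
  minor_nz : ∀ i j, i ≠ j → EntireNZ (minor F G i j)

variable {q : ℕ} {F G : Fin q → ℂ → ℂ}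

theorem minor_swap (F G : Fin q → ℂ → ℂ) (i j : Fin q) (z : ℂ) :
    minor F G j i z = - minor F G i j z := by
  simp only [minor]; ring

theorem minor_symm (F G : Fin q → ℂ → ℂ) (i j : Fin q) (z : ℂ) :
    minor G F i j z = - minor F G i j z := by
  simp only [minor]; ring

theorem jord_comm (A B : ℂ → ℂ) (z : ℂ) : jord A B z = jord B A z := min_comm _ _

theorem ind_nonneg (A : ℂ → ℂ) (z : ℂ) : 0 ≤ ind A z := by
  unfold ind; split_ifs <;> norm_num

theorem exc_swap (F G : Fin q → ℂ → ℂ) (i j : Fin q) (z : ℂ) : exc F G j i z = exc F G i j z := by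
  unfold exc
  rw [show minor F G j i = fun w => - minor F G i j w from funext (minor_swap F G i j),
    analyticOrderNatAt_neg]
  ring

theorem triple_add (F G : Fin q → ℂ → ℂ) (i j k : Fin q) (z : ℂ) :
    triple F G k j i z = triple F G i j k z + triple F G j k i z := by
  simp only [triple, minor]; ring

namespace Config

theorem symm (c : Config F G) : Config G F where
  left := c.right
  right := c.left
  disj v w z h1 h2 := c.disj v w z ((c.zero_iff v z).2 h1) ((c.zero_iff w z).2 h2)
  zero_iff v z := (c.zero_iff v z).symm
  coin i v j z h1 h2 := (c.coin i v j z ((c.zero_iff i z).2 h1)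
    (fun h => h2 ((c.zero_iff j z).1 h))).symm
  minor_nz i j h := by
    rw [show minor G F i j = fun w => - minor F G i j w from
      funext (minor_symm F G i j)]
    exact (c.minor_nz i j h).neg

theorem ind_eq (c : Config F G) (v : Fin q) : ind (G v) = ind (F v) := by
  funext z
  simp only [ind, c.zero_iff v z]

theorem exc_symm (c : Config F G) (i j : Fin q) : exc G F i j = exc F G i j := by
  funext z
  unfold exc
  rw [show minor G F i j = fun w => - minor F G i j w from
    funext (minor_symm F G i j), analyticOrderNatAt_neg]
  simp only [c.ind_eq, jord_comm (G _)]

theorem cases (c : Config F G) (z : ℂ) :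
    (∀ v, F v z ≠ 0) ∨ ∃ w, F w z = 0 ∧ ∀ v, v ≠ w → F v z ≠ 0 := by
  by_cases h : ∃ w, F w z = 0
  · obtain ⟨w, hw⟩ := h
    exact Or.inr ⟨w, hw, fun v hv h => hv (c.disj v w z h hw)⟩
  · push Not at h
    exact Or.inl h

theorem of_ne (c : Config F G) {v : Fin q} {z : ℂ} (h : F v z ≠ 0) :
    analyticOrderNatAt (F v) z = 0 ∧ analyticOrderNatAt (G v) z = 0 ∧ jord (F v) (G v) z = 0 ∧
      ind (F v) z = 0 := by
  have h1 := (c.left v).order_eq_zero.2 h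
  have h2 := (c.right v).order_eq_zero.2 fun h3 => h ((c.zero_iff v z).2 h3)
  refine ⟨h1, h2, by simp [jord, h1, h2], by simp [ind, h]⟩

theorem of_eq (c : Config F G) {v : Fin q} {z : ℂ} (h : F v z = 0) :
    1 ≤ analyticOrderNatAt (F v) z ∧ 1 ≤ analyticOrderNatAt (G v) z ∧ 1 ≤ jord (F v) (G v) z ∧
      ind (F v) z = 1 := by
  have h1 : analyticOrderNatAt (F v) z ≠ 0 := fun h1 => (c.left v).order_eq_zero.1 h1 h
  have h2 : analyticOrderNatAt (G v) z ≠ 0 := fun h1 =>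
    (c.right v).order_eq_zero.1 h1 ((c.zero_iff v z).1 h)
  refine ⟨by omega, by omega, ?_, by simp [ind, h]⟩
  unfold jord
  omega

theorem sum_ind_of_ne (c : Config F G) {z : ℂ} (h : ∀ v, F v z ≠ 0) : ∑ v, ind (F v) z = 0 :=
  Finset.sum_eq_zero fun v _ => (c.of_ne (h v)).2.2.2

theorem sum_ind_of_eq (c : Config F G) {z : ℂ} {w : Fin q} (h : F w z = 0) :
    ∑ v, ind (F v) z = 1 := by
  rw [Finset.sum_eq_single w, (c.of_eq h).2.2.2]
  · intro v _ hv
    exact (c.of_ne fun h' => hv (c.disj v w z h' h)).2.2.2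
  · simp

theorem jord_le_order_minor (c : Config F G) {i j : Fin q} (hij : i ≠ j) (z : ℂ) :
    jord (F i) (G i) z ≤ analyticOrderNatAt (minor F G i j) z := by
  have h1 := ((c.left i).mul (c.right j)).min_le_order_sub ((c.left j).mul (c.right i))
    (c.minor_nz i j hij) (fun _ => rfl) z
  rw [(c.left i).order_mul (c.right j), (c.left j).order_mul (c.right i)] at h1
  unfold jord
  omega

theorem exc_nonneg (c : Config F G) {i j : Fin q} (hij : i ≠ j) (z : ℂ) : 0 ≤ exc F G i j z := by
  unfold exc
  rcases c.cases z with h | ⟨w, hw, h⟩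
  · have := c.sum_ind_of_ne h
    have hi := c.of_ne (h i)
    have hj := c.of_ne (h j)
    omega
  · have hs := c.sum_ind_of_eq hw
    have h1 := c.of_eq hw
    by_cases hwi : w = i
    · subst hwi
      have h2 := c.of_ne (h j hij.symm)
      have h3 := c.jord_le_order_minor hij z
      omega
    by_cases hwj : w = j
    · subst hwj
      have h2 := c.of_ne (h i hij)
      have h3 := c.jord_le_order_minor hij.symm z
      rw [show minor F G w i = fun u => - minor F G i w u from
        funext (minor_swap F G i w), analyticOrderNatAt_neg] at h3
      omega
    · have hi := c.of_ne (h i (Ne.symm hwi))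
      have hj := c.of_ne (h j (Ne.symm hwj))
      have h2 : minor F G i j z = 0 := by
        have := c.coin w i j z hw (h j (Ne.symm hwj))
        simp only [minor, this]; ring
      have h3 : analyticOrderNatAt (minor F G i j) z ≠ 0 := fun h3 =>
        (c.minor_nz i j hij).order_eq_zero.1 h3 h2
      omega

theorem triple_nz (c : Config F G) (i : Fin q) {j k : Fin q} (h : j ≠ k) :
    EntireNZ (triple F G i j k) := (c.right i).mul (c.minor_nz j k h)

theorem order_triple (c : Config F G) (i : Fin q) {j k : Fin q} (h : j ≠ k) (z : ℂ) :
    (analyticOrderNatAt (triple F G i j k) z : ℤ) = analyticOrderNatAt (G i) z +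
      (exc F G j k z + (jord (F j) (G j) z + jord (F k) (G k) z +
        (∑ v, ind (F v) z - ind (F j) z - ind (F k) z))) := by
  have h1 := (c.right i).order_mul (c.minor_nz j k h) z
  have h2 : analyticOrderNatAt (triple F G i j k) z = analyticOrderNatAt (G i) z +
    analyticOrderNatAt (minor F G j k) z := h1
  rw [h2, exc]
  push_cast
  ring

end Config

/-- The smallest of the vanishing orders of three proportional triples. -/
def tmin (F G : Fin q → ℂ → ℂ) (i j k : Fin q) (z : ℂ) : ℤ :=
  min (min (analyticOrderNatAt (triple F G i j k) z : ℤ)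
    (analyticOrderNatAt (triple F G j k i) z)) (analyticOrderNatAt (triple F G k j i) z)

/-- A frame that controls all auxiliary functions attached to `F` and `G`. -/
structure Adapted (E : Frame) (F G : Fin q → ℂ → ℂ) : Prop where
  one_le : 1 ≤ E.K
  zero : ∀ v z, F v z = 0 → E.Z z = 0
  zero_minor : ∀ i j z, i ≠ j → minor F G i j z = 0 → E.Z z = 0
  wr : ∀ i j k, i ≠ j → j ≠ k → k ≠ i →
    EntireNZ (wronskian ![triple F G i j k, triple F G j k i]) ∧
      ∀ z, wronskian ![triple F G i j k, triple F G j k i] z = 0 → E.Z z = 0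
  wr_symm : ∀ i j k, i ≠ j → j ≠ k → k ≠ i →
    EntireNZ (wronskian ![triple G F i j k, triple G F j k i]) ∧
      ∀ z, wronskian ![triple G F i j k, triple G F j k i] z = 0 → E.Z z = 0
  fam : ∀ i j k i' j' k', j ≠ k → j' ≠ k' → (triple F G i j k, triple F G i' j' k') ∈ E.fam
  fam_symm : ∀ i j k i' j' k', j ≠ k → j' ≠ k' → (triple G F i j k, triple G F i' j' k') ∈ E.fam

theorem Adapted.symm {E : Frame} (a : Adapted E F G) (c : Config F G) : Adapted E G F where
  one_le := a.one_le
  zero v z h := a.zero v z ((c.zero_iff v z).2 h)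
  zero_minor i j z hij h := a.zero_minor i j z hij (by simpa [minor_symm F G] using h)
  wr := a.wr_symm
  wr_symm := a.wr
  fam := a.fam_symm
  fam_symm := a.fam

theorem Adapted.zero_triple {E : Frame} (a : Adapted E F G) (c : Config F G) {i j k : Fin q}
    (hjk : j ≠ k) {z : ℂ} (h : triple F G i j k z = 0) : E.Z z = 0 := by
  rcases mul_eq_zero.1 h with h | h
  · exact a.zero i z ((c.zero_iff i z).2 h)
  · exact a.zero_minor j k z hjk h

theorem linearIndependent_threeLines (e : Fin 2 ↪ Fin 3) :
    LinearIndependent ℂ fun i => (![![1, 0], ![0, 1], ![1, 1]] : Fin 3 → Fin 2 → ℂ) (e i) := by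
  have h : e 0 ≠ e 1 := fun h => absurd (e.injective h) (by decide)
  rw [Fintype.linearIndependent_iff]
  intro g hg
  have h0 := congrFun hg 0
  have h1 := congrFun hg 1
  simp only [Fin.sum_univ_two, Pi.add_apply, Pi.smul_apply, Pi.zero_apply, smul_eq_mul] at h0 h1
  rw [Fin.forall_fin_two]
  generalize e 0 = a, e 1 = b at *
  fin_cases a <;> fin_cases b <;> simp_all

open Real in
theorem small_triple {E : Frame} (c : Config F G) (a : Adapted E F G)
    (hexc : ∀ i j, i ≠ j → E.Small (E.N (exc F G i j))) {i j k : Fin q} (hij : i ≠ j) (hjk : j ≠ k)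
    (hki : k ≠ i) :
    E.Small fun r => circleAverage
      (fun z => log ‖(![triple F G i j k z, triple F G j k i z] : Fin 2 → ℂ)‖) 0 r -
        E.N (tmin F G i j k) r - (E.N (ind (F i)) r + E.N (ind (F j)) r + E.N (ind (F k)) r) := by
  have hA := c.triple_nz i hjk
  have hB := c.triple_nz j hki
  have hji := hij.symm
  have hX := c.triple_nz k hij.symm
  obtain ⟨hW, hWZ⟩ := a.wr i j k hij hjk hki
  have key := E.second_main (N := 2) (q := 3) (by norm_num) (by norm_num) (by have := a.one_le; omega)
    ![![1, 0], ![0, 1], ![1, 1]] linearIndependent_threeLines ![triple F G i j k, triple F G j k i]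
    (by intro v; fin_cases v; exacts [hA.1, hB.1])
    ![triple F G i j k, triple F G j k i, triple F G k j i]
    (by intro v z; fin_cases v <;> simp [Fin.sum_univ_two, triple_add F G i j k])
    (by intro v; fin_cases v; exacts [hA, hB, hX])
    (by
      intro v z hz
      fin_cases v
      exacts [a.zero_triple c hjk hz, a.zero_triple c hki hz, a.zero_triple c hij.symm hz])
    hW hWZ
    (by
      intro v w
      fin_cases v <;> fin_cases w <;> exact a.fam _ _ _ _ _ _ (by assumption) (by assumption))
  simp only [Fin.sum_univ_three, Matrix.cons_val_zero, Matrix.cons_val_one, Matrix.cons_val] at key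
  have hloc : ∀ z, (analyticOrderNatAt (triple F G i j k) z : ℤ) +
      analyticOrderNatAt (triple F G j k i) z + analyticOrderNatAt (triple F G k j i) z ≤
      analyticOrderNatAt (wronskian ![triple F G i j k, triple F G j k i]) z + tmin F G i j k z +
      (ind (F i) z + ind (F j) z + ind (F k) z) + (exc F G i j z + exc F G j k z + exc F G k i z) := by
    intro z
    have hi := ind_nonneg (F i) z
    have hj := ind_nonneg (F j) z
    have hk := ind_nonneg (F k) z
    have e1 := c.exc_nonneg hij z
    have e2 := c.exc_nonneg hjk z
    have e3 := c.exc_nonneg hki z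
    have hAo := c.order_triple i hjk z
    have hBo := c.order_triple j hki z
    have hXo := c.order_triple k hji z
    rw [exc_swap F G i j] at hXo
    have := order_triple_le hA hB hX (triple_add F G i j k) hW z
      (t := (ind (F i) z + ind (F j) z + ind (F k) z +
        (exc F G i j z + exc F G j k z + exc F G k i z)).toNat) (by
        by_cases zi : F i z = 0
        · have := c.of_eq zi
          right; omega
        by_cases zj : F j z = 0
        · have := c.of_eq zj
          right; omega
        by_cases zk : F k z = 0
        · have := c.of_eq zk
          right; omega
        have := c.of_ne zi
        have := c.of_ne zj
        have := c.of_ne zk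
        omega)
    unfold tmin
    omega
  refine ((((key.add (hexc i j hij)).add (hexc j k hjk)).add (hexc k i hki))).mono fun r M hg => ?_
  have h1 := E.N_mono hloc hg.one_le
  simp only [Frame.N_add] at h1
  have h2 : (fun z => log ‖fun v => (![triple F G i j k, triple F G j k i] : Fin 2 → ℂ → ℂ) v z‖) =
      fun z => log ‖(![triple F G i j k z, triple F G j k i z] : Fin 2 → ℂ)‖ := by
    funext z
    congr 2
    funext v
    fin_cases v <;> rfl
  rw [h2] at *
  norm_num
  linarith

end

section

variable {q : ℕ} {F G : Fin q → ℂ → ℂ}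

theorem Config.order_minor (F G : Fin q → ℂ → ℂ) (i j : Fin q) (z : ℂ) :
    (analyticOrderNatAt (minor F G i j) z : ℤ) = exc F G i j z + (jord (F i) (G i) z +
      jord (F j) (G j) z + (∑ v, ind (F v) z - ind (F i) z - ind (F j) z)) := by
  rw [exc]; ring

theorem Config.tmin_add_tmin_le (c : Config F G) {i j k : Fin q} (hij : i ≠ j) (hjk : j ≠ k)
    (hki : k ≠ i) (z : ℂ) : tmin F G i j k z + tmin G F i j k z + ∑ v, ind (F v) z ≤
      analyticOrderNatAt (minor F G i j) z + analyticOrderNatAt (minor F G j k) z +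
        analyticOrderNatAt (minor F G k i) z := by
  have e1 := c.exc_nonneg hij z
  have e2 := c.exc_nonneg hjk z
  have e3 := c.exc_nonneg hki z
  have hA := c.order_triple i hjk z
  have hB := c.order_triple j hki z
  have hX := c.order_triple k hij.symm z
  have hA' := c.symm.order_triple i hjk z
  have hB' := c.symm.order_triple j hki z
  have hX' := c.symm.order_triple k hij.symm z
  rw [exc_swap F G i j] at hX
  rw [exc_swap G F i j] at hX'
  simp only [c.exc_symm, c.ind_eq, jord_comm (G _)] at hA' hB' hX'
  rw [Config.order_minor F G i j, Config.order_minor F G j k, Config.order_minor F G k i]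
  unfold tmin
  rcases c.cases z with h | ⟨w, hw, h⟩
  · have := c.sum_ind_of_ne h
    have hi := c.of_ne (h i)
    have hj := c.of_ne (h j)
    have hk := c.of_ne (h k)
    omega
  · have hs := c.sum_ind_of_eq hw
    have h1 := c.of_eq hw
    by_cases hwi : w = i
    · subst hwi
      have := c.of_ne (h j hij.symm)
      have := c.of_ne (h k hki)
      omega
    by_cases hwj : w = j
    · subst hwj
      have := c.of_ne (h i hij)
      have := c.of_ne (h k hjk.symm)
      omega
    by_cases hwk : w = k
    · subst hwk
      have := c.of_ne (h i hki.symm)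
      have := c.of_ne (h j hjk)
      omega
    have := c.of_ne (h i (Ne.symm hwi))
    have := c.of_ne (h j (Ne.symm hwj))
    have := c.of_ne (h k (Ne.symm hwk))
    omega

theorem norm_mul_sub_mul_le (a b : Fin 2 → ℂ) : ‖a 0 * b 1 - a 1 * b 0‖ ≤ 2 * (‖a‖ * ‖b‖) := by
  have h : ∀ i j, ‖a i * b j‖ ≤ ‖a‖ * ‖b‖ := fun i j => by
    rw [norm_mul]
    exact mul_le_mul (norm_le_pi_norm a i) (norm_le_pi_norm b j) (norm_nonneg _) (norm_nonneg _)
  linarith [norm_sub_le (a 0 * b 1) (a 1 * b 0), h 0 1, h 1 0]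

theorem continuousOn_log_norm_vec {N : ℕ} {φ : ℂ → Fin N → ℂ} (hφ : Continuous φ) {s : Set ℂ}
    (h : ∀ z ∈ s, φ z ≠ 0) : ContinuousOn (fun z => Real.log ‖φ z‖) s :=
  ContinuousOn.log hφ.norm.continuousOn fun z hz => norm_ne_zero_iff.2 (h z hz)

open Real in
theorem circleAverage_log_le_add {N M : ℕ} {X : ℂ → ℂ} {φ : ℂ → Fin N → ℂ} {ψ : ℂ → Fin M → ℂ}
    (hX : Continuous X) (hφ : Continuous φ) (hψ : Continuous ψ) {C : ℝ} (hC : 0 < C)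
    (hle : ∀ z, ‖X z‖ ≤ C * (‖φ z‖ * ‖ψ z‖)) {r : ℝ} (hr : 0 ≤ r) (hne : ∀ z, ‖z‖ = r → X z ≠ 0) :
    circleAverage (fun z => log ‖X z‖) 0 r ≤ log C +
      (circleAverage (fun z => log ‖φ z‖) 0 r + circleAverage (fun z => log ‖ψ z‖) 0 r) := by
  have hs : ∀ z ∈ Metric.sphere (0 : ℂ) r, X z ≠ 0 ∧ φ z ≠ 0 ∧ ψ z ≠ 0 := fun z hz => by
    have hz' := hne z (by simpa using hz)
    have hp := hle z
    refine ⟨hz', ?_, ?_⟩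
    · rintro h
      simp [h, hz'] at hp
    · rintro h
      simp [h, hz'] at hp
  have i1 : CircleIntegrable (fun z => log ‖X z‖) 0 r := ContinuousOn.circleIntegrable hr
    (continuousOn_log_norm hX fun z hz => (hs z hz).1)
  have i2 : CircleIntegrable (fun z => log ‖φ z‖) 0 r := ContinuousOn.circleIntegrable hr
    (continuousOn_log_norm_vec hφ fun z hz => (hs z hz).2.1)
  have i3 : CircleIntegrable (fun z => log ‖ψ z‖) 0 r := ContinuousOn.circleIntegrable hr
    (continuousOn_log_norm_vec hψ fun z hz => (hs z hz).2.2)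
  have i4 : CircleIntegrable (fun _ => log C) (0 : ℂ) r :=
    ContinuousOn.circleIntegrable hr continuousOn_const
  have i5 : CircleIntegrable (fun z => log ‖φ z‖ + log ‖ψ z‖) 0 r := i2.add i3
  rw [← circleAverage_const (log C) (0 : ℂ) r, ← circleAverage_fun_add i2 i3,
    ← circleAverage_fun_add i4 i5]
  refine circleAverage_mono i1 (i4.add i5) fun z hz => ?_
  rw [abs_of_nonneg hr] at hz
  obtain ⟨h1, h2, h3⟩ := hs z hz
  have p1 := norm_pos_iff.2 h1
  have p2 := norm_pos_iff.2 h2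
  have p3 := norm_pos_iff.2 h3
  have := log_le_log p1 (hle z)
  rw [log_mul hC.ne' (by positivity), log_mul p2.ne' p3.ne'] at this
  exact this

open Real in
/-- For three different indices, the counting function of all the zeros is bounded by those of the
three functions. -/
theorem small_sum_ind {E : Frame} (c : Config F G) (a : Adapted E F G)
    (hexc : ∀ i j, i ≠ j → E.Small (E.N (exc F G i j))) {i j k : Fin q} (hij : i ≠ j) (hjk : j ≠ k)
    (hki : k ≠ i) :
    E.Small fun r => ∑ v, E.N (ind (F v)) r -
      2 * (E.N (ind (F i)) r + E.N (ind (F j)) r + E.N (ind (F k)) r) := by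
  have h1 := small_triple c a hexc hij hjk hki
  have h2 := small_triple c.symm (a.symm c) (fun i j h => by rw [c.exc_symm]; exact hexc i j h)
    hij hjk hki
  simp only [c.ind_eq] at h2
  set X : ℂ → ℂ := fun z => minor F G i j z * minor F G j k z * minor F G k i z with hXdef
  have hX1 := (c.minor_nz i j hij).mul (c.minor_nz j k hjk)
  have hX : EntireNZ X := hX1.mul (c.minor_nz k i hki)
  have hXZ : ∀ z, X z = 0 → E.Z z = 0 := fun z hz => by
    rcases mul_eq_zero.1 hz with hz | hz
    · rcases mul_eq_zero.1 hz with hz | hz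
      · exact a.zero_minor _ _ _ hij hz
      · exact a.zero_minor _ _ _ hjk hz
    · exact a.zero_minor _ _ _ hki hz
  have h3 := E.jensen_le hX hXZ
  have hXo : ∀ z, (analyticOrderNatAt X z : ℤ) = analyticOrderNatAt (minor F G i j) z +
      analyticOrderNatAt (minor F G j k) z + analyticOrderNatAt (minor F G k i) z := fun z => by
    have h4 := hX1.order_mul (c.minor_nz k i hki) z
    have h5 := (c.minor_nz i j hij).order_mul (c.minor_nz j k hjk) z
    rw [h5] at h4
    exact_mod_cast h4
  set φ : ℂ → Fin 2 → ℂ := fun z => ![triple F G i j k z, triple F G j k i z] with hφ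
  set ψ : ℂ → Fin 2 → ℂ := fun z => ![triple G F i j k z, triple G F j k i z] with hψ
  have hcφ : Continuous φ := continuous_pi fun v => by
    fin_cases v
    exacts [(c.triple_nz i hjk).1.continuous, (c.triple_nz j hki).1.continuous]
  have hcψ : Continuous ψ := continuous_pi fun v => by
    fin_cases v
    exacts [(c.symm.triple_nz i hjk).1.continuous, (c.symm.triple_nz j hki).1.continuous]
  have hle : ∀ z, ‖X z‖ ≤ 2 * (‖φ z‖ * ‖ψ z‖) := fun z => by
    refine le_of_eq_of_le (congrArg _ ?_) (norm_mul_sub_mul_le (φ z) (ψ z))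
    simp only [hXdef, hφ, hψ, triple, minor, Matrix.cons_val_zero, Matrix.cons_val_one]
    ring
  have h6 : E.Small fun r => circleAverage (fun z => log ‖X z‖) 0 r -
      (circleAverage (fun z => log ‖φ z‖) 0 r + circleAverage (fun z => log ‖ψ z‖) 0 r) :=
    Frame.small_of_le (C := log 2) fun r M hg => by
      have := circleAverage_log_le_add hX.1.continuous hcφ hcψ two_pos hle
        (zero_le_one.trans hg.one_le) fun z hz h => hg.off z (hXZ z h) hz
      linarith
  refine (((h1.add h2).add h3).add h6).mono fun r M hg => ?_
  have h7 := E.N_mono (fun z => (c.tmin_add_tmin_le hij hjk hki z).trans (hXo z).ge) hg.one_le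
  simp only [Frame.N_add, Frame.N_sum] at h7
  linarith

end

section

/-- The defect between the joint vanishing order and the vanishing orders truncated by `n`. -/
def tdef (n : ℕ) (A B : ℂ → ℂ) (z : ℂ) : ℤ :=
  jord A B z + n * ind A z - min (analyticOrderNatAt A z : ℤ) n - min (analyticOrderNatAt B z : ℤ) n

theorem Config.tdef_nonneg {q : ℕ} {F G : Fin q → ℂ → ℂ} (c : Config F G) (n : ℕ) (v : Fin q)
    (z : ℂ) : 0 ≤ tdef n (F v) (G v) z := by
  unfold tdef
  by_cases h : F v z = 0
  · have h1 := c.of_eq h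
    rw [h1.2.2.2]
    unfold jord
    omega
  · have h1 := c.of_ne h
    rw [h1.2.2.2]
    omega

open Real

/-- The characteristic functions `tf` and `tg` satisfy the first main theorem for the minors and
the second main theorem for the two families. -/
structure MainBounds (n : ℕ) (E : Frame) (F G : Fin (2 * n + 2) → ℂ → ℂ) (tf tg : ℝ → ℝ) :
    Prop where
  minor_le : ∀ i j, i ≠ j → E.Small fun r =>
    circleAverage (fun z => log ‖minor F G i j z‖) 0 r - (tf r + tg r)
  left_le : E.Small fun r => (n + 1) * tf r -
    ∑ v, E.N (fun z => min (analyticOrderNatAt (F v) z : ℤ) n) r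
  right_le : E.Small fun r => (n + 1) * tg r -
    ∑ v, E.N (fun z => min (analyticOrderNatAt (G v) z : ℤ) n) r

/-- The difference between the characteristic function and the generic counting function of the
zeros of a minor. -/
def gap {q : ℕ} (E : Frame) (F G : Fin q → ℂ → ℂ) (tf tg : ℝ → ℝ) (i j : Fin q) (r : ℝ) : ℝ :=
  tf r + tg r - E.N (jord (F i) (G i)) r - E.N (jord (F j) (G j)) r -
    (∑ v, E.N (ind (F v)) r - E.N (ind (F i)) r - E.N (ind (F j)) r)

namespace MainBounds

variable {n : ℕ} {E : Frame} {F G : Fin (2 * n + 2) → ℂ → ℂ} {tf tg : ℝ → ℝ}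

theorem symm (b : MainBounds n E F G tf tg) : MainBounds n E G F tg tf where
  minor_le i j h := by
    refine (b.minor_le i j h).mono fun r M _ => ?_
    simp only [minor_symm F G, norm_neg]
    linarith
  left_le := b.right_le
  right_le := b.left_le

theorem N_order_minor (i j : Fin (2 * n + 2)) (r : ℝ) :
    E.N (fun z => analyticOrderNatAt (minor F G i j) z) r =
      E.N (exc F G i j) r + (tf r + tg r - gap E F G tf tg i j r) := by
  simp only [Config.order_minor F G i j, Frame.N_add, Frame.N_sub, Frame.N_sum, gap]
  ring

theorem small_exc_sub_gap (b : MainBounds n E F G tf tg) (c : Config F G) (a : Adapted E F G)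
    {i j : Fin (2 * n + 2)} (hij : i ≠ j) :
    E.Small fun r => E.N (exc F G i j) r - gap E F G tf tg i j r := by
  refine ((b.minor_le i j hij).add
    (E.jensen_le (c.minor_nz i j hij) fun z => a.zero_minor i j z hij)).mono fun r M _ => ?_
  rw [N_order_minor (tf := tf) (tg := tg)]
  linarith

theorem small_neg_gap (b : MainBounds n E F G tf tg) (c : Config F G) (a : Adapted E F G)
    {i j : Fin (2 * n + 2)} (hij : i ≠ j) : E.Small fun r => - gap E F G tf tg i j r :=
  (b.small_exc_sub_gap c a hij).mono fun r M hg => by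
    linarith [E.N_nonneg (c.exc_nonneg hij) hg.one_le]

theorem sum_gap (d : Fin (2 * n + 2)) (r : ℝ) :
    ∑ k, gap E F G tf tg k (k + d) r + 2 * ∑ v, E.N (tdef n (F v) (G v)) r =
      2 * ((n + 1) * tf r - ∑ v, E.N (fun z => min (analyticOrderNatAt (F v) z : ℤ) n) r) +
      2 * ((n + 1) * tg r - ∑ v, E.N (fun z => min (analyticOrderNatAt (G v) z : ℤ) n) r) := by
  have h1 : ∀ x : Fin (2 * n + 2) → ℝ, ∑ k, x (k + d) = ∑ k, x k :=
    fun x => Equiv.sum_comp (Equiv.addRight d) x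
  unfold gap tdef
  simp only [Frame.N_add, Frame.N_sub, Frame.N_nsmul, Finset.sum_add_distrib,
    Finset.sum_sub_distrib, Finset.sum_const, Finset.card_univ, Fintype.card_fin, nsmul_eq_mul,
    ← Finset.mul_sum, h1 fun k => E.N (jord (F k) (G k)) r, h1 fun k => E.N (ind (F k)) r]
  push_cast
  ring

theorem small_sum_gap (b : MainBounds n E F G tf tg) (d : Fin (2 * n + 2)) :
    E.Small fun r => ∑ k, gap E F G tf tg k (k + d) r + 2 * ∑ v, E.N (tdef n (F v) (G v)) r :=
  ((b.left_le.const_mul zero_le_two).add (b.right_le.const_mul zero_le_two)).mono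
    fun r _ _ => (sum_gap d r).le

theorem small_gap (b : MainBounds n E F G tf tg) (c : Config F G) (a : Adapted E F G)
    {i j : Fin (2 * n + 2)} (hij : i ≠ j) : E.Small (gap E F G tf tg i j) := by
  classical
  have hd : j - i ≠ 0 := sub_ne_zero.2 hij.symm
  have h1 := Frame.Small.sum (s := Finset.univ.erase i) fun k _ =>
    b.small_neg_gap c a (i := k) (j := k + (j - i)) (by simpa using hd)
  refine ((b.small_sum_gap (j - i)).add h1).mono fun r M hg => ?_
  have h2 : 0 ≤ ∑ v, E.N (tdef n (F v) (G v)) r :=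
    Finset.sum_nonneg fun v _ => E.N_nonneg (c.tdef_nonneg n v) hg.one_le
  rw [Finset.sum_neg_distrib, ← Finset.add_sum_erase _ _ (Finset.mem_univ i),
    add_sub_cancel]
  linarith

theorem small_exc (b : MainBounds n E F G tf tg) (c : Config F G) (a : Adapted E F G)
    (i j : Fin (2 * n + 2)) (hij : i ≠ j) : E.Small (E.N (exc F G i j)) :=
  ((b.small_exc_sub_gap c a hij).add (b.small_gap c a hij)).mono fun r M _ => by linarith

theorem small_tdef (b : MainBounds n E F G tf tg) (c : Config F G) (a : Adapted E F G)
    (v : Fin (2 * n + 2)) : E.Small (E.N (tdef n (F v) (G v))) := by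
  classical
  have h1 := Frame.Small.sum (s := Finset.univ) fun k _ =>
    b.small_neg_gap c a (i := k) (j := k + 1) (by simp)
  refine ((b.small_sum_gap 1).add h1).mono fun r M hg => ?_
  have h2 : E.N (tdef n (F v) (G v)) r ≤ ∑ v, E.N (tdef n (F v) (G v)) r :=
    Finset.single_le_sum (f := fun v => E.N (tdef n (F v) (G v)) r)
      (fun v _ => E.N_nonneg (c.tdef_nonneg n v) hg.one_le) (Finset.mem_univ v)
  have h3 := E.N_nonneg (c.tdef_nonneg n v) hg.one_le
  rw [Finset.sum_neg_distrib]
  linarith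

theorem left_le_ind (b : MainBounds n E F G tf tg) (c : Config F G) :
    E.Small fun r => (n + 1) * tf r - n * ∑ v, E.N (ind (F v)) r := by
  refine b.left_le.mono fun r M hg => ?_
  have : ∑ v, E.N (fun z => min (analyticOrderNatAt (F v) z : ℤ) n) r ≤
      n * ∑ v, E.N (ind (F v)) r := by
    rw [Finset.mul_sum]
    refine Finset.sum_le_sum fun v _ => ?_
    rw [← Frame.N_nsmul]
    refine E.N_mono (fun z => ?_) hg.one_le
    by_cases h : F v z = 0
    · rw [(c.of_eq h).2.2.2]; omega
    · rw [(c.of_ne h).2.2.2, (c.of_ne h).1]; omega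
  linarith

theorem right_le_ind (b : MainBounds n E F G tf tg) (c : Config F G) :
    E.Small fun r => (n + 1) * tg r - n * ∑ v, E.N (ind (F v)) r := by
  have := b.symm.left_le_ind c.symm
  simpa only [c.ind_eq] using this

theorem small_of_small_sum_ind (b : MainBounds n E F G tf tg) (c : Config F G)
    (hS : E.Small fun r => ∑ v, E.N (ind (F v)) r) : E.Small fun r => tf r + tg r := by
  have h1 := ((b.left_le_ind c).add (b.right_le_ind c)).add
    (hS.const_mul (c := 2 * n) (by positivity))
  refine (h1.const_mul (c := (n + 1 : ℝ)⁻¹) (by positivity)).mono fun r M _ => ?_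
  apply le_of_eq
  field_simp
  ring

/-- The case `n ≥ 3` of the main estimate. -/
theorem small_of_three_le (b : MainBounds n E F G tf tg) (c : Config F G) (a : Adapted E F G)
    (hn : 3 ≤ n) : E.Small fun r => tf r + tg r := by
  refine b.small_of_small_sum_ind c ?_
  have h1 := Frame.Small.sum (s := Finset.univ) fun (k : Fin (2 * n + 2)) _ =>
    small_sum_ind c a (b.small_exc c a) (i := k) (j := k + 1) (k := k + 1 + 1)
      (by simp) (by simp) (by
        rw [add_assoc, Ne, add_eq_left, Fin.ext_iff, Fin.val_add, Fin.val_one, Fin.val_zero,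
          Nat.mod_eq_of_lt (by omega)]
        norm_num)
  refine h1.mono fun r M hg => ?_
  have hs : ∀ x : Fin (2 * n + 2) → ℝ, ∑ k, x (k + 1) = ∑ k, x k :=
    fun x => Equiv.sum_comp (Equiv.addRight 1) x
  have h0 : 0 ≤ ∑ v, E.N (ind (F v)) r :=
    Finset.sum_nonneg fun v _ => E.N_nonneg (ind_nonneg (F v)) hg.one_le
  have hs2 := hs fun k => E.N (ind (F (k + 1))) r
  have hs1 := hs fun k => E.N (ind (F k)) r
  rw [Finset.sum_sub_distrib, ← Finset.mul_sum, Finset.sum_add_distrib, Finset.sum_add_distrib, hs2,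
    hs1, Finset.sum_const, Finset.card_univ, Fintype.card_fin, nsmul_eq_mul]
  have hn' : (3 : ℝ) ≤ n := by exact_mod_cast hn
  push_cast
  nlinarith

end MainBounds

end

theorem EntireNZ.le_order_of_eq_sum {ι : Type*} [Fintype ι] {Q : ℂ → ℂ} (hQ : EntireNZ Q)
    (a : ι → ℂ) {X Y : ι → ℂ → ℂ} (hX : ∀ i, EntireNZ (X i)) (hY : ∀ i, EntireNZ (Y i))
    (h : ∀ z, Q z = ∑ i, a i * (X i z * Y i z)) {z : ℂ} {k : ℤ}
    (hk : ∀ i, k ≤ analyticOrderNatAt (X i) z + analyticOrderNatAt (Y i) z) :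
    k ≤ analyticOrderNatAt Q z := by
  suffices h1 : k.toNat ≤ analyticOrderNatAt Q z by omega
  rw [hQ.le_order_iff, natCast_le_analyticOrderAt (hQ.1.analyticAt z)]
  have h2 : ∀ i, ∃ g : ℂ → ℂ, AnalyticAt ℂ g z ∧
      ∀ᶠ w in 𝓝 z, X i w * Y i w = (w - z) ^ k.toNat • g w := fun i => by
    refine (natCast_le_analyticOrderAt (((hX i).mul (hY i)).1.analyticAt z)).1
      (((hX i).mul (hY i)).le_order_iff.1 ?_)
    have := hk i
    rw [(hX i).order_mul (hY i)]
    omega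
  choose g hg hgX using h2
  refine ⟨fun w => ∑ i, a i * g i w, ?_, ?_⟩
  · exact Finset.analyticAt_fun_sum _ fun i _ => analyticAt_const.mul (hg i)
  · filter_upwards [eventually_all.2 hgX] with w hw
    rw [h, smul_eq_mul, Finset.mul_sum]
    refine Finset.sum_congr rfl fun i _ => ?_
    rw [hw i, smul_eq_mul]
    ring

/-- A combination of products of minors which, for two families with the same linear relations,
vanishes to a higher order at the zeros of the last member of the families. -/
def minorQuad {q : ℕ} (F G : Fin q → ℂ → ℂ) (i j k l : Fin q) (α₂ β₂ α₃ β₃ : ℂ) (z : ℂ) : ℂ :=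
  β₂ * α₃ * (minor F G i j z * minor F G k l z) +
    (α₂ * β₃ - β₂ * α₃) * (minor F G i k z * minor F G j l z)

section

variable {q : ℕ} {F G : Fin q → ℂ → ℂ} {i j k l m p : Fin q} {α₂ β₂ γ₂ α₃ β₃ γ₃ : ℂ}

theorem minorQuad_eq (hF₂ : ∀ z, F k z = α₂ * F i z + β₂ * F j z + γ₂ * F p z)
    (hG₂ : ∀ z, G k z = α₂ * G i z + β₂ * G j z + γ₂ * G p z)
    (hF₃ : ∀ z, F l z = α₃ * F i z + β₃ * F j z + γ₃ * F p z)
    (hG₃ : ∀ z, G l z = α₃ * G i z + β₃ * G j z + γ₃ * G p z) (z : ℂ) :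
    minorQuad F G i j k l α₂ β₂ α₃ β₃ z = ∑ v : Fin 3,
      ![β₂ * α₃ * (α₂ * γ₃ - γ₂ * α₃) - (α₂ * β₃ - β₂ * α₃) * (α₃ * γ₂),
        β₂ * α₃ * (β₂ * γ₃ - γ₂ * β₃) + (α₂ * β₃ - β₂ * α₃) * (β₂ * γ₃),
        (α₂ * β₃ - β₂ * α₃) * (γ₂ * γ₃)] v *
      (![minor F G i j, minor F G i j, minor F G i p] v z *
        ![minor F G i p, minor F G j p, minor F G j p] v z) := by
  simp only [Fin.sum_univ_three, Matrix.cons_val_zero, Matrix.cons_val_one, Matrix.cons_val]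
  simp only [minorQuad, minor, hF₂, hF₃, hG₂, hG₃]
  ring

open Classical in
theorem Config.le_order_minorQuad (c : Config F G)
    (hQ : EntireNZ (minorQuad F G i j k l α₂ β₂ α₃ β₃))
    (hF₂ : ∀ z, F k z = α₂ * F i z + β₂ * F j z + γ₂ * F p z)
    (hG₂ : ∀ z, G k z = α₂ * G i z + β₂ * G j z + γ₂ * G p z)
    (hF₃ : ∀ z, F l z = α₃ * F i z + β₃ * F j z + γ₃ * F p z)
    (hG₃ : ∀ z, G l z = α₃ * G i z + β₃ * G j z + γ₃ * G p z)
    (hd : [i, j, k, l, m, p].Nodup) (z : ℂ) :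
    (jord (F i) (G i) z + ind (F i) z) + (jord (F j) (G j) z + ind (F j) z) +
      (jord (F k) (G k) z + ind (F k) z) + (jord (F l) (G l) z + ind (F l) z) +
      2 * ind (F m) z + 2 * ind (F p) z + (if 2 ≤ jord (F p) (G p) z then 1 else 0) ≤
      analyticOrderNatAt (minorQuad F G i j k l α₂ β₂ α₃ β₃) z := by
  simp only [List.nodup_cons, List.mem_cons, List.not_mem_nil, or_false, not_or,
    List.nodup_nil, not_false_eq_true, and_true] at hd
  obtain ⟨⟨ij, ik, il, im, ip⟩, ⟨jk, jl, jm, jp⟩, ⟨kl, km, kp⟩, ⟨lm, lp⟩, mp⟩ := hd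
  have hij := Config.order_minor F G i j z
  have hkl := Config.order_minor F G k l z
  have hik := Config.order_minor F G i k z
  have hjl := Config.order_minor F G j l z
  have hip := Config.order_minor F G i p z
  have hjp := Config.order_minor F G j p z
  have eij := c.exc_nonneg ij z
  have ekl := c.exc_nonneg kl z
  have eik := c.exc_nonneg ik z
  have ejl := c.exc_nonneg jl z
  have eip := c.exc_nonneg ip z
  have ejp := c.exc_nonneg jp z
  have hfin : ∀ N : ℤ, N ≤ analyticOrderNatAt (minor F G i j) z +
      analyticOrderNatAt (minor F G k l) z → N ≤ analyticOrderNatAt (minor F G i k) z +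
      analyticOrderNatAt (minor F G j l) z →
      N ≤ analyticOrderNatAt (minorQuad F G i j k l α₂ β₂ α₃ β₃) z := fun N h1 h2 =>
    hQ.le_order_of_eq_sum ![β₂ * α₃, α₂ * β₃ - β₂ * α₃] (X := ![minor F G i j, minor F G i k])
      (Y := ![minor F G k l, minor F G j l])
      (by intro v; fin_cases v; exacts [c.minor_nz _ _ ij, c.minor_nz _ _ ik])
      (by intro v; fin_cases v; exacts [c.minor_nz _ _ kl, c.minor_nz _ _ jl])
      (fun w => by simp [Fin.sum_univ_two, minorQuad])
      (by intro v; fin_cases v; exacts [h1, h2])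
  by_cases hp : F p z = 0
  · have hs := c.sum_ind_of_eq hp
    have h1 := c.of_eq hp
    have hi := c.of_ne fun h => ip (c.disj _ _ z h hp)
    have hj := c.of_ne fun h => jp (c.disj _ _ z h hp)
    have hk := c.of_ne fun h => kp (c.disj _ _ z h hp)
    have hl := c.of_ne fun h => lp (c.disj _ _ z h hp)
    have hm := c.of_ne fun h => mp (c.disj _ _ z h hp)
    split_ifs with h2
    · refine hQ.le_order_of_eq_sum _
        (by intro v; fin_cases v; exacts [c.minor_nz _ _ ij, c.minor_nz _ _ ij, c.minor_nz _ _ ip])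
        (by intro v; fin_cases v; exacts [c.minor_nz _ _ ip, c.minor_nz _ _ jp, c.minor_nz _ _ jp])
        (minorQuad_eq hF₂ hG₂ hF₃ hG₃) ?_
      intro v
      fin_cases v
      · change _ ≤ (analyticOrderNatAt (minor F G i j) z : ℤ) + analyticOrderNatAt (minor F G i p) z
        omega
      · change _ ≤ (analyticOrderNatAt (minor F G i j) z : ℤ) + analyticOrderNatAt (minor F G j p) z
        omega
      · change _ ≤ (analyticOrderNatAt (minor F G i p) z : ℤ) + analyticOrderNatAt (minor F G j p) z
        omega
    · refine hfin _ ?_ ?_ <;> omega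
  have hp' := c.of_ne hp
  rw [if_neg (by omega)]
  refine hfin _ ?_ ?_
  all_goals
    rcases c.cases z with h | ⟨w, hw, h⟩
    · have hs := c.sum_ind_of_ne h
      have hi := c.of_ne (h i)
      have hj := c.of_ne (h j)
      have hk := c.of_ne (h k)
      have hl := c.of_ne (h l)
      have hm := c.of_ne (h m)
      omega
    · have hs := c.sum_ind_of_eq hw
      have h1 := c.of_eq hw
      have hne : ∀ v, v ≠ w → _ := fun v hv => c.of_ne (h v hv)
      by_cases wi : i = w
      · subst wi
        have := hne j (Ne.symm ij)
        have := hne k (Ne.symm ik)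
        have := hne l (Ne.symm il)
        have := hne m (Ne.symm im)
        omega
      by_cases wj : j = w
      · subst wj
        have := hne i ij
        have := hne k (Ne.symm jk)
        have := hne l (Ne.symm jl)
        have := hne m (Ne.symm jm)
        omega
      by_cases wk : k = w
      · subst wk
        have := hne i ik
        have := hne j jk
        have := hne l (Ne.symm kl)
        have := hne m (Ne.symm km)
        omega
      by_cases wl : l = w
      · subst wl
        have := hne i il
        have := hne j jl
        have := hne k kl
        have := hne m (Ne.symm lm)
        omega
      have := hne i wi
      have := hne j wj
      have := hne k wk
      have := hne l wl
      by_cases wm : m = w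
      · subst wm
        omega
      · have := hne m wm
        omega

end

namespace MainBounds

open Real

variable {E : Frame} {F G : Fin (2 * 2 + 2) → ℂ → ℂ} {tf tg : ℝ → ℝ} {α₂ β₂ γ₂ α₃ β₃ γ₃ : ℂ}

theorem small_ind_last (b : MainBounds 2 E F G tf tg) (c : Config F G) (a : Adapted E F G)
    (hQ : EntireNZ (minorQuad F G 0 1 2 3 α₂ β₂ α₃ β₃))
    (hQZ : ∀ z, minorQuad F G 0 1 2 3 α₂ β₂ α₃ β₃ z = 0 → E.Z z = 0)
    (hQle : E.Small fun r => circleAverage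
      (fun z => log ‖minorQuad F G 0 1 2 3 α₂ β₂ α₃ β₃ z‖) 0 r - 2 * (tf r + tg r))
    (hF₂ : ∀ z, F 2 z = α₂ * F 0 z + β₂ * F 1 z + γ₂ * F 5 z)
    (hG₂ : ∀ z, G 2 z = α₂ * G 0 z + β₂ * G 1 z + γ₂ * G 5 z)
    (hF₃ : ∀ z, F 3 z = α₃ * F 0 z + β₃ * F 1 z + γ₃ * F 5 z)
    (hG₃ : ∀ z, G 3 z = α₃ * G 0 z + β₃ * G 1 z + γ₃ * G 5 z)
    (htr : ∀ z, min (analyticOrderNatAt (F 5) z) 3 = min (analyticOrderNatAt (G 5) z) 3) :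
    E.Small (E.N (ind (F 5))) := by
  classical
  have h1 := b.small_gap c a (i := 0) (j := 1) (by decide)
  have h2 := b.small_gap c a (i := 2) (j := 3) (by decide)
  refine ((((h1.add h2).add hQle).add (E.jensen_le hQ hQZ)).add (b.small_tdef c a 5)).mono
    fun r M hg => ?_
  have h3 := E.N_mono (c.le_order_minorQuad (m := 4) hQ hF₂ hG₂ hF₃ hG₃ (by decide)) hg.one_le
  have h4 : E.N (ind (F 5)) r ≤ E.N (fun z => (if 2 ≤ jord (F 5) (G 5) z then 1 else 0) +
      tdef 2 (F 5) (G 5) z) r := by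
    refine E.N_mono (fun z => ?_) hg.one_le
    have h5 := htr z
    have h6 := c.tdef_nonneg 2 5 z
    by_cases h : F 5 z = 0
    · have h7 := c.of_eq h
      rw [h7.2.2.2]
      split_ifs with h8
      · omega
      · unfold tdef
        rw [h7.2.2.2]
        unfold jord at h8 ⊢
        push_cast
        omega
    · have h7 := c.of_ne h
      rw [h7.2.2.2]
      split_ifs <;> omega
  have h5 : ∀ x : Fin (2 * 2 + 2) → ℝ, ∑ v, x v = x 0 + x 1 + x 2 + x 3 + x 4 + x 5 :=
    fun x => Fin.sum_univ_six x
  have e2 : ∀ (φ : ℂ → ℤ), E.N (fun z => 2 * φ z) r = 2 * E.N φ r := fun φ => by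
    simpa using E.N_nsmul 2 φ r
  simp only [Frame.N_add, e2] at h3 h4
  simp only [gap, h5]
  linarith

/-- The case `n = 2` of the main estimate. -/
theorem small_of_eq_two (b : MainBounds 2 E F G tf tg) (c : Config F G) (a : Adapted E F G)
    (hlast : E.Small (E.N (ind (F 5)))) : E.Small fun r => tf r + tg r := by
  refine b.small_of_small_sum_ind c ?_
  have h := fun i j k => small_sum_ind c a (b.small_exc c a) (i := i) (j := j) (k := k)
  have h0 := h 0 1 5 (by decide) (by decide) (by decide)
  have h1 := h 1 2 5 (by decide) (by decide) (by decide)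
  have h2 := h 2 3 5 (by decide) (by decide) (by decide)
  have h3 := h 3 4 5 (by decide) (by decide) (by decide)
  have h4 := h 4 0 5 (by decide) (by decide) (by decide)
  refine (((((h0.add h1).add h2).add h3).add h4).add
    (hlast.const_mul (c := 6) (by norm_num))).mono fun r M _ => ?_
  have h5 : ∀ x : Fin (2 * 2 + 2) → ℝ, ∑ v, x v = x 0 + x 1 + x 2 + x 3 + x 4 + x 5 :=
    fun x => Fin.sum_univ_six x
  simp only [h5]
  linarith

end MainBounds

/-- The characteristic function of the map with components `f`. -/
def chr {N : ℕ} (f : Fin N → ℂ → ℂ) (r : ℝ) : ℝ :=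
  Real.circleAverage (fun z => Real.log ‖fun i => f i z‖) 0 r

section

variable {n : ℕ} {f g : Fin (n + 1) → ℂ → ℂ}

theorem differentiable_lform (hf : ∀ i, Differentiable ℂ (f i)) (a : Fin (n + 1) → ℂ) :
    Differentiable ℂ (lform a f) := by
  unfold lform
  fun_prop

theorem norm_lform_le (a : Fin (n + 1) → ℂ) (f : Fin (n + 1) → ℂ → ℂ) (z : ℂ) :
    ‖lform a f z‖ ≤ (∑ i, ‖a i‖) * ‖fun i => f i z‖ := by
  unfold lform
  rw [Finset.sum_mul]
  refine (norm_sum_le _ _).trans (Finset.sum_le_sum fun i _ => ?_)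
  rw [norm_mul]
  exact mul_le_mul_of_nonneg_left (norm_le_pi_norm (fun i => f i z) i) (norm_nonneg _)

theorem ReducedRepr.norm_pos (hf : ReducedRepr n f) (z : ℂ) : 0 < ‖fun i => f i z‖ := by
  obtain ⟨i, hi⟩ := hf.2 z
  exact norm_pos_iff.2 fun h => hi (congrFun h i)

theorem ReducedRepr.continuous_log (hf : ReducedRepr n f) :
    Continuous fun z => Real.log ‖fun i => f i z‖ :=
  Continuous.log (continuous_pi fun i => (hf.1 i).continuous).norm fun z => (hf.norm_pos z).ne'

open Real in
theorem circleAverage_log_le_chr (hf : ReducedRepr n f) (hg : ReducedRepr n g) {u : ℂ → ℝ}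
    (hu : Continuous u) {C : ℝ} (hC : 0 < C) {a b : ℕ}
    (hle : ∀ z, u z ≤ C * (‖fun i => f i z‖ ^ a * ‖fun i => g i z‖ ^ b)) {r : ℝ} (hr : 0 ≤ r)
    (hpos : ∀ z, ‖z‖ = r → 0 < u z) :
    circleAverage (fun z => log (u z)) 0 r ≤ log C + (a * chr f r + b * chr g r) := by
  have i1 : CircleIntegrable (fun z => log (u z)) 0 r := ContinuousOn.circleIntegrable hr
    (ContinuousOn.log hu.continuousOn fun z hz => (hpos z (by simpa using hz)).ne')
  have i2 : CircleIntegrable (fun z => (a : ℝ) • log ‖fun i => f i z‖) 0 r :=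
    (hf.continuous_log.const_smul (a : ℝ)).continuousOn.circleIntegrable hr
  have i3 : CircleIntegrable (fun z => (b : ℝ) • log ‖fun i => g i z‖) 0 r :=
    (hg.continuous_log.const_smul (b : ℝ)).continuousOn.circleIntegrable hr
  have i4 : CircleIntegrable (fun _ => log C) (0 : ℂ) r :=
    ContinuousOn.circleIntegrable hr continuousOn_const
  have i5 : CircleIntegrable (fun z => (a : ℝ) • log ‖fun i => f i z‖ +
    (b : ℝ) • log ‖fun i => g i z‖) 0 r := i2.add i3
  rw [chr, chr, ← smul_eq_mul (a : ℝ), ← smul_eq_mul (b : ℝ), ← circleAverage_fun_smul,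
    ← circleAverage_fun_smul, ← circleAverage_const (log C) (0 : ℂ) r,
    ← circleAverage_fun_add i2 i3, ← circleAverage_fun_add i4 i5]
  refine circleAverage_mono i1 (i4.add i5) fun z hz => ?_
  rw [abs_of_nonneg hr] at hz
  have p1 := hf.norm_pos z
  have p2 := hg.norm_pos z
  have := log_le_log (hpos z (by simpa using hz)) (hle z)
  rw [log_mul hC.ne' (by positivity), log_mul (by positivity) (by positivity), log_pow,
    log_pow] at this
  exact this

end

section

variable {n : ℕ} {f g : Fin (n + 1) → ℂ → ℂ}

theorem EntireNZ.eventually_codiscreteWithin {F : ℂ → ℂ} (hF : EntireNZ F) (U : Set ℂ) :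
    ∀ᶠ z in codiscreteWithin U, F z ≠ 0 := by
  obtain ⟨-, z₀, h₀⟩ := id hF
  have h := AnalyticOnNhd.preimage_zero_mem_codiscrete (f := F) (x := z₀)
    (fun z _ => hF.1.analyticAt z) h₀
  exact codiscreteWithin_mono (Set.subset_univ U) h

open Real in
theorem circleAverage_log_norm_le_chr (hf : ReducedRepr n f) {F : ℂ → ℂ} (hF : EntireNZ F) {C : ℝ}
    (hC : 0 < C) (hle : ∀ z, ‖F z‖ ≤ C * ‖fun i => f i z‖) {r : ℝ} (hr : 1 ≤ r) :
    circleAverage (fun z => log ‖F z‖) 0 r ≤ log C + chr f r := by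
  classical
  have hr0 : 0 ≤ r := zero_le_one.trans hr
  set u : ℂ → ℝ := fun z => if F z = 0 then log C + log ‖fun i => f i z‖ else log ‖F z‖ with hu
  have hcod : (fun z => log ‖F z‖) =ᶠ[codiscreteWithin (Metric.sphere 0 |r|)] u := by
    filter_upwards [hF.eventually_codiscreteWithin (Metric.sphere 0 |r|)] with z hz
    simp [hu, hz]
  have i1 : CircleIntegrable (fun z => log ‖F z‖) 0 r :=
    MeromorphicOn.circleIntegrable_log_norm fun z _ => hF.meromorphic z
  have i2 : CircleIntegrable u 0 r := i1.congr_codiscreteWithin hcod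
  have i3 : CircleIntegrable (fun _ => log C) (0 : ℂ) r :=
    ContinuousOn.circleIntegrable hr0 continuousOn_const
  have i4 : CircleIntegrable (fun z => log ‖fun i => f i z‖) 0 r :=
    hf.continuous_log.continuousOn.circleIntegrable hr0
  rw [circleAverage_congr_codiscreteWithin hcod (by linarith), chr,
    ← circleAverage_const (log C) (0 : ℂ) r, ← circleAverage_fun_add i3 i4]
  refine circleAverage_mono i2 (i3.add i4) fun z _ => ?_
  simp only [hu]
  split_ifs with h
  · exact le_rfl
  · rw [← log_mul hC.ne' (hf.norm_pos z).ne']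
    exact log_le_log (norm_pos_iff.2 h) (hle z)

open Real in
/-- The first main theorem. -/
theorem exists_cnt_le_chr {Z : ℂ → ℂ} (hZ : EntireNZ Z) (hf : ReducedRepr n f) {F : ℂ → ℂ}
    (hF : EntireNZ F) (hFZ : ∀ z, F z = 0 → Z z = 0) {C : ℝ}
    (hle : ∀ z, ‖F z‖ ≤ C * ‖fun i => f i z‖) :
    ∃ D, 0 ≤ D ∧ ∀ r, 1 ≤ r → cnt Z (fun z => analyticOrderNatAt F z) r ≤ chr f r + D := by
  obtain ⟨D, hD, hb⟩ := exists_abs_cnt_sub_circleAverage_le hZ hF hFZ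
  refine ⟨D + |log (|C| + 1)|, by positivity, fun r hr => ?_⟩
  have h1 := (abs_le.1 (hb r hr)).2
  have h2 := circleAverage_log_norm_le_chr hf hF (C := |C| + 1) (by positivity) (fun z =>
    (hle z).trans (mul_le_mul_of_nonneg_right (by linarith [le_abs_self C]) (norm_nonneg _))) hr
  have h3 := le_abs_self (log (|C| + 1))
  linarith

/-- The characteristic function is bounded below. -/
theorem exists_neg_le_chr (hf : ReducedRepr n f) {a : Fin (n + 1) → ℂ}
    (ha : EntireNZ (lform a f)) : ∃ D, 0 ≤ D ∧ ∀ r, 1 ≤ r → -D ≤ chr f r := by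
  obtain ⟨D, hD, hb⟩ := exists_cnt_le_chr ha hf ha (fun _ h => h) (norm_lform_le a f)
  refine ⟨D, hD, fun r hr => ?_⟩
  have := cnt_nonneg ha (φ := fun z => analyticOrderNatAt (lform a f) z)
    (fun z _ => Int.natCast_nonneg _) hr
  linarith [hb r hr]

end

theorem exists_entireNZ_of_finite {S : Set (ℂ → ℂ)} (hS : S.Finite) (h : ∀ X ∈ S, EntireNZ X) :
    ∃ Z, EntireNZ Z ∧ ∀ X ∈ S, ∀ z, X z = 0 → Z z = 0 := by
  refine ⟨fun z => ∏ X ∈ hS.toFinset, X z, EntireNZ.prod _ (F := fun X => X)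
    fun X hX => h X (by simpa using hX), fun X hX z hz => ?_⟩
  exact Finset.prod_eq_zero (hS.mem_toFinset.2 hX) hz

theorem norm_minor_le {q : ℕ} {F G : Fin q → ℂ → ℂ} {A x y : ℝ} {z : ℂ} (hA : 0 ≤ A)
    (hx : 0 ≤ x) (hF : ∀ v, ‖F v z‖ ≤ A * x) (hG : ∀ v, ‖G v z‖ ≤ A * y) (i j : Fin q) :
    ‖minor F G i j z‖ ≤ 2 * A ^ 2 * (x * y) := by
  have h1 : ‖F i z * G j z‖ ≤ (A * x) * (A * y) := by
    rw [norm_mul]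
    exact mul_le_mul (hF i) (hG j) (norm_nonneg _) (by positivity)
  have h2 : ‖F j z * G i z‖ ≤ (A * x) * (A * y) := by
    rw [norm_mul]
    exact mul_le_mul (hF j) (hG i) (norm_nonneg _) (by positivity)
  have h3 := norm_sub_le (F i z * G j z) (F j z * G i z)
  unfold minor
  nlinarith

theorem norm_triple_le {q : ℕ} {F G : Fin q → ℂ → ℂ} {A x y : ℝ} {z : ℂ} (hA : 0 ≤ A)
    (hx : 0 ≤ x) (hy : 0 ≤ y) (hF : ∀ v, ‖F v z‖ ≤ A * x) (hG : ∀ v, ‖G v z‖ ≤ A * y)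
    (i j k : Fin q) : ‖triple F G i j k z‖ ≤ 2 * A ^ 3 * (x * y ^ 2) := by
  have h1 := mul_le_mul (hG i) (norm_minor_le hA hx hF hG j k) (norm_nonneg _) (by positivity)
  rw [triple, norm_mul]
  exact h1.trans_eq (by ring)

section

variable {n q : ℕ} {f g : Fin (n + 1) → ℂ → ℂ} {F G : Fin q → ℂ → ℂ}

open Real in
theorem circleAverage_log_max_le_chr (hf : ReducedRepr n f) (hg : ReducedRepr n g) {P Q : ℂ → ℂ}
    (hP : Continuous P) (hQ : Continuous Q) {C : ℝ} (hC : 0 < C) {a b : ℕ}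
    (hPle : ∀ z, ‖P z‖ ≤ C * (‖fun i => f i z‖ ^ a * ‖fun i => g i z‖ ^ b))
    (hQle : ∀ z, ‖Q z‖ ≤ C * (‖fun i => f i z‖ ^ a * ‖fun i => g i z‖ ^ b)) {r : ℝ} (hr : 1 ≤ r)
    (hPr : ∀ z, ‖z‖ = r → P z ≠ 0) (ha : a ≤ 2) (hb : b ≤ 2) {D : ℝ} (hfD : -D ≤ chr f r)
    (hgD : -D ≤ chr g r) (hD : 0 ≤ D) :
    circleAverage (fun z => log (max ‖P z‖ ‖Q z‖)) 0 r ≤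
      2 * (chr f r + chr g r) + (log C + 4 * D) := by
  have h1 := circleAverage_log_le_chr (u := fun z => max ‖P z‖ ‖Q z‖) hf hg
    (hP.norm.max hQ.norm) hC (fun z => max_le (hPle z) (hQle z)) (zero_le_one.trans hr)
    (fun z hz => lt_max_of_lt_left (norm_pos_iff.2 (hPr z hz)))
  have key : ∀ (m : ℕ) (t : ℝ), m ≤ 2 → -D ≤ t → m * t ≤ 2 * t + 2 * D := by
    intro m t hm ht
    have hm' : (m : ℝ) ≤ 2 := by exact_mod_cast hm
    have := mul_nonneg (sub_nonneg.2 hm') (by linarith : (0 : ℝ) ≤ t + D)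
    nlinarith [(Nat.cast_nonneg m : (0 : ℝ) ≤ m)]
  linarith [key a _ ha hfD, key b _ hb hgD]

open Real in
theorem exists_frame (c : Config F G) (hf : ReducedRepr n f) (hg : ReducedRepr n g) {A : ℝ}
    (hF : ∀ v z, ‖F v z‖ ≤ A * ‖fun i => f i z‖) (hG : ∀ v z, ‖G v z‖ ≤ A * ‖fun i => g i z‖)
    {S : Set (ℂ → ℂ)} (hS : S.Finite) (hSnz : ∀ X ∈ S, EntireNZ X)
    (hwr : ∀ i j k, i ≠ j → j ≠ k → k ≠ i →
      EntireNZ (wronskian ![triple F G i j k, triple F G j k i]) ∧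
      EntireNZ (wronskian ![triple G F i j k, triple G F j k i]))
    {D : ℝ} (hD : 0 ≤ D) (hfD : ∀ r, 1 ≤ r → -D ≤ chr f r) (hgD : ∀ r, 1 ≤ r → -D ≤ chr g r)
    (hgrow : ∀ C : ℝ, ∃ r₀, ∀ r, r₀ ≤ r → C * log r ≤ chr f r + chr g r) {K : ℕ} (hK : 1 ≤ K) :
    ∃ E : Frame, E.K = K ∧ Adapted E F G ∧ (∀ X ∈ S, ∀ z, X z = 0 → E.Z z = 0) ∧
      (∀ v w, (F v, F w) ∈ E.fam) ∧ (∀ v w, (G v, G w) ∈ E.fam) ∧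
      ¬ E.Small fun r => chr f r + chr g r := by
  classical
  let S₁ : Set (ℂ → ℂ) := S ∪ Set.range F ∪
    Set.range (fun p : {p : Fin q × Fin q // p.1 ≠ p.2} => minor F G p.1.1 p.1.2) ∪
    Set.range (fun t : {t : Fin q × Fin q × Fin q // t.1 ≠ t.2.1 ∧ t.2.1 ≠ t.2.2 ∧ t.2.2 ≠ t.1} =>
      wronskian ![triple F G t.1.1 t.1.2.1 t.1.2.2, triple F G t.1.2.1 t.1.2.2 t.1.1]) ∪
    Set.range (fun t : {t : Fin q × Fin q × Fin q // t.1 ≠ t.2.1 ∧ t.2.1 ≠ t.2.2 ∧ t.2.2 ≠ t.1} =>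
      wronskian ![triple G F t.1.1 t.1.2.1 t.1.2.2, triple G F t.1.2.1 t.1.2.2 t.1.1])
  have hS₁ : S₁.Finite := (((hS.union (Set.finite_range _)).union (Set.finite_range _)).union
    (Set.finite_range _)).union (Set.finite_range _)
  have hS₁nz : ∀ X ∈ S₁, EntireNZ X := by
    rintro X ((((h | ⟨v, rfl⟩) | ⟨p, rfl⟩) | ⟨t, rfl⟩) | ⟨t, rfl⟩)
    · exact hSnz X h
    · exact c.left v
    · exact c.minor_nz _ _ p.2
    · exact (hwr _ _ _ t.2.1 t.2.2.1 t.2.2.2).1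
    · exact (hwr _ _ _ t.2.1 t.2.2.1 t.2.2.2).2
  obtain ⟨Z, hZ, hZS⟩ := exists_entireNZ_of_finite hS₁ hS₁nz
  let I := {t : Fin q × Fin q × Fin q // t.2.1 ≠ t.2.2}
  let τ : (Fin q → ℂ → ℂ) → (Fin q → ℂ → ℂ) → I → ℂ → ℂ :=
    fun X Y t => triple X Y t.1.1 t.1.2.1 t.1.2.2
  let pairs : ∀ {ι : Type}, (ι → ℂ → ℂ) → Set ((ℂ → ℂ) × (ℂ → ℂ)) := fun {ι} X =>
    Set.range fun p : ι × ι => (X p.1, X p.2)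
  let 𝓠 : Set ((ℂ → ℂ) × (ℂ → ℂ)) := pairs F ∪ pairs G ∪ pairs (τ F G) ∪ pairs (τ G F)
  have h𝓠 : 𝓠.Finite := (((Set.finite_range _).union (Set.finite_range _)).union
    (Set.finite_range _)).union (Set.finite_range _)
  let E : Frame := ⟨Z, hZ, h𝓠.toFinset, K⟩
  have hzF : ∀ v z, F v z = 0 → Z z = 0 := fun v => hZS _ (by simp [S₁])
  have hzm : ∀ i j z, i ≠ j → minor F G i j z = 0 → Z z = 0 := fun i j z hij =>
    hZS _ (Or.inl (Or.inl (Or.inr ⟨⟨(i, j), hij⟩, rfl⟩))) z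
  have a : Adapted E F G :=
    { one_le := hK
      zero := hzF
      zero_minor := hzm
      wr := fun i j k h1 h2 h3 => ⟨(hwr i j k h1 h2 h3).1,
        hZS _ (Or.inl (Or.inr ⟨⟨(i, j, k), h1, h2, h3⟩, rfl⟩))⟩
      wr_symm := fun i j k h1 h2 h3 => ⟨(hwr i j k h1 h2 h3).2,
        hZS _ (Or.inr ⟨⟨(i, j, k), h1, h2, h3⟩, rfl⟩)⟩
      fam := fun i j k i' j' k' h h' => h𝓠.mem_toFinset.2
        (Or.inl (Or.inr ⟨(⟨(i, j, k), h⟩, ⟨(i', j', k'), h'⟩), rfl⟩))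
      fam_symm := fun i j k i' j' k' h h' => h𝓠.mem_toFinset.2
        (Or.inr ⟨(⟨(i, j, k), h⟩, ⟨(i', j', k'), h'⟩), rfl⟩) }
  refine ⟨E, rfl, a, fun X hX => hZS X (Or.inl (Or.inl (Or.inl (Or.inl hX)))),
    fun v w => h𝓠.mem_toFinset.2 (Or.inl (Or.inl (Or.inl ⟨(v, w), rfl⟩))),
    fun v w => h𝓠.mem_toFinset.2 (Or.inl (Or.inl (Or.inr ⟨(v, w), rfl⟩))), ?_⟩
  have hzG : ∀ v z, G v z = 0 → Z z = 0 := fun v z h => hzF v z ((c.zero_iff v z).2 h)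
  set B : ℝ := |A| + 1 with hB
  have hB1 : 1 ≤ B := by simp [hB]
  have hAB : A ≤ B := by linarith [le_abs_self A]
  have hF' : ∀ z v, ‖F v z‖ ≤ B * ‖fun i => f i z‖ := fun z v =>
    (hF v z).trans (mul_le_mul_of_nonneg_right hAB (norm_nonneg _))
  have hG' : ∀ z v, ‖G v z‖ ≤ B * ‖fun i => g i z‖ := fun z v =>
    (hG v z).trans (mul_le_mul_of_nonneg_right hAB (norm_nonneg _))
  -- a common property of the members of the family
  have hfam : ∀ P ∈ h𝓠.toFinset, (EntireNZ P.1 ∧ EntireNZ P.2) ∧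
      (∀ z, P.1 z = 0 ∨ P.2 z = 0 → Z z = 0) ∧
      ∃ a b : ℕ, a ≤ 2 ∧ b ≤ 2 ∧
        (∀ z, ‖P.1 z‖ ≤ 2 * B ^ 3 * (‖fun i => f i z‖ ^ a * ‖fun i => g i z‖ ^ b)) ∧
        ∀ z, ‖P.2 z‖ ≤ 2 * B ^ 3 * (‖fun i => f i z‖ ^ a * ‖fun i => g i z‖ ^ b) := by
    have hpairs : ∀ {ι : Type} (X : ι → ℂ → ℂ) (a b : ℕ), a ≤ 2 → b ≤ 2 → (∀ i, EntireNZ (X i)) →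
        (∀ i z, X i z = 0 → Z z = 0) →
        (∀ i z, ‖X i z‖ ≤ 2 * B ^ 3 * (‖fun i => f i z‖ ^ a * ‖fun i => g i z‖ ^ b)) →
        ∀ P ∈ pairs X, (EntireNZ P.1 ∧ EntireNZ P.2) ∧
      (∀ z, P.1 z = 0 ∨ P.2 z = 0 → Z z = 0) ∧
      ∃ a b : ℕ, a ≤ 2 ∧ b ≤ 2 ∧
        (∀ z, ‖P.1 z‖ ≤ 2 * B ^ 3 * (‖fun i => f i z‖ ^ a * ‖fun i => g i z‖ ^ b)) ∧
        ∀ z, ‖P.2 z‖ ≤ 2 * B ^ 3 * (‖fun i => f i z‖ ^ a * ‖fun i => g i z‖ ^ b) := by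
      rintro ι X a b ha hb h1 h2 h3 P ⟨⟨i, j⟩, rfl⟩
      exact ⟨⟨h1 i, h1 j⟩, fun z h => h.elim (h2 i z) (h2 j z), a, b, ha, hb, h3 i, h3 j⟩
    have hBB : B ≤ 2 * B ^ 3 := by nlinarith [sq_nonneg (B - 1), sq_nonneg B, pow_nonneg (zero_le_one.trans hB1) 3]
    intro P hP
    rcases h𝓠.mem_toFinset.1 hP with ((h | h) | h) | h
    · exact hpairs F 1 0 (by norm_num) (by norm_num) c.left hzF (fun v z => by
        simp only [pow_one, pow_zero, mul_one]
        exact (hF' z v).trans (mul_le_mul_of_nonneg_right hBB (norm_nonneg _))) P h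
    · exact hpairs G 0 1 (by norm_num) (by norm_num) c.right hzG (fun v z => by
        simp only [pow_one, pow_zero, one_mul]
        exact (hG' z v).trans (mul_le_mul_of_nonneg_right hBB (norm_nonneg _))) P h
    · exact hpairs (τ F G) 1 2 (by norm_num) (by norm_num) (fun t => c.triple_nz _ t.2)
        (fun t z h => a.zero_triple c t.2 h) (fun t z => by
        rw [pow_one]
        exact norm_triple_le (by linarith) (norm_nonneg _) (norm_nonneg _) (hF' z) (hG' z) _ _ _)
        P h
    · exact hpairs (τ G F) 2 1 (by norm_num) (by norm_num) (fun t => c.symm.triple_nz _ t.2)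
        (fun t z h => (a.symm c).zero_triple c.symm t.2 h) (fun t z => by
        rw [pow_one, mul_comm (_ ^ 2)]
        exact norm_triple_le (by linarith) (norm_nonneg _) (norm_nonneg _) (hG' z) (hF' z) _ _ _)
        P h
  rintro ⟨C, hC, hsm⟩
  set L : ℝ := |log (2 * B ^ 3)| + 4 * D + 2 with hL
  obtain ⟨r, M, hr, hM, hoff, hder, hT⟩ := exists_good_radius hZ h𝓠.toFinset
    (fun P hP => (hfam P hP).1) (fun P hP => (hfam P hP).2.1)
    (fun r => chr f r + chr g r + 2 * D) (c := L) (by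
      intro P hP r hr hoff
      obtain ⟨⟨h1, h2⟩, h3, a, b, ha, hb, h4, h5⟩ := hfam P hP
      have h6 := circleAverage_log_max_le_chr hf hg h1.1.continuous h2.1.continuous
        (C := 2 * B ^ 3) (by positivity) h4 h5 hr (fun z hz h => hoff z (h3 z (Or.inl h)) hz) ha hb
        (hfD r hr) (hgD r hr) hD
      have h7 : 2 ≤ L := by rw [hL]; linarith [abs_nonneg (log (2 * B ^ 3))]
      have h8 : log (2 * B ^ 3) ≤ L := by rw [hL]; linarith [le_abs_self (log (2 * B ^ 3))]
      nlinarith [hfD r hr, hgD r hr])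
    (fun C' => by
      obtain ⟨r₀, h⟩ := hgrow C'
      exact ⟨r₀, fun r hr => (h r hr).trans (by linarith)⟩) K
    (ε := 1 / (C + 2 * D + 1)) (by positivity)
  have h1 := hsm r M ⟨hr, hM, hoff, hder⟩
  have h2 : (1 + log M) * (C + 2 * D + 1) ≤ chr f r + chr g r + 2 * D := by
    rwa [one_div, inv_mul_eq_div, le_div_iff₀ (by positivity)] at hT
  nlinarith [log_nonneg hM]

end

theorem GenPos.linearIndependent_comp {n q : ℕ} {H : Fin q → Fin (n + 1) → ℂ} (hH : GenPos n q H)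
    (e : Fin (n + 1) ↪ Fin q) : LinearIndependent ℂ fun i => H (e i) := by
  have h := hH (Finset.univ.map e) (by simp)
  exact h.comp (fun i : Fin (n + 1) => (⟨e i, by simp⟩ : (Finset.univ.map e : Finset (Fin q))))
    fun i j hij => e.injective (congrArg Subtype.val hij)

theorem GenPos.ne_zero {n : ℕ} {H : Fin (2 * n + 2) → Fin (n + 1) → ℂ}
    (hH : GenPos n (2 * n + 2) H) (v : Fin (2 * n + 2)) : H v ≠ 0 := by
  have h : ({v} : Finset (Fin (2 * n + 2))).card ≤ n + 1 := by simp
  obtain ⟨s, hs, hs'⟩ := Finset.exists_superset_card_eq h (by simp; omega)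
  exact (hH s hs').ne_zero ⟨v, hs (Finset.mem_singleton_self v)⟩

theorem exists_norm_lform_le {n q : ℕ} (f g : Fin (n + 1) → ℂ → ℂ) (H G : Fin q → Fin (n + 1) → ℂ) :
    ∃ A, 0 ≤ A ∧ (∀ v z, ‖lform (H v) f z‖ ≤ A * ‖fun i => f i z‖) ∧
      ∀ v z, ‖lform (G v) g z‖ ≤ A * ‖fun i => g i z‖ := by
  refine ⟨∑ v, ∑ i, (‖H v i‖ + ‖G v i‖), by positivity, fun v z => ?_, fun v z => ?_⟩
  · exact (norm_lform_le _ _ _).trans <| mul_le_mul_of_nonneg_right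
      ((Finset.sum_le_sum fun i _ => by linarith [norm_nonneg (G v i)]).trans
        (Finset.single_le_sum (f := fun v => ∑ i, (‖H v i‖ + ‖G v i‖))
          (fun _ _ => by positivity) (Finset.mem_univ v))) (norm_nonneg _)
  · exact (norm_lform_le _ _ _).trans <| mul_le_mul_of_nonneg_right
      ((Finset.sum_le_sum fun i _ => by linarith [norm_nonneg (H v i)]).trans
        (Finset.single_le_sum (f := fun v => ∑ i, (‖H v i‖ + ‖G v i‖))
          (fun _ _ => by positivity) (Finset.mem_univ v))) (norm_nonneg _)

section

variable {n : ℕ} {f g : Fin (n + 1) → ℂ → ℂ} {H G : Fin (2 * n + 2) → Fin (n + 1) → ℂ} {E : Frame}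

/-- The second main theorem with truncated counting functions, for disjoint divisors. -/
theorem Frame.small_truncated_second_main (hf : ReducedRepr n f) (hH : GenPos n (2 * n + 2) H)
    (hK : n ≤ E.K) (hF : ∀ v, EntireNZ (lform (H v) f))
    (hdisj : ∀ v w z, lform (H v) f z = 0 → lform (H w) f z = 0 → v = w)
    (hFZ : ∀ v z, lform (H v) f z = 0 → E.Z z = 0) (hW : EntireNZ (wronskian f))
    (hWZ : ∀ z, wronskian f z = 0 → E.Z z = 0)
    (hmem : ∀ v w, (lform (H v) f, lform (H w) f) ∈ E.fam) :
    E.Small fun r => (n + 1) * chr f r -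
      ∑ v, E.N (fun z => min (analyticOrderNatAt (lform (H v) f) z : ℤ) n) r := by
  have h1 := Frame.second_main (E := E) (N := n + 1) (q := 2 * n + 2) (by omega) (by omega)
    (by omega) H hH.linearIndependent_comp f hf.1 (fun v => lform (H v) f) (fun _ _ => rfl) hF hFZ
    hW hWZ hmem
  have h2 : ((2 * n + 2 - (n + 1) : ℕ) : ℝ) = n + 1 := by
    have : 2 * n + 2 - (n + 1) = n + 1 := by omega
    rw [this]; push_cast; ring
  rw [h2] at h1
  refine h1.mono fun r M hg => ?_
  have hpt : ∀ z, (∑ v, (analyticOrderNatAt (lform (H v) f) z : ℤ)) ≤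
      (analyticOrderNatAt (wronskian f) z : ℤ) +
        ∑ v, min (analyticOrderNatAt (lform (H v) f) z : ℤ) n := by
    intro z
    by_cases hz : ∃ w, lform (H w) f z = 0
    · obtain ⟨w, hw⟩ := hz
      have h0 : ∀ v, v ≠ w → analyticOrderNatAt (lform (H v) f) z = 0 := fun v hv =>
        (hF v).order_eq_zero.2 fun h => hv (hdisj v w z h hw)
      rw [Finset.sum_eq_single w (fun v _ hv => by simp [h0 v hv]) (by simp),
        Finset.sum_eq_single w (fun v _ hv => by simp [h0 v hv]) (by simp)]
      have h3 := le_analyticOrderAt_wronskian hf.1 (hH.ne_zero w) (z := z)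
        (m := analyticOrderNatAt (lform (H w) f) z) ((hF w).cast_order z).le
      rw [← hW.le_order_iff] at h3
      omega
    · push Not at hz
      have h0 : ∀ v, analyticOrderNatAt (lform (H v) f) z = 0 := fun v =>
        (hF v).order_eq_zero.2 (hz v)
      simp [h0]
  have h3 := E.N_mono hpt hg.one_le
  rw [Frame.N_sum, Frame.N_add, Frame.N_sum] at h3
  have h4 : chr f r = Real.circleAverage (fun z => Real.log ‖fun i => f i z‖) 0 r := rfl
  rw [h4]
  linarith

open Real in
theorem Frame.small_minor_sub_chr {q : ℕ} {F G : Fin q → ℂ → ℂ} (c : Config F G)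
    (a : Adapted E F G) (hf : ReducedRepr n f) (hg : ReducedRepr n g) {A : ℝ}
    (hF : ∀ v z, ‖F v z‖ ≤ A * ‖fun i => f i z‖) (hG : ∀ v z, ‖G v z‖ ≤ A * ‖fun i => g i z‖)
    {i j : Fin q} (hij : i ≠ j) :
    E.Small fun r => circleAverage (fun z => log ‖minor F G i j z‖) 0 r - (chr f r + chr g r) := by
  have hAB : A ≤ |A| + 1 := by linarith [le_abs_self A]
  refine Frame.small_of_le (C := log (2 * (|A| + 1) ^ 2)) fun r M hgood => ?_
  have := circleAverage_log_le_chr (u := fun z => ‖minor F G i j z‖) (C := 2 * (|A| + 1) ^ 2)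
    (a := 1) (b := 1) hf hg (c.minor_nz i j hij).1.continuous.norm (by positivity) (fun z => by
      simp only [pow_one]
      exact norm_minor_le (by positivity) (norm_nonneg _)
        (fun v => (hF v z).trans (mul_le_mul_of_nonneg_right hAB (norm_nonneg _)))
        (fun v => (hG v z).trans (mul_le_mul_of_nonneg_right hAB (norm_nonneg _))) i j)
    (zero_le_one.trans hgood.one_le) fun z hz => norm_pos_iff.2 fun h =>
      hgood.off z (a.zero_minor i j z hij h) hz
  push_cast at this
  linarith

open Real in
/-- For every finite set of nonzero entire functions there is a frame, controlling these functions,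
in which both main theorems hold but the characteristic functions are not small. -/
theorem exists_frame_mainBounds (hn : 1 ≤ n) (hf : ReducedRepr n f) (hg : ReducedRepr n g)
    (hH : GenPos n (2 * n + 2) H) (hG : GenPos n (2 * n + 2) G)
    (c : Config (fun v => lform (H v) f) fun v => lform (G v) g)
    (hWf : EntireNZ (wronskian f)) (hWg : EntireNZ (wronskian g))
    (hwr : ∀ i j k, i ≠ j → j ≠ k → k ≠ i →
      EntireNZ (wronskian ![triple (fun v => lform (H v) f) (fun v => lform (G v) g) i j k,
        triple (fun v => lform (H v) f) (fun v => lform (G v) g) j k i]) ∧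
      EntireNZ (wronskian ![triple (fun v => lform (G v) g) (fun v => lform (H v) f) i j k,
        triple (fun v => lform (G v) g) (fun v => lform (H v) f) j k i]))
    (hgrow : ∀ C : ℝ, ∃ r₀, ∀ r, r₀ ≤ r → C * log r ≤ chr f r + chr g r)
    {X : ℂ → ℂ} (hX : EntireNZ X) :
    ∃ E : Frame, Adapted E (fun v => lform (H v) f) (fun v => lform (G v) g) ∧
      MainBounds n E (fun v => lform (H v) f) (fun v => lform (G v) g) (chr f) (chr g) ∧
      (∀ z, X z = 0 → E.Z z = 0) ∧ ¬ E.Small fun r => chr f r + chr g r := by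
  obtain ⟨D₁, hD₁, hb₁⟩ := exists_neg_le_chr hf (c.left 0)
  obtain ⟨D₂, hD₂, hb₂⟩ := exists_neg_le_chr hg (c.right 0)
  obtain ⟨A, -, hF, hG'⟩ := exists_norm_lform_le f g H G
  obtain ⟨E, hK, a, hS, m₁, m₂, hns⟩ := exists_frame c hf hg hF hG'
    (S := {X, wronskian f, wronskian g}) (by simp)
    (by rintro Y (rfl | rfl | rfl) <;> assumption) hwr (D := D₁ + D₂) (by positivity)
    (fun r hr => by linarith [hb₁ r hr]) (fun r hr => by linarith [hb₂ r hr]) hgrow hn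
  refine ⟨E, a, ⟨fun i j hij => Frame.small_minor_sub_chr c a hf hg hF hG' hij, ?_, ?_⟩,
    hS X (by simp), hns⟩
  · exact Frame.small_truncated_second_main hf hH hK.ge c.left c.disj a.zero hWf
      (hS _ (by simp)) m₁
  · exact Frame.small_truncated_second_main hg hG hK.ge c.right c.symm.disj (a.symm c).zero hWg
      (hS _ (by simp)) m₂

end

/-- `R` is given by a polynomial which is homogeneous of degree `d₁` in the first and of degree
`d₂` in the second group of variables. -/
def IsBiForm {n : ℕ} (d₁ d₂ : ℕ) (R : (Fin (n + 1) → ℂ) → (Fin (n + 1) → ℂ) → ℂ) : Prop :=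
  ∃ Q : MvPolynomial (Fin (n + 1) ⊕ Fin (n + 1)) ℂ,
    MvPolynomial.IsWeightedHomogeneous (Sum.elim (fun _ => 1) (fun _ => 0)) Q d₁ ∧
    MvPolynomial.IsWeightedHomogeneous (Sum.elim (fun _ => 0) (fun _ => 1)) Q d₂ ∧
    ∀ v w, MvPolynomial.eval (Sum.elim v w) Q = R v w

namespace IsBiForm

open MvPolynomial

variable {n d₁ d₂ e₁ e₂ : ℕ} {R S : (Fin (n + 1) → ℂ) → (Fin (n + 1) → ℂ) → ℂ}

theorem isWeightedHomogeneous_sum {ι σ : Type*} [Fintype ι] (w : σ → ℕ) (e : ι → σ) (a : ι → ℂ)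
    {d : ℕ} (h : ∀ i, w (e i) = d) : IsWeightedHomogeneous w (∑ i, C (a i) * X (e i)) d := by
  refine IsWeightedHomogeneous.sum _ _ _ fun i _ => ?_
  have h1 := (isWeightedHomogeneous_C w (a i)).mul (isWeightedHomogeneous_X ℂ w (e i))
  rwa [zero_add, h] at h1

theorem left (a : Fin (n + 1) → ℂ) : IsBiForm (n := n) 1 0 fun v _ => ∑ i, a i * v i :=
  ⟨∑ i, C (a i) * X (Sum.inl i), isWeightedHomogeneous_sum _ _ _ fun _ => rfl,
    isWeightedHomogeneous_sum _ _ _ fun _ => rfl, fun v w => by simp⟩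

theorem right (a : Fin (n + 1) → ℂ) : IsBiForm (n := n) 0 1 fun _ w => ∑ i, a i * w i :=
  ⟨∑ i, C (a i) * X (Sum.inr i), isWeightedHomogeneous_sum _ _ _ fun _ => rfl,
    isWeightedHomogeneous_sum _ _ _ fun _ => rfl, fun v w => by simp⟩

theorem mul (hR : IsBiForm d₁ d₂ R) (hS : IsBiForm e₁ e₂ S) :
    IsBiForm (d₁ + e₁) (d₂ + e₂) fun v w => R v w * S v w := by
  obtain ⟨P, h1, h2, h3⟩ := hR
  obtain ⟨Q, k1, k2, k3⟩ := hS
  exact ⟨P * Q, h1.mul k1, h2.mul k2, fun v w => by simp [h3, k3]⟩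

theorem add (hR : IsBiForm d₁ d₂ R) (hS : IsBiForm d₁ d₂ S) :
    IsBiForm d₁ d₂ fun v w => R v w + S v w := by
  obtain ⟨P, h1, h2, h3⟩ := hR
  obtain ⟨Q, k1, k2, k3⟩ := hS
  exact ⟨P + Q, h1.add k1, h2.add k2, fun v w => by simp [h3, k3]⟩

theorem const_mul (a : ℂ) (hR : IsBiForm d₁ d₂ R) : IsBiForm d₁ d₂ fun v w => a * R v w := by
  obtain ⟨P, h1, h2, h3⟩ := hR
  refine ⟨C a * P, ?_, ?_, fun v w => by simp [h3]⟩
  · simpa using (isWeightedHomogeneous_C _ a).mul h1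
  · simpa using (isWeightedHomogeneous_C _ a).mul h2

theorem sub (hR : IsBiForm d₁ d₂ R) (hS : IsBiForm d₁ d₂ S) :
    IsBiForm d₁ d₂ fun v w => R v w - S v w := by
  have := hR.add (hS.const_mul (-1))
  simpa [sub_eq_add_neg] using this

theorem exists_ne_zero {f g : Fin (n + 1) → ℂ → ℂ} (hdeg : ¬ AlgDeg f g) (hR : IsBiForm d₁ d₂ R)
    {v w : Fin (n + 1) → ℂ} (hvw : R v w ≠ 0) : ∃ z, R (fun i => f i z) (fun i => g i z) ≠ 0 := by
  obtain ⟨Q, h1, h2, h3⟩ := hR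
  by_contra! h
  refine hdeg ⟨Q, ?_, ⟨d₁, h1⟩, ⟨d₂, h2⟩, fun z => (h3 _ _).trans (h z)⟩
  rintro rfl
  exact hvw (by rw [← h3, map_zero])

end IsBiForm

theorem entireNZ_lform {n : ℕ} {f : Fin (n + 1) → ℂ → ℂ} (hf : ∀ i, Differentiable ℂ (f i))
    (hlin : LinearIndependent ℂ f) {a : Fin (n + 1) → ℂ} (ha : a ≠ 0) : EntireNZ (lform a f) := by
  refine ⟨differentiable_lform hf a, ?_⟩
  by_contra! h
  refine ha (funext (Fintype.linearIndependent_iff.1 hlin a ?_))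
  ext z
  simpa [lform] using h z

theorem linearIndependent_right_of_not_algDeg {n : ℕ} {f g : Fin (n + 1) → ℂ → ℂ}
    (hdeg : ¬ AlgDeg f g) : LinearIndependent ℂ g := by
  refine Fintype.linearIndependent_iff.2 fun a ha i => ?_
  by_contra hi
  obtain ⟨z, hz⟩ := (IsBiForm.right a).exists_ne_zero hdeg (v := 0) (w := Pi.single i 1)
    (by simpa [Pi.single_apply] using hi)
  refine hz ?_
  simpa using congrFun ha z

/-- Finitely many members of a family in general position take arbitrary values. -/
theorem GenPos.exists_sum_eq {n q : ℕ} {H : Fin q → Fin (n + 1) → ℂ} (hH : GenPos n q H)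
    (hq : n + 1 ≤ q) {s : Finset (Fin q)} (hs : s.card ≤ n + 1) (t : Fin q → ℂ) :
    ∃ v : Fin (n + 1) → ℂ, ∀ i ∈ s, ∑ j, H i j * v j = t i := by
  classical
  obtain ⟨u, hsu, hu⟩ := Finset.exists_superset_card_eq hs (by simpa using hq)
  obtain ⟨φ, hφ⟩ : ∃ φ : (Fin (n + 1) → ℂ) →ₗ[ℂ] ℂ, ∀ i ∈ u, φ (H i) = t i := by
    have h := hH u hu
    obtain ⟨φ, hφ⟩ := LinearMap.exists_extend
      ((Finsupp.linearCombination ℂ fun i : u => t i).comp h.repr)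
    refine ⟨φ, fun i hi => ?_⟩
    have hmem : H i ∈ Submodule.span ℂ (Set.range fun i : u => H i.1) :=
      Submodule.subset_span ⟨⟨i, hi⟩, rfl⟩
    have h1 := LinearMap.congr_fun hφ ⟨H i, hmem⟩
    rw [LinearMap.comp_apply, LinearMap.comp_apply,
      h.repr_eq_single ⟨i, hi⟩ ⟨H i, hmem⟩ rfl] at h1
    simpa using h1
  refine ⟨fun j => φ (Pi.single j 1), fun i hi => ?_⟩
  have h2 := hφ i (hsu hi)
  rw [← h2, LinearMap.pi_apply_eq_sum_univ φ (H i)]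
  refine Finset.sum_congr rfl fun j _ => ?_
  rw [smul_eq_mul]
  congr 1
  change φ _ = φ _
  congr 1
  ext k
  simp [Pi.single_apply, eq_comm]

section

variable {n : ℕ} {f g : Fin (n + 1) → ℂ → ℂ} {H G : Fin (2 * n + 2) → Fin (n + 1) → ℂ}

theorem GenPos.exists_three (hn : 2 ≤ n) (hH : GenPos n (2 * n + 2) H) {i j k : Fin (2 * n + 2)}
    (hij : i ≠ j) (hjk : j ≠ k) (hki : k ≠ i) (x y z : ℂ) :
    ∃ v : Fin (n + 1) → ℂ, ∑ l, H i l * v l = x ∧ ∑ l, H j l * v l = y ∧ ∑ l, H k l * v l = z := by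
  classical
  obtain ⟨v, hv⟩ := hH.exists_sum_eq (by omega) (s := {i, j, k})
    (Finset.card_le_three.trans (by omega)) fun l => if l = i then x else if l = j then y else z
  exact ⟨v, by simpa using hv i (by simp), by simpa [hij.symm] using hv j (by simp),
    by simpa [hki, hjk.symm] using hv k (by simp)⟩

/-- The bihomogeneous form inducing `minor`. -/
theorem isBiForm_minor (a b a' b' : Fin (n + 1) → ℂ) : IsBiForm (n := n) 1 1 fun v w =>
    (∑ l, a l * v l) * (∑ l, b' l * w l) - (∑ l, b l * v l) * (∑ l, a' l * w l) :=
  ((IsBiForm.left a).mul (IsBiForm.right b')).sub ((IsBiForm.left b).mul (IsBiForm.right a'))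

theorem entireNZ_minor_of_not_algDeg (hn : 2 ≤ n) (hdeg : ¬ AlgDeg f g)
    (hf : ∀ i, Differentiable ℂ (f i)) (hg : ∀ i, Differentiable ℂ (g i))
    (hH : GenPos n (2 * n + 2) H) (hG : GenPos n (2 * n + 2) G) {i j : Fin (2 * n + 2)}
    (hij : i ≠ j) : EntireNZ (minor (fun v => lform (H v) f) (fun v => lform (G v) g) i j) := by
  refine ⟨?_, ?_⟩
  · unfold minor
    have := fun a => differentiable_lform hf a
    have := fun a => differentiable_lform hg a
    fun_prop
  · obtain ⟨v, hv⟩ := hH.exists_sum_eq (by omega) (s := {i, j})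
      (Finset.card_le_two.trans (by omega)) fun l => if l = i then 1 else 0
    obtain ⟨w, hw⟩ := hG.exists_sum_eq (by omega) (s := {i, j})
      (Finset.card_le_two.trans (by omega)) fun l => if l = i then 0 else 1
    exact (isBiForm_minor (H i) (H j) (G i) (G j)).exists_ne_zero hdeg (v := v) (w := w) (by
      rw [hv i (by simp), hv j (by simp), hw i (by simp), hw j (by simp)]
      simp [hij.symm])

theorem entireNZ_wronskian_pair {A B : ℂ → ℂ} (hA : Differentiable ℂ A) (hB : Differentiable ℂ B)
    (h : ∀ a b : ℂ, (a ≠ 0 ∨ b ≠ 0) → ∃ z, a * A z + b * B z ≠ 0) :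
    EntireNZ (wronskian ![A, B]) := by
  have hd : ∀ i, Differentiable ℂ (![A, B] i) := by
    intro i
    fin_cases i
    exacts [hA, hB]
  refine ⟨differentiable_wronskian hd, exists_wronskian_ne_zero hd ?_⟩
  rw [LinearIndependent.pair_iff]
  intro a b hab
  by_contra hne
  obtain ⟨z, hz⟩ := h a b (by tauto)
  exact hz (by simpa using congrFun hab z)

theorem entireNZ_wronskian_triple (hn : 2 ≤ n) (hdeg : ¬ AlgDeg f g)
    (hf : ∀ i, Differentiable ℂ (f i)) (hg : ∀ i, Differentiable ℂ (g i))
    (hH : GenPos n (2 * n + 2) H) (hG : GenPos n (2 * n + 2) G) {i j k : Fin (2 * n + 2)}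
    (hij : i ≠ j) (hjk : j ≠ k) (hki : k ≠ i) :
    EntireNZ (wronskian ![triple (fun v => lform (H v) f) (fun v => lform (G v) g) i j k,
      triple (fun v => lform (H v) f) (fun v => lform (G v) g) j k i]) ∧
    EntireNZ (wronskian ![triple (fun v => lform (G v) g) (fun v => lform (H v) f) i j k,
      triple (fun v => lform (G v) g) (fun v => lform (H v) f) j k i]) := by
  have hdf := fun a => differentiable_lform hf a
  have hdg := fun a => differentiable_lform hg a
  constructor
  · refine entireNZ_wronskian_pair (by unfold triple minor; fun_prop)
      (by unfold triple minor; fun_prop) fun a b hab => ?_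
    have hR := (((IsBiForm.right (G i)).mul (isBiForm_minor (H j) (H k) (G j) (G k))).const_mul
      a).add (((IsBiForm.right (G j)).mul (isBiForm_minor (H k) (H i) (G k) (G i))).const_mul b)
    rcases hab with ha | hb
    · obtain ⟨v, v1, v2, v3⟩ := hH.exists_three hn hij hjk hki 0 1 0
      obtain ⟨w, w1, w2, w3⟩ := hG.exists_three hn hij hjk hki 1 0 1
      exact hR.exists_ne_zero hdeg (v := v) (w := w) (by
        rw [v1, v2, v3, w1, w2, w3]; simpa using ha)
    · obtain ⟨v, v1, v2, v3⟩ := hH.exists_three hn hij hjk hki 1 0 0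
      obtain ⟨w, w1, w2, w3⟩ := hG.exists_three hn hij hjk hki 0 1 1
      exact hR.exists_ne_zero hdeg (v := v) (w := w) (by
        rw [v1, v2, v3, w1, w2, w3]; simpa using hb)
  · refine entireNZ_wronskian_pair (by unfold triple minor; fun_prop)
      (by unfold triple minor; fun_prop) fun a b hab => ?_
    have hR := (((IsBiForm.left (H i)).mul (isBiForm_minor (H k) (H j) (G k) (G j))).const_mul
      a).add (((IsBiForm.left (H j)).mul (isBiForm_minor (H i) (H k) (G i) (G k))).const_mul b)
    have hcomb : ∀ z, a * triple (fun v => lform (G v) g) (fun v => lform (H v) f) i j k z +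
        b * triple (fun v => lform (G v) g) (fun v => lform (H v) f) j k i z =
        a * (lform (H i) f z * (lform (H k) f z * lform (G j) g z -
          lform (H j) f z * lform (G k) g z)) + b * (lform (H j) f z *
          (lform (H i) f z * lform (G k) g z - lform (H k) f z * lform (G i) g z)) := by
      intro z
      simp only [triple, minor]
      ring
    simp only [hcomb]
    rcases hab with ha | hb
    · obtain ⟨v, v1, v2, v3⟩ := hH.exists_three hn hij hjk hki 1 0 1
      obtain ⟨w, w1, w2, w3⟩ := hG.exists_three hn hij hjk hki 0 1 0
      exact hR.exists_ne_zero hdeg (v := v) (w := w) (by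
        rw [v1, v2, v3, w1, w2, w3]; simpa using ha)
    · obtain ⟨v, v1, v2, v3⟩ := hH.exists_three hn hij hjk hki 0 1 1
      obtain ⟨w, w1, w2, w3⟩ := hG.exists_three hn hij hjk hki 1 0 0
      exact hR.exists_ne_zero hdeg (v := v) (w := w) (by
        rw [v1, v2, v3, w1, w2, w3]; simpa using hb)

end

theorem lform_sum_smul {n q : ℕ} (b : Fin q → ℂ) (G : Fin q → Fin (n + 1) → ℂ)
    (g : Fin (n + 1) → ℂ → ℂ) (z : ℂ) :
    lform (∑ v, b v • G v) g z = ∑ v, b v * lform (G v) g z := by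
  simp only [lform, Finset.sum_apply, Pi.smul_apply, smul_eq_mul, Finset.sum_mul, Finset.mul_sum]
  rw [Finset.sum_comm]
  exact Finset.sum_congr rfl fun v _ => Finset.sum_congr rfl fun i _ => by ring

section

variable {n : ℕ} {f g : Fin (n + 1) → ℂ → ℂ} {H G : Fin (2 * n + 2) → Fin (n + 1) → ℂ}

theorem sum_ind_le_order {q : ℕ} {F G : Fin q → ℂ → ℂ} (c : Config F G) {X : ℂ → ℂ}
    (hX : EntireNZ X) (h : ∀ v z, F v z = 0 → X z = 0) (z : ℂ) :
    ∑ v, ind (F v) z ≤ (analyticOrderNatAt X z : ℤ) := by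
  by_cases hz : ∃ w, F w z = 0
  · obtain ⟨w, hw⟩ := hz
    rw [c.sum_ind_of_eq hw]
    have := mt hX.order_eq_zero.1 (not_not.2 (h w z hw))
    omega
  · push Not at hz
    rw [c.sum_ind_of_ne hz]
    omega

theorem MainBounds.small_of_sum_eq_zero {E : Frame} {F : Fin (2 * n + 2) → ℂ → ℂ} {tf : ℝ → ℝ}
    (hn : 1 ≤ n) (hg : ReducedRepr n g)
    (c : Config F fun v => lform (G v) g)
    (b : MainBounds n E F (fun v => lform (G v) g) tf (chr g))
    {β : Fin (2 * n + 2) → ℂ} (hβ : ∀ z, ∑ v, β v * F v z = 0)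
    (hX : EntireNZ (lform (∑ v, β v • G v) g))
    (hXZ : ∀ z, lform (∑ v, β v • G v) g z = 0 → E.Z z = 0) :
    E.Small fun r => tf r + chr g r := by
  have hzero : ∀ v z, F v z = 0 → lform (∑ v, β v • G v) g z = 0 := by
    intro i z hi
    obtain ⟨j, hj⟩ : ∃ j, j ≠ i := exists_ne i
    have hFj : F j z ≠ 0 := fun h => hj (c.disj j i z h hi)
    have h1 : (∑ v, β v * F v z) * lform (G j) g z =
        (∑ v, β v * lform (G v) g z) * F j z := by
      rw [Finset.sum_mul, Finset.sum_mul]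
      refine Finset.sum_congr rfl fun v _ => ?_
      rw [mul_assoc, c.coin i v j z hi hFj, mul_assoc]
    rw [hβ, zero_mul, ← lform_sum_smul] at h1
    exact (mul_eq_zero.1 h1.symm).resolve_right hFj
  obtain ⟨D, hD, hb⟩ := exists_cnt_le_chr E.nz hg hX hXZ (norm_lform_le _ g)
  have h1 : E.Small fun r => ∑ v, E.N (ind (F v)) r - chr g r := by
    refine Frame.small_of_le (C := D) fun r M hgood => ?_
    have h2 := E.N_mono (sum_ind_le_order c hX hzero) hgood.one_le
    rw [Frame.N_sum] at h2
    have h3 : E.N (fun z => (analyticOrderNatAt (lform (∑ v, β v • G v) g) z : ℤ)) r ≤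
        chr g r + D := hb r hgood.one_le
    linarith
  refine b.small_of_small_sum_ind c ?_
  refine ((b.right_le_ind c).add (h1.const_mul (c := n + 1) (by positivity))).mono
    fun r M _ => ?_
  apply le_of_eq
  ring

/-- The linear relations between the hyperplanes of the first family hold for the second family. -/
theorem sum_smul_eq_zero_of_frames (hn : 1 ≤ n) (hg : ReducedRepr n g)
    (hlin : LinearIndependent ℂ g)
    (c : Config (fun v => lform (H v) f) fun v => lform (G v) g)
    (hE : ∀ X, EntireNZ X → ∃ E : Frame,
      Adapted E (fun v => lform (H v) f) (fun v => lform (G v) g) ∧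
      MainBounds n E (fun v => lform (H v) f) (fun v => lform (G v) g) (chr f) (chr g) ∧
      (∀ z, X z = 0 → E.Z z = 0) ∧ ¬ E.Small fun r => chr f r + chr g r)
    {β : Fin (2 * n + 2) → ℂ} (hβ : ∑ v, β v • H v = 0) : ∑ v, β v • G v = 0 := by
  by_contra hne
  have hX := entireNZ_lform hg.1 hlin hne
  obtain ⟨E, -, b, hZ, hns⟩ := hE _ hX
  refine hns (b.small_of_sum_eq_zero hn hg c (β := β) (fun z => ?_) hX hZ)
  rw [← lform_sum_smul, hβ]
  simp [lform]

end

section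

open Real

variable {f g : Fin (2 + 1) → ℂ → ℂ} {H G : Fin (2 * 2 + 2) → Fin (2 + 1) → ℂ}

theorem GenPos.exists_relation (hH : GenPos 2 (2 * 2 + 2) H) {i j p : Fin (2 * 2 + 2)} (hij : i ≠ j)
    (hjp : j ≠ p) (hpi : p ≠ i) (k : Fin (2 * 2 + 2)) :
    ∃ α β γ : ℂ, H k = α • H i + β • H j + γ • H p := by
  have hinj : Function.Injective ![i, j, p] := by
    intro x y h
    fin_cases x <;> fin_cases y <;> simp_all
  have h1 := hH.linearIndependent_comp ⟨![i, j, p], hinj⟩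
  have h2 := h1.span_eq_top_of_card_eq_finrank (by simp)
  have h3 : H k ∈ Submodule.span ℂ (Set.range fun x => H (![i, j, p] x)) := by
    have : H k ∈ (⊤ : Submodule ℂ (Fin (2 + 1) → ℂ)) := trivial
    rwa [← h2] at this
  obtain ⟨a, ha⟩ := (Submodule.mem_span_range_iff_exists_fun ℂ).1 h3
  refine ⟨a 0, a 1, a 2, ?_⟩
  rw [← ha, Fin.sum_univ_three]
  rfl

theorem Frame.small_minorQuad_sub_chr {n q : ℕ} {f g : Fin (n + 1) → ℂ → ℂ} {F G : Fin q → ℂ → ℂ}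
    {E : Frame} (hf : ReducedRepr n f) (hg : ReducedRepr n g) {A : ℝ} (hA : 0 ≤ A)
    (hF : ∀ v z, ‖F v z‖ ≤ A * ‖fun i => f i z‖) (hG : ∀ v z, ‖G v z‖ ≤ A * ‖fun i => g i z‖)
    {i j k l : Fin q} {α₂ β₂ α₃ β₃ : ℂ} (hQ : EntireNZ (minorQuad F G i j k l α₂ β₂ α₃ β₃))
    (hQZ : ∀ z, minorQuad F G i j k l α₂ β₂ α₃ β₃ z = 0 → E.Z z = 0) :
    E.Small fun r => circleAverage
      (fun z => log ‖minorQuad F G i j k l α₂ β₂ α₃ β₃ z‖) 0 r - 2 * (chr f r + chr g r) := by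
  set B := ‖β₂ * α₃‖ + ‖α₂ * β₃ - β₂ * α₃‖ with hB
  set C := B * (2 * A ^ 2) ^ 2 + 1 with hC
  have hC0 : 0 < C := by positivity
  refine Frame.small_of_le (C := log C) fun r M hgood => ?_
  have := circleAverage_log_le_chr (u := fun z => ‖minorQuad F G i j k l α₂ β₂ α₃ β₃ z‖) (C := C)
    (a := 2) (b := 2) hf hg hQ.1.continuous.norm hC0 (fun z => by
      have hm : ∀ a b, ‖minor F G a b z‖ ≤ 2 * A ^ 2 * (‖fun i => f i z‖ * ‖fun i => g i z‖) :=
        norm_minor_le hA (norm_nonneg _) (fun v => hF v z) (fun v => hG v z)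
      set t := ‖fun i => f i z‖ * ‖fun i => g i z‖ with ht
      have ht0 : 0 ≤ t := by positivity
      have hmm : ∀ a b a' b' (x : ℂ), ‖x * (minor F G a b z * minor F G a' b' z)‖ ≤
          ‖x‖ * (2 * A ^ 2 * t) ^ 2 := fun a b a' b' x => by
        rw [norm_mul, norm_mul, sq]
        exact mul_le_mul_of_nonneg_left (mul_le_mul (hm a b) (hm a' b') (norm_nonneg _)
          (by positivity)) (norm_nonneg _)
      have h1 := (norm_add_le _ _).trans (add_le_add (hmm i j k l (β₂ * α₃))
        (hmm i k j l (α₂ * β₃ - β₂ * α₃)))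
      refine h1.trans ?_
      rw [← mul_pow, ← ht, hC, ← add_mul, ← hB]
      nlinarith [sq_nonneg t])
    (zero_le_one.trans hgood.one_le) fun z hz => norm_pos_iff.2 fun h => hgood.off z (hQZ z h) hz
  push_cast at this
  linarith

theorem GenPos.minorQuad_form_ne_zero (hH : GenPos 2 (2 * 2 + 2) H) {α₂ β₂ γ₂ α₃ β₃ γ₃ : ℂ}
    (h₂ : H 2 = α₂ • H 0 + β₂ • H 1 + γ₂ • H 5) (h₃ : H 3 = α₃ • H 0 + β₃ • H 1 + γ₃ • H 5) :
    (α₂ * β₃ - β₂ * α₃) * (γ₂ * γ₃) ≠ 0 := by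
  have e₂ : ∀ v : Fin 3 → ℂ, ∑ l, H 2 l * v l =
      α₂ * ∑ l, H 0 l * v l + β₂ * ∑ l, H 1 l * v l + γ₂ * ∑ l, H 5 l * v l := by
    intro v
    rw [h₂]
    simp only [Pi.add_apply, Pi.smul_apply, smul_eq_mul, Finset.mul_sum]
    rw [← Finset.sum_add_distrib, ← Finset.sum_add_distrib]
    exact Finset.sum_congr rfl fun _ _ => by ring
  have e₃ : ∀ v : Fin 3 → ℂ, ∑ l, H 3 l * v l =
      α₃ * ∑ l, H 0 l * v l + β₃ * ∑ l, H 1 l * v l + γ₃ * ∑ l, H 5 l * v l := by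
    intro v
    rw [h₃]
    simp only [Pi.add_apply, Pi.smul_apply, smul_eq_mul, Finset.mul_sum]
    rw [← Finset.sum_add_distrib, ← Finset.sum_add_distrib]
    exact Finset.sum_congr rfl fun _ _ => by ring
  refine mul_ne_zero ?_ (mul_ne_zero ?_ ?_)
  · obtain ⟨v, v2, v3, v5⟩ := hH.exists_three le_rfl (i := 2) (j := 3) (k := 5) (by decide)
      (by decide) (by decide) 0 1 0
    obtain ⟨w, w2, w3, w5⟩ := hH.exists_three le_rfl (i := 2) (j := 3) (k := 5) (by decide)
      (by decide) (by decide) 1 0 0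
    have a1 := e₂ v
    have a2 := e₃ v
    have a3 := e₂ w
    have a4 := e₃ w
    rw [v2, v5] at a1
    rw [v3, v5] at a2
    rw [w2, w5] at a3
    rw [w3, w5] at a4
    intro h
    grind
  · obtain ⟨v, v0, v1, v2⟩ := hH.exists_three le_rfl (i := 0) (j := 1) (k := 2) (by decide)
      (by decide) (by decide) 0 0 1
    rintro rfl
    have := e₂ v
    simp [v0, v1, v2] at this
  · obtain ⟨v, v0, v1, v2⟩ := hH.exists_three le_rfl (i := 0) (j := 1) (k := 3) (by decide)
      (by decide) (by decide) 0 0 1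
    rintro rfl
    have := e₃ v
    simp [v0, v1, v2] at this

end

section

open Real

theorem entireNZ_minorQuad_of_not_algDeg {f g : Fin (2 + 1) → ℂ → ℂ}
    {H G : Fin (2 * 2 + 2) → Fin (2 + 1) → ℂ} (hdeg : ¬ AlgDeg f g)
    (hf : ∀ i, Differentiable ℂ (f i)) (hg : ∀ i, Differentiable ℂ (g i))
    (hH : GenPos 2 (2 * 2 + 2) H) (hG : GenPos 2 (2 * 2 + 2) G) {α₂ β₂ γ₂ α₃ β₃ γ₃ : ℂ}
    (hH₂ : H 2 = α₂ • H 0 + β₂ • H 1 + γ₂ • H 5) (hH₃ : H 3 = α₃ • H 0 + β₃ • H 1 + γ₃ • H 5)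
    (hG₂ : G 2 = α₂ • G 0 + β₂ • G 1 + γ₂ • G 5) (hG₃ : G 3 = α₃ • G 0 + β₃ • G 1 + γ₃ • G 5) :
    EntireNZ (minorQuad (fun v => lform (H v) f) (fun v => lform (G v) g) 0 1 2 3
      α₂ β₂ α₃ β₃) := by
  have hdf := fun a => differentiable_lform hf a
  have hdg := fun a => differentiable_lform hg a
  refine ⟨by unfold minorQuad minor; fun_prop, ?_⟩
  have hR := (((isBiForm_minor (H 0) (H 1) (G 0) (G 1)).mul
    (isBiForm_minor (H 2) (H 3) (G 2) (G 3))).const_mul (β₂ * α₃)).add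
    (((isBiForm_minor (H 0) (H 2) (G 0) (G 2)).mul
    (isBiForm_minor (H 1) (H 3) (G 1) (G 3))).const_mul (α₂ * β₃ - β₂ * α₃))
  obtain ⟨v, v0, v1, v5⟩ := hH.exists_three le_rfl (i := 0) (j := 1) (k := 5) (by decide)
    (by decide) (by decide) 1 1 0
  obtain ⟨w, w0, w1, w5⟩ := hG.exists_three le_rfl (i := 0) (j := 1) (k := 5) (by decide)
    (by decide) (by decide) 0 0 1
  have e : ∀ {a b c d : Fin (2 + 1) → ℂ} {α β γ : ℂ} (u : Fin (2 + 1) → ℂ),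
      d = α • a + β • b + γ • c → ∑ l, d l * u l =
        α * ∑ l, a l * u l + β * ∑ l, b l * u l + γ * ∑ l, c l * u l := by
    rintro a b c _ α β γ u rfl
    simp only [Pi.add_apply, Pi.smul_apply, smul_eq_mul, Finset.mul_sum]
    rw [← Finset.sum_add_distrib, ← Finset.sum_add_distrib]
    exact Finset.sum_congr rfl fun _ _ => by ring
  refine hR.exists_ne_zero hdeg (v := v) (w := w) ?_
  rw [e v hH₂, e v hH₃, e w hG₂, e w hG₃, v0, v1, v5, w0, w1, w5]
  have := hH.minorQuad_form_ne_zero hH₂ hH₃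
  convert this using 1
  ring

/-- The main estimate in case `n = 2`, for the frames containing the zeros of `minorQuad`. -/
theorem false_of_frames_of_eq_two {f g : Fin (2 + 1) → ℂ → ℂ}
    {H G : Fin (2 * 2 + 2) → Fin (2 + 1) → ℂ} (hdeg : ¬ AlgDeg f g) (hf : ReducedRepr 2 f)
    (hg : ReducedRepr 2 g) (hH : GenPos 2 (2 * 2 + 2) H) (hG : GenPos 2 (2 * 2 + 2) G)
    (c : Config (fun v => lform (H v) f) fun v => lform (G v) g)
    (htr : ∀ z, min (analyticOrderNatAt (lform (H 5) f) z) 3 =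
      min (analyticOrderNatAt (lform (G 5) g) z) 3)
    (hE : ∀ X, EntireNZ X → ∃ E : Frame,
      Adapted E (fun v => lform (H v) f) (fun v => lform (G v) g) ∧
      MainBounds 2 E (fun v => lform (H v) f) (fun v => lform (G v) g) (chr f) (chr g) ∧
      (∀ z, X z = 0 → E.Z z = 0) ∧ ¬ E.Small fun r => chr f r + chr g r) : False := by
  have hrel : ∀ k : Fin (2 * 2 + 2), ∃ α β γ : ℂ,
      H k = α • H 0 + β • H 1 + γ • H 5 ∧ G k = α • G 0 + β • G 1 + γ • G 5 := by
    intro k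
    obtain ⟨α, β, γ, h⟩ := hH.exists_relation (i := 0) (j := 1) (p := 5) (by decide) (by decide)
      (by decide) k
    refine ⟨α, β, γ, h, ?_⟩
    have hs : ∀ K : Fin (2 * 2 + 2) → Fin (2 + 1) → ℂ,
        ∑ v, (Pi.single 0 α + Pi.single 1 β + Pi.single 5 γ - Pi.single k 1 :
          Fin (2 * 2 + 2) → ℂ) v • K v = α • K 0 + β • K 1 + γ • K 5 - K k := fun K => by
      simp [sub_smul, add_smul, Finset.sum_add_distrib, Pi.single_apply, ite_smul]
    have := sum_smul_eq_zero_of_frames (by norm_num) hg (linearIndependent_right_of_not_algDeg hdeg)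
      c hE ((hs H).trans (sub_eq_zero.2 h.symm))
    exact (sub_eq_zero.1 ((hs G).symm.trans this)).symm
  obtain ⟨α₂, β₂, γ₂, hH₂, hG₂⟩ := hrel 2
  obtain ⟨α₃, β₃, γ₃, hH₃, hG₃⟩ := hrel 3
  have hQ := entireNZ_minorQuad_of_not_algDeg hdeg hf.1 hg.1 hH hG hH₂ hH₃ hG₂ hG₃
  obtain ⟨E, a, b, hQZ, hns⟩ := hE _ hQ
  obtain ⟨A, hA, hFA, hGA⟩ := exists_norm_lform_le f g H G
  have e : ∀ {a b c d : Fin (2 + 1) → ℂ} {α β γ : ℂ} (u : Fin (2 + 1) → ℂ → ℂ) (z : ℂ),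
      d = α • a + β • b + γ • c →
        lform d u z = α * lform a u z + β * lform b u z + γ * lform c u z := by
    rintro a b c _ α β γ u z rfl
    simp only [lform, Pi.add_apply, Pi.smul_apply, smul_eq_mul, Finset.mul_sum]
    rw [← Finset.sum_add_distrib, ← Finset.sum_add_distrib]
    exact Finset.sum_congr rfl fun _ _ => by ring
  exact hns (b.small_of_eq_two c a (b.small_ind_last c a hQ hQZ
    (Frame.small_minorQuad_sub_chr hf hg hA hFA hGA hQ hQZ) (fun z => e f z hH₂)
    (fun z => e g z hG₂) (fun z => e f z hH₃) (fun z => e g z hG₃) htr))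

variable {n : ℕ} {f g : Fin (n + 1) → ℂ → ℂ} {H G : Fin (2 * n + 2) → Fin (n + 1) → ℂ}

/-- The theorem for maps whose characteristic functions grow faster than the logarithm. -/
theorem algDeg_of_growth (hn : 2 ≤ n) (hf : ReducedRepr n f) (hg : ReducedRepr n g)
    (hlin : LinearIndependent ℂ f) (hH : GenPos n (2 * n + 2) H) (hG : GenPos n (2 * n + 2) G)
    (hdisj : ∀ v w z, lform (H v) f z = 0 → lform (H w) f z = 0 → v = w)
    (hzero : ∀ v z, lform (H v) f z = 0 ↔ lform (G v) g z = 0)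
    (hcoin : ∀ i v j z, lform (H i) f z = 0 → lform (H j) f z ≠ 0 →
      lform (H v) f z * lform (G j) g z = lform (G v) g z * lform (H j) f z)
    (htr : ∀ z, min (analyticOrderNatAt (lform (H (Fin.last (2 * n + 1))) f) z) (n + 1) =
      min (analyticOrderNatAt (lform (G (Fin.last (2 * n + 1))) g) z) (n + 1))
    (hgrow : ∀ C : ℝ, ∃ r₀, ∀ r, r₀ ≤ r → C * log r ≤ chr f r + chr g r) : AlgDeg f g := by
  by_contra hdeg
  have hlg := linearIndependent_right_of_not_algDeg hdeg
  have c : Config (fun v => lform (H v) f) fun v => lform (G v) g :=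
    ⟨fun v => entireNZ_lform hf.1 hlin (hH.ne_zero v),
      fun v => entireNZ_lform hg.1 hlg (hG.ne_zero v), hdisj, hzero, hcoin,
      fun i j hij => entireNZ_minor_of_not_algDeg hn hdeg hf.1 hg.1 hH hG hij⟩
  have hE := fun X hX => exists_frame_mainBounds (by omega) hf hg hH hG c
    ⟨differentiable_wronskian hf.1, exists_wronskian_ne_zero hf.1 hlin⟩
    ⟨differentiable_wronskian hg.1, exists_wronskian_ne_zero hg.1 hlg⟩
    (fun i j k hij hjk hki => entireNZ_wronskian_triple hn hdeg hf.1 hg.1 hH hG hij hjk hki)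
    hgrow (X := X) hX
  obtain h3 | rfl : 3 ≤ n ∨ n = 2 := by omega
  · obtain ⟨E, a, b, -, hns⟩ := hE _ (c.left 0)
    exact hns (b.small_of_three_le c a h3)
  · exact false_of_frames_of_eq_two hdeg hf hg hH hG c htr hE

end

theorem EntireNZ.vord_eq {F : ℂ → ℂ} (hF : EntireNZ F) (z : ℂ) : vord F z = analyticOrderNatAt F z := by
  have key : ∀ k : ℕ, k ≤ analyticOrderNatAt F z ↔ ∀ i < k, iteratedDeriv i F z = 0 := fun k => by
    rw [hF.le_order_iff, natCast_le_analyticOrderAt_iff_iteratedDeriv_eq_zero (hF.1.analyticAt z)]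
  have hne : {k : ℕ | iteratedDeriv k F z ≠ 0}.Nonempty := by
    by_contra! h
    have := (key (analyticOrderNatAt F z + 1)).2 fun i _ => by
      by_contra hi
      exact Set.eq_empty_iff_forall_notMem.1 h i hi
    omega
  refine le_antisymm ?_ (le_csInf hne fun k hk => ?_)
  · rw [vord]
    by_contra! h
    have := (key (analyticOrderNatAt F z + 1)).2 fun i hi => by
      by_contra hi'
      have : sInf {k : ℕ | iteratedDeriv k F z ≠ 0} ≤ i := Nat.sInf_le hi'
      omega
    omega
  · by_contra! h
    exact hk ((key _).1 le_rfl k h)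

section

variable {n : ℕ} {f g : Fin (n + 1) → ℂ → ℂ}

open Real in
/-- The characteristic function of a map whose image meets a hyperplane infinitely often grows
faster than the logarithm. -/
theorem exists_log_le_chr (hf : ReducedRepr n f) {a : Fin (n + 1) → ℂ} (ha : EntireNZ (lform a f))
    (hinf : {z | lform a f z = 0}.Infinite) (C D : ℝ) :
    ∃ r₀, 1 ≤ r₀ ∧ ∀ r, r₀ ≤ r → C * log r + D ≤ chr f r := by
  obtain ⟨D₀, -, hD⟩ := exists_cnt_le_chr ha hf ha (fun _ h => h) (norm_lform_le a f)
  obtain ⟨m, hm⟩ := exists_nat_ge (C + 1)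
  obtain ⟨s, hs, hcard⟩ := hinf.exists_subset_card_eq m
  set R := 1 + ∑ u ∈ s, ‖u‖ with hR
  have hR1 : 1 ≤ R := le_add_of_nonneg_right (Finset.sum_nonneg fun _ _ => norm_nonneg _)
  have hsR : ∀ u ∈ s, ‖u‖ ≤ R := fun u hu => by
    have := Finset.single_le_sum (f := fun u : ℂ => ‖u‖) (fun _ _ => norm_nonneg _) hu
    linarith
  refine ⟨max R (exp (D + D₀ + m * log R)), hR1.trans (le_max_left _ _), fun r hr => ?_⟩
  have hRr := (le_max_left _ _).trans hr
  have hr1 := hR1.trans hRr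
  have hlog : D + D₀ + m * log R ≤ log r :=
    (le_log_iff_exp_le (zero_lt_one.trans_le hr1)).2 ((le_max_right _ _).trans hr)
  have hlogr := log_nonneg hr1
  set E := cutoff (MeromorphicOn.divisor (lform a f) Set.univ)
    fun z => analyticOrderNatAt (lform a f) z with hE
  have hEz : ∀ z, E z = analyticOrderNatAt (lform a f) z := fun z => by
    change (if MeromorphicOn.divisor (lform a f) Set.univ z = 0 then (0 : ℤ) else _) = _
    rw [ha.divisor_apply]
    split_ifs with h
    · exact h.symm
    · rfl
  have h1 := sum_mul_log_le_logCounting (E := E) (fun z => by rw [hEz]; exact Int.natCast_nonneg _)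
    s hR1 hRr hsR
  have h2 : (m : ℝ) ≤ ∑ u ∈ s, (E u : ℝ) := by
    rw [← hcard, ← nsmul_one, ← Finset.sum_const]
    refine Finset.sum_le_sum fun u hu => ?_
    have h3 : analyticOrderNatAt (lform a f) u ≠ 0 := fun h => ha.order_eq_zero.1 h (hs hu)
    rw [hEz]
    exact_mod_cast Nat.one_le_iff_ne_zero.2 h3
  have h3 : Function.locallyFinsuppWithin.logCounting E r ≤ chr f r + D₀ := hD r hr1
  have h4 := mul_le_mul_of_nonneg_right h2 (sub_nonneg.2 (log_le_log (by linarith) hRr))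
  have h5 := mul_le_mul_of_nonneg_right hm hlogr
  linarith

open Complex

theorem eq_zero_of_comp_exp {u : ℂ → ℂ} (hu : Continuous u) (h : ∀ z, u (exp z) = 0) (z : ℂ) :
    u z = 0 := by
  have hd : Dense ({0}ᶜ : Set ℂ) := dense_compl_singleton 0
  refine congrFun (hu.ext_on hd continuous_const fun w hw => ?_) z
  rw [← exp_log (x := w) hw]
  exact h _

theorem ReducedRepr.comp_exp (hf : ReducedRepr n f) : ReducedRepr n fun i z => f i (exp z) :=
  ⟨fun i => (hf.1 i).comp differentiable_exp, fun z => hf.2 (exp z)⟩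

theorem ReducedRepr.linearIndependent_comp_exp (hf : ReducedRepr n f)
    (hlin : LinearIndependent ℂ f) : LinearIndependent ℂ fun i z => f i (exp z) := by
  refine Fintype.linearIndependent_iff.2 fun a ha => Fintype.linearIndependent_iff.1 hlin a ?_
  ext z
  have := eq_zero_of_comp_exp (differentiable_lform hf.1 a).continuous fun w => by
    simpa [lform] using congrFun ha w
  simpa [lform] using this z

theorem AlgDeg.of_comp_exp (hf : ReducedRepr n f) (hg : ReducedRepr n g)
    (h : AlgDeg (fun i z => f i (exp z)) fun i z => g i (exp z)) : AlgDeg f g := by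
  obtain ⟨Q, h0, h1, h2, h3⟩ := h
  refine ⟨Q, h0, h1, h2, eq_zero_of_comp_exp ?_ h3⟩
  refine (MvPolynomial.continuous_eval Q).comp (continuous_pi fun i => ?_)
  rcases i with i | i
  · exact (hf.1 i).continuous
  · exact (hg.1 i).continuous

theorem analyticOrderNatAt_comp_exp (F : ℂ → ℂ) (z : ℂ) :
    analyticOrderNatAt (fun w => F (exp w)) z = analyticOrderNatAt F (exp z) := by
  have h := analyticOrderAt_comp_of_deriv_ne_zero (f := F) (g := exp) (z₀ := z)
    (differentiable_exp.analyticAt z) (by simp)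
  rw [analyticOrderNatAt, analyticOrderNatAt, ← h]
  rfl

theorem exists_lform_eq_zero (hn : 1 ≤ n) (f : Fin (n + 1) → ℂ → ℂ) (z : ℂ) :
    ∃ a, a ≠ 0 ∧ lform a f z = 0 := by
  have h := LinearMap.ker_ne_bot_of_finrank_lt (f := Fintype.linearCombination ℂ fun i => f i z)
    (by simp; omega)
  obtain ⟨a, ha, ha0⟩ := (Submodule.ne_bot_iff _).1 h
  exact ⟨a, ha0, by simpa [Fintype.linearCombination_apply, lform] using ha⟩

theorem growth_comp_exp (hn : 1 ≤ n) (hf : ReducedRepr n f) (hg : ReducedRepr n g)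
    (hlin : LinearIndependent ℂ f) (hlg : LinearIndependent ℂ g) (C : ℝ) :
    ∃ r₀, ∀ r, r₀ ≤ r → C * Real.log r ≤
      chr (fun i z => f i (exp z)) r + chr (fun i z => g i (exp z)) r := by
  obtain ⟨a, ha, haf⟩ := exists_lform_eq_zero hn f 1
  have h1 := entireNZ_lform hf.comp_exp.1 (hf.linearIndependent_comp_exp hlin) ha
  have h2 := entireNZ_lform hg.comp_exp.1 (hg.linearIndependent_comp_exp hlg) ha
  obtain ⟨D, -, hD⟩ := exists_neg_le_chr hg.comp_exp h2
  obtain ⟨r₀, hr₀, h3⟩ := exists_log_le_chr hf.comp_exp h1 (Set.infinite_of_injective_forall_mem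
    (f := fun k : ℕ => k * (2 * Real.pi * I)) (fun k l h => by
      simpa [Real.pi_ne_zero] using h) fun k => by
      change lform a f (exp (k * (2 * Real.pi * I))) = 0
      rw [exp_nat_mul_two_pi_mul_I, haf]) C D
  exact ⟨r₀, fun r hr => by linarith [h3 r hr, hD r (hr₀.trans hr)]⟩

end

/-- **Theorem of Section 3 (one-variable case).** Two meromorphic maps
`f, g : ℂ → ℙⁿ(ℂ)` (`n ≥ 2`, `f` linearly nondegenerate) sharing two families
`{H_i}` and `{G_i}` of `2n + 2` hyperplanes in general position, in the sense
of conditions (a)–(d), give an algebraically degenerate map `f × g`. -/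
theorem two_families_degenerate
    (n : ℕ) (hn : 2 ≤ n)
    (f g : Fin (n + 1) → ℂ → ℂ)
    (hf : ReducedRepr n f) (hg : ReducedRepr n g)
    (hlin : LinearIndependent ℂ f)
    (H G : Fin (2 * n + 2) → Fin (n + 1) → ℂ)
    (hGPH : GenPos n (2 * n + 2) H) (hGPG : GenPos n (2 * n + 2) G)
    (ha : ∀ i j : Fin (2 * n + 2), i < j →
      ∀ z : ℂ, ¬(lform (H i) f z = 0 ∧ lform (H j) f z = 0))
    (hb : ∀ i : Fin (2 * n + 2), (i : ℕ) < 2 * n + 1 →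
      ∀ z : ℂ, lform (H i) f z = 0 ↔ lform (G i) g z = 0)
    (hc : ∀ z : ℂ, min (vord (lform (H ⟨2 * n + 1, by omega⟩) f) z) (n + 1)
      = min (vord (lform (G ⟨2 * n + 1, by omega⟩) g) z) (n + 1))
    (hd : ∀ v j : Fin (2 * n + 2), ∀ z : ℂ,
      (∃ i : Fin (2 * n + 2), lform (H i) f z = 0) → lform (H j) f z ≠ 0 →
      lform (H v) f z * lform (G j) g z = lform (G v) g z * lform (H j) f z) :
    AlgDeg f g := by
  by_contra hdeg
  have hlg := linearIndependent_right_of_not_algDeg hdeg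
  have hF := fun v => entireNZ_lform hf.1 hlin (hGPH.ne_zero v)
  have hG := fun v => entireNZ_lform hg.1 hlg (hGPG.ne_zero v)
  simp only [(hF _).vord_eq, (hG _).vord_eq] at hc
  have hzero : ∀ v z, lform (H v) f z = 0 ↔ lform (G v) g z = 0 := by
    intro v z
    by_cases hv : (v : ℕ) < 2 * n + 1
    · exact hb v hv z
    · have hv' : v = ⟨2 * n + 1, Nat.lt_succ_self _⟩ := Fin.ext (by simp only; omega)
      rw [hv', ← not_iff_not, ← ne_eq, ← ne_eq, ← (hF _).order_eq_zero, ← (hG _).order_eq_zero]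
      have := hc z
      omega
  have hdisj : ∀ v w z, lform (H v) f z = 0 → lform (H w) f z = 0 → v = w := by
    intro v w z hv hw
    by_contra hne
    rcases lt_or_gt_of_ne hne with h | h
    · exact ha v w h z ⟨hv, hw⟩
    · exact ha w v h z ⟨hw, hv⟩
  refine hdeg (AlgDeg.of_comp_exp hf hg (algDeg_of_growth hn hf.comp_exp hg.comp_exp
    (hf.linearIndependent_comp_exp hlin) hGPH hGPG (fun v w z => hdisj v w (Complex.exp z))
    (fun v z => hzero v (Complex.exp z))
    (fun i v j z hi hj => hd v j (Complex.exp z) ⟨i, hi⟩ hj) (fun z => ?_)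
    (growth_comp_exp (by omega) hf hg hlin hlg)))
  have := hc (Complex.exp z)
  rw [← analyticOrderNatAt_comp_exp, ← analyticOrderNatAt_comp_exp] at this
  exact this
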